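/- arXiv:0806.0097 — 2 statements merged into one kernel-verified Lean document; each statement's English description precedes it below -/
import Mathlib

section
/- Let Ω ⊆ ℂ be a Denjoy domain with Ω ∩ ℝ = ⋃_{n=0}^∞ (a_n, b_n), where (a₀, b₀) = (−∞, 0) and b_n ≤ a_{n+1} for every n. Suppose there is a fixed constant K > 1 such that b_n ≥ K·a_n for every n ≥ 1. Then both the Poincaré metric space (Ω, h_Ω) and the quasihyperbolic metric space (Ω, k_Ω) are Gromov δ-hyperbolic, with δ depending only on K. -/
open Set Metric Filter Complex

noncomputable section

/-- The length of a curve `γ : [0,1] → E` with respect to the conformal density `ρ`. -/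
def curveLen {E : Type*} [NormedAddCommGroup E] [NormedSpace ℝ E]
    (ρ : E → ℝ) (γ : ℝ → E) : ℝ :=
  ∫ t in (0:ℝ)..1, ρ (γ t) * ‖deriv γ t‖

/-- The distance induced on the set `S` by the conformal density `ρ`, defined as the infimum
of the `ρ`-lengths of C¹ curves joining the two points inside `S`. -/
def densityDist {E : Type*} [NormedAddCommGroup E] [NormedSpace ℝ E]
    (S : Set E) (ρ : E → ℝ) (z w : E) : ℝ :=
  sInf { L | ∃ γ : ℝ → E, ContDiffOn ℝ 1 γ (Icc 0 1) ∧ γ 0 = z ∧ γ 1 = w ∧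
      (∀ t ∈ Icc (0:ℝ) 1, γ t ∈ S) ∧ L = curveLen ρ γ }

/-- The quasihyperbolic density `1/δ_Ω(z)` of a domain `Ω`. -/
def qhDensity {E : Type*} [NormedAddCommGroup E] [NormedSpace ℝ E] (Ω : Set E) : E → ℝ :=
  fun z => (Metric.infDist z Ωᶜ)⁻¹

/-- The quasihyperbolic distance of a domain `Ω`. -/
def qhDist {E : Type*} [NormedAddCommGroup E] [NormedSpace ℝ E] (Ω : Set E) : E → E → ℝ :=
  densityDist Ω (qhDensity Ω)

/-- `lam` is the density of the Poincaré (hyperbolic) metric of the plane domain `Ω`: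
it is the pushforward of the density `2/(1-|z|²)` of the unit disk under a holomorphic
universal covering map `p : 𝔻 → Ω`. -/
def IsPoincareDensity (Ω : Set ℂ) (lam : ℂ → ℝ) : Prop :=
  ∃ p : ℂ → ℂ,
    (∀ z ∈ ball (0:ℂ) 1, DifferentiableAt ℂ p z) ∧
    p '' ball (0:ℂ) 1 = Ω ∧
    IsCoveringMapOn (fun z : ball (0:ℂ) 1 => p z) Ω ∧
    ∀ z ∈ ball (0:ℂ) 1, lam (p z) * ‖deriv p z‖ = 2 / (1 - ‖z‖ ^ 2)

/-- `g` is a geodesic in `(S, d)` from `x` to `y`, parametrized by arclength on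
`[0, d x y]`. -/
def IsGeodesicIn {α : Type*} (S : Set α) (d : α → α → ℝ) (g : ℝ → α) (x y : α) : Prop :=
  g 0 = x ∧ g (d x y) = y ∧ (∀ t ∈ Icc (0:ℝ) (d x y), g t ∈ S) ∧
  ∀ s ∈ Icc (0:ℝ) (d x y), ∀ t ∈ Icc (0:ℝ) (d x y), d (g s) (g t) = |s - t|

/-- Every geodesic triangle of `(S, d)` is `δ`-thin (Rips condition). -/
def GromovHyperbolicWith {α : Type*} (S : Set α) (d : α → α → ℝ) (δ : ℝ) : Prop :=
  ∀ x ∈ S, ∀ y ∈ S, ∀ z ∈ S, ∀ gxy gxz gzy : ℝ → α,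
    IsGeodesicIn S d gxy x y → IsGeodesicIn S d gxz x z → IsGeodesicIn S d gzy z y →
    ∀ t ∈ Icc (0:ℝ) (d x y),
      ∃ p ∈ gxz '' Icc (0:ℝ) (d x z) ∪ gzy '' Icc (0:ℝ) (d z y), d (gxy t) p ≤ δ

/-- `(S, d)` is Gromov hyperbolic: some `δ ≥ 0` works for all geodesic triangles. -/
def IsGromovHyperbolic {α : Type*} (S : Set α) (d : α → α → ℝ) : Prop :=
  ∃ δ : ℝ, 0 ≤ δ ∧ GromovHyperbolicWith S d δ

/-- The real axis inside `ℂ`. -/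
def realLine : Set ℂ := {z : ℂ | z.im = 0}

/-- A Denjoy domain: a domain whose boundary is contained in the real axis. -/
def IsDenjoyDomain (Ω : Set ℂ) : Prop :=
  IsOpen Ω ∧ IsConnected Ω ∧ frontier Ω ⊆ realLine

/-- The distance (for the distance function `d`) from a point to a set. -/
def distToSet {α : Type*} (d : α → α → ℝ) (z : α) (A : Set α) : ℝ :=
  sInf (d z '' A)

/-- A fundamental geodesic: a geodesic of `(S, d)` contained in the closed upper half plane,
joining a point of the boundary interval `I` (on the real axis) to a point of the boundary
interval `J`. -/
def IsFundGeodesic (S : Set ℂ) (d : ℂ → ℂ → ℝ) (I J : Set ℝ) (g : ℝ → ℂ) (x y : ℂ) : Prop :=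
  IsGeodesicIn S d g x y ∧ x.im = 0 ∧ x.re ∈ I ∧ y.im = 0 ∧ y.re ∈ J ∧
  ∀ t ∈ Icc (0:ℝ) (d x y), 0 ≤ (g t).im

end

/-- The four-point inequality with additive constant `c`. -/
def FourPoint {α : Type*} (S : Set α) (d : α → α → ℝ) (c : ℝ) : Prop :=
  ∀ x ∈ S, ∀ y ∈ S, ∀ z ∈ S, ∀ w ∈ S,
    d x y + d z w ≤ d x z + d y w + c ∨ d x y + d z w ≤ d x w + d y z + c

/-- `y` is a coarse nearest-point projection of `x` to `S`. -/
def IsGate {α : Type*} (d : α → α → ℝ) (S : Set α) (C : ℝ) (x y : α) : Prop :=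
  y ∈ S ∧ ∀ s ∈ S, d x y + d y s ≤ d x s + C

section FourPoint

variable {α : Type*} {d : α → α → ℝ} {S U L : Set α} {c C : ℝ}

theorem FourPoint.mono {T : Set α} (h : FourPoint S d c) (hT : T ⊆ S) : FourPoint T d c :=
  fun x hx y hy z hz w hw => h x (hT hx) y (hT hy) z (hT hz) w (hT hw)

/-- Points that almost lie between `x` and `z` are close to every geodesic from `x` to `z`. -/
theorem FourPoint.exists_mem_geodesic (h : FourPoint S d c) (hc : 0 ≤ c)
    (hsymm : ∀ x y, d x y = d y x) (hnonneg : ∀ x y, 0 ≤ d x y) {g : ℝ → α} {x z w : α}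
    (hx : x ∈ S) (hz : z ∈ S) (hw : w ∈ S) (hg : IsGeodesicIn S d g x z)
    (hbetween : d x w + d w z ≤ d x z + c) :
    ∃ p ∈ g '' Icc (0:ℝ) (d x z), d w p ≤ 2 * c := by
  obtain ⟨h0, h1, hmem, hdist⟩ := hg
  rcases le_total (d x w) (d x z) with hle | hle
  · have ht : d x w ∈ Icc (0:ℝ) (d x z) := ⟨hnonneg _ _, hle⟩
    refine ⟨g (d x w), mem_image_of_mem _ ht, ?_⟩
    have e1 : d x (g (d x w)) = d x w := by
      have := hdist 0 ⟨le_rfl, hnonneg _ _⟩ _ ht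
      rwa [h0, zero_sub, abs_neg, abs_of_nonneg (hnonneg _ _)] at this
    have e2 : d (g (d x w)) z = d x z - d x w := by
      have := hdist _ ht _ ⟨hnonneg _ _, le_rfl⟩
      rwa [h1, abs_sub_comm, abs_of_nonneg (by linarith)] at this
    have e3 := hsymm z (g (d x w))
    have e4 := hsymm z w
    rcases h w hw _ (hmem _ ht) x hx z hz with h | h
    · rw [hsymm w x, hsymm (g _) z] at h; linarith
    · rw [hsymm (g _) x] at h; linarith
  · refine ⟨g (d x z), mem_image_of_mem _ ⟨hnonneg _ _, le_rfl⟩, ?_⟩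
    rw [h1]; linarith

theorem FourPoint.gromovHyperbolicWith (h : FourPoint S d c) (hc : 0 ≤ c)
    (hsymm : ∀ x y, d x y = d y x) (hnonneg : ∀ x y, 0 ≤ d x y) :
    GromovHyperbolicWith S d (2 * c) := by
  intro x hx y hy z hz gxy gxz gzy hxy hxz hzy t ht
  obtain ⟨h0, h1, hmem, hdist⟩ := hxy
  have hw := hmem t ht
  have e1 : d x (gxy t) = t := by
    have := hdist 0 ⟨le_rfl, hnonneg _ _⟩ _ ht
    rwa [h0, zero_sub, abs_neg, abs_of_nonneg ht.1] at this
  have e2 : d (gxy t) y = d x y - t := by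
    have := hdist _ ht _ ⟨hnonneg _ _, le_rfl⟩
    rwa [h1, abs_sub_comm, abs_of_nonneg (by linarith [ht.2])] at this
  rcases h x hx y hy z hz (gxy t) hw with h' | h'
  · rw [hsymm y, hsymm z] at h'
    obtain ⟨p, hp, hp'⟩ := h.exists_mem_geodesic hc hsymm hnonneg hx hz hw hxz (by linarith)
    exact ⟨p, Or.inl hp, hp'⟩
  · rw [hsymm y] at h'
    obtain ⟨p, hp, hp'⟩ := h.exists_mem_geodesic hc hsymm hnonneg hz hy hw hzy (by linarith)
    exact ⟨p, Or.inr hp, hp'⟩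

/-- A function comparable with a logarithm of a symmetric quasi-metric satisfies the four-point
inequality. -/
theorem fourPoint_of_log_quasimetric {m : α → α → ℝ} {w : α → ℝ} {k A : ℝ} (hk : 1 ≤ k)
    (hpos : ∀ x ∈ S, ∀ y ∈ S, 0 < m x y) (hsymm : ∀ x y, m x y = m y x)
    (htri : ∀ x ∈ S, ∀ y ∈ S, ∀ z ∈ S, m x y ≤ k * max (m x z) (m z y))
    (hlow : ∀ x ∈ S, ∀ y ∈ S, 2 * Real.log (m x y) - w x - w y - A ≤ d x y)
    (hupp : ∀ x ∈ S, ∀ y ∈ S, d x y ≤ 2 * Real.log (m x y) - w x - w y + A) :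
    FourPoint S d (4 * Real.log k + 4 * A) := by
  have hk0 : 0 < k := by linarith
  have key : ∀ x ∈ S, ∀ y ∈ S, ∀ z ∈ S, ∀ M, m x z ≤ M → m z y ≤ M →
      Real.log (m x y) ≤ Real.log k + Real.log M := by
    intro x hx y hy z hz M h h'
    have hM : 0 < M := (hpos x hx z hz).trans_le h
    rw [← Real.log_mul hk0.ne' hM.ne']
    refine Real.log_le_log (hpos x hx y hy) ((htri x hx y hy z hz).trans ?_)
    exact mul_le_mul_of_nonneg_left (max_le h h') hk0.le
  intro x hx y hy z hz v hv
  have l1 := hlow x hx z hz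
  have l2 := hlow y hy v hv
  have l3 := hlow x hx v hv
  have l4 := hlow y hy z hz
  have u1 := hupp x hx y hy
  have u2 := hupp z hz v hv
  have s1 := hsymm x z
  have s2 := hsymm y v
  have s3 := hsymm x v
  have s4 := hsymm y z
  by_cases ha : m x z ≤ m x v ∧ m x z ≤ m y z
  · right
    have := key x hx y hy z hz (m y z) (by linarith) (by linarith)
    have := key z hz v hv x hx (m x v) (by linarith) (by linarith)
    linarith
  by_cases hb : m y v ≤ m x v ∧ m y v ≤ m y z
  · right
    have := key x hx y hy v hv (m x v) (by linarith) (by linarith)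
    have := key z hz v hv y hy (m y z) (by linarith) (by linarith)
    linarith
  left
  rcases le_total (m x v) (m y z) with h | h
  · have h1 : m x v ≤ m x z := by
      by_contra h1; exact ha ⟨by linarith, by linarith⟩
    have h2 : m x v ≤ m y v := by
      by_contra h2; exact hb ⟨by linarith, by linarith⟩
    have := key x hx y hy v hv (m y v) (by linarith) (by linarith)
    have := key z hz v hv x hx (m x z) (by linarith) (by linarith)
    linarith
  · have h1 : m y z ≤ m x z := by
      by_contra h1; exact ha ⟨by linarith, by linarith⟩
    have h2 : m y z ≤ m y v := by
      by_contra h2; exact hb ⟨by linarith, by linarith⟩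
    have := key x hx y hy z hz (m x z) (by linarith) (by linarith)
    have := key z hz v hv y hy (m y v) (by linarith) (by linarith)
    linarith

end FourPoint

section Glue

variable {α : Type*} {d : α → α → ℝ} {S U L : Set α} {c C : ℝ}

theorem FourPoint.exchange_pair (hU : FourPoint U d c) (hsymm : ∀ x y, d x y = d y x)
    (hSU : S ⊆ U) {x z p q : α} (hx : x ∈ U) (hz : z ∈ U) (hp : IsGate d S C x p)
    (hq : IsGate d S C z q) :
    d x p + d p q + d z q ≤ d x z + 2 * C + c ∨ 2 * d p q ≤ 2 * C + c := by
  have h1 := hp.2 q hq.1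
  have h2 := hq.2 p hp.1
  have s1 := hsymm p q
  have s2 := hsymm q p
  rcases hU x hx q (hSU hq.1) z hz p (hSU hp.1) with h | h
  · left; linarith
  · right; linarith [hsymm q z]

/-- Gluing two four-point spaces along a common gated subset. -/
theorem FourPoint.union (hU : FourPoint U d c) (hL : FourPoint L d c) (hc : 0 ≤ c) (hC : 0 ≤ C)
    (hsymm : ∀ x y, d x y = d y x)
    (htri : ∀ x ∈ U ∪ L, ∀ y ∈ U ∪ L, ∀ z ∈ U ∪ L, d x z ≤ d x y + d y z)
    (hSU : S ⊆ U) (hSL : S ⊆ L) (hgate : ∀ x ∈ U ∪ L, ∃ y, IsGate d S C x y)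
    (hcross : ∀ x ∈ U, ∀ y ∈ L, ∃ s ∈ S, d x s + d s y ≤ d x y + 1) :
    FourPoint (U ∪ L) d (4 * c + 20 * C + 20) := by
  choose! g hg using hgate
  have gS : ∀ x ∈ U ∪ L, g x ∈ S := fun x hx => (hg x hx).1
  have F1 : ∀ x ∈ U, ∀ y ∈ L, d x (g x) + d (g x) (g y) + d y (g y) ≤ d x y + 2 * C + 1 := by
    intro x hx y hy
    obtain ⟨s, hs, h⟩ := hcross x hx y hy
    have h1 := (hg x (.inl hx)).2 s hs
    have h2 := (hg y (.inr hy)).2 s hs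
    have h3 := htri (g x) (.inl (hSU (gS x (.inl hx)))) s (.inl (hSU hs)) (g y)
      (.inl (hSU (gS y (.inr hy))))
    linarith [hsymm y s, hsymm s (g y)]
  have F2 : ∀ x ∈ U, ∀ y ∈ L, d x (g y) + d y (g y) ≤ d x y + C + 1 := by
    intro x hx y hy
    obtain ⟨s, hs, h⟩ := hcross x hx y hy
    have h2 := (hg y (.inr hy)).2 s hs
    have h3 := htri x (.inl hx) s (.inl (hSU hs)) (g y) (.inl (hSU (gS y (.inr hy))))
    linarith [hsymm y s, hsymm s (g y)]
  have F3 : ∀ x ∈ U, ∀ y ∈ L, d y (g x) + d x (g x) ≤ d x y + C + 1 := by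
    intro x hx y hy
    obtain ⟨s, hs, h⟩ := hcross x hx y hy
    have h2 := (hg x (.inl hx)).2 s hs
    have h3 := htri y (.inr hy) s (.inl (hSU hs)) (g x) (.inl (hSU (gS x (.inl hx))))
    linarith [hsymm y s, hsymm s (g x)]
  have Ghalf : ∀ V W : Set α, FourPoint V d c → S ⊆ V → V ⊆ U ∪ L → W ⊆ U ∪ L →
      (∀ x ∈ V, ∀ y ∈ W, d x (g y) + d y (g y) ≤ d x y + C + 1) →
      ∀ x ∈ V, ∀ y ∈ V, ∀ z ∈ V, ∀ w ∈ W,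
        d x y + d z w ≤ d x z + d y w + (4 * c + 20 * C + 20) ∨
        d x y + d z w ≤ d x w + d y z + (4 * c + 20 * C + 20) := by
    intro V W hV hSV hVX hWX F x hx y hy z hz w hw
    have h1 := F x hx w hw
    have h2 := F y hy w hw
    have h3 := htri z (hVX hz) (g w) (hVX (hSV (gS w (hWX hw)))) w (hWX hw)
    have h4 := hsymm (g w) w
    rcases hV x hx y hy z hz (g w) (hSV (gS w (hWX hw))) with h | h
    · left; linarith
    · right; linarith
  have G1 := Ghalf U L hU hSU subset_union_left subset_union_right F2
  have G2 := Ghalf L U hL hSL subset_union_right subset_union_left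
    (fun x hx y hy => by have := F3 y hy x hx; rwa [hsymm x y])
  have path : ∀ x ∈ U ∪ L, ∀ y ∈ U ∪ L, d x y ≤ d x (g x) + d (g x) (g y) + d y (g y) := by
    intro x hx y hy
    have hx' : g x ∈ U ∪ L := .inl (hSU (gS x hx))
    have hy' : g y ∈ U ∪ L := .inl (hSU (gS y hy))
    have h1 := htri x hx (g x) hx' y hy
    have h2 := htri (g x) hx' (g y) hy' y hy
    linarith [hsymm y (g y)]
  have H1 : ∀ x ∈ U, ∀ y ∈ U, ∀ z ∈ L, ∀ w ∈ L,
        d x y + d z w ≤ d x z + d y w + (4 * c + 20 * C + 20) ∨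
        d x y + d z w ≤ d x w + d y z + (4 * c + 20 * C + 20) := by
    intro x hx y hy z hz w hw
    have p1 := path x (.inl hx) y (.inl hy)
    have p2 := path z (.inr hz) w (.inr hw)
    have f1 := F1 x hx z hz
    have f2 := F1 y hy w hw
    have f3 := F1 x hx w hw
    have f4 := F1 y hy z hz
    rcases hU _ (hSU (gS x (.inl hx))) _ (hSU (gS y (.inl hy))) _ (hSU (gS z (.inr hz))) _
      (hSU (gS w (.inr hw))) with h | h
    · left; linarith
    · right; linarith
  have H2 : ∀ x ∈ U, ∀ y ∈ L, ∀ z ∈ U, ∀ w ∈ L,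
        d x y + d z w ≤ d x z + d y w + (4 * c + 20 * C + 20) ∨
        d x y + d z w ≤ d x w + d y z + (4 * c + 20 * C + 20) := by
    intro x hx y hy z hz w hw
    have x' : g x ∈ U ∪ L := .inl (hSU (gS x (.inl hx)))
    have y' : g y ∈ U ∪ L := .inl (hSU (gS y (.inr hy)))
    have z' : g z ∈ U ∪ L := .inl (hSU (gS z (.inl hz)))
    have w' : g w ∈ U ∪ L := .inl (hSU (gS w (.inr hw)))
    have p1 := path x (.inl hx) y (.inr hy)
    have p2 := path z (.inl hz) w (.inr hw)
    have f3 := F1 x hx w hw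
    have f4 := F1 z hz y hy
    have s1 := hsymm z y
    have s2 := hsymm (g z) (g y)
    have s3 := hsymm (g z) (g x)
    have s4 := hsymm (g w) (g y)
    have t1 := htri _ y' _ z' _ w'
    have t2 := htri _ z' _ x' _ w'
    have t3 := htri _ x' _ w' _ z'
    have t4 := htri _ w' _ y' _ z'
    rcases hU _ (hSU (gS x (.inl hx))) _ (hSU (gS y (.inr hy))) _ (hSU (gS z (.inl hz))) _
      (hSU (gS w (.inr hw))) with h | h
    · rcases hU.exchange_pair hsymm hSU hx hz (hg x (.inl hx)) (hg z (.inl hz)) with e1 | e1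
      · rcases hL.exchange_pair hsymm hSL hy hw (hg y (.inr hy)) (hg w (.inr hw)) with e2 | e2
        · left; linarith
        · right; linarith
      · right; linarith
    · right; linarith
  rintro x (hx | hx) y (hy | hy) z (hz | hz) w (hw | hw)
  · refine (hU x hx y hy z hz w hw).imp ?_ ?_ <;> intro h <;> linarith
  · exact G1 x hx y hy z hz w hw
  · refine (G1 x hx y hy w hw z hz).symm.imp ?_ ?_ <;> intro h <;>
      linarith [hsymm z w]
  · exact H1 x hx y hy z hz w hw
  · refine (G1 z hz w hw x hx y hy).imp ?_ ?_ <;> intro h <;>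
      linarith [hsymm z x, hsymm w y, hsymm z y, hsymm w x]
  · exact H2 x hx y hy z hz w hw
  · refine (H2 x hx y hy w hw z hz).symm.imp ?_ ?_ <;> intro h <;>
      linarith [hsymm z w]
  · refine (G2 z hz w hw y hy x hx).symm.imp ?_ ?_ <;> intro h <;>
      linarith [hsymm z x, hsymm w y, hsymm z y, hsymm w x, hsymm x y]
  · refine (G1 z hz w hw y hy x hx).symm.imp ?_ ?_ <;> intro h <;>
      linarith [hsymm z x, hsymm w y, hsymm z y, hsymm w x, hsymm x y]
  · refine (H2 y hy x hx z hz w hw).symm.imp ?_ ?_ <;> intro h <;>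
      linarith [hsymm z x, hsymm w y, hsymm z y, hsymm w x, hsymm x y]
  · refine (H2 y hy x hx w hw z hz).imp ?_ ?_ <;> intro h <;>
      linarith [hsymm z x, hsymm w y, hsymm z y, hsymm w x, hsymm x y, hsymm z w]
  · refine (G2 z hz w hw x hx y hy).imp ?_ ?_ <;> intro h <;>
      linarith [hsymm z x, hsymm w y, hsymm z y, hsymm w x, hsymm x y]
  · refine (H1 z hz w hw x hx y hy).imp ?_ ?_ <;> intro h <;>
      linarith [hsymm z x, hsymm w y, hsymm z y, hsymm w x, hsymm x y]
  · refine (G2 x hx y hy w hw z hz).symm.imp ?_ ?_ <;> intro h <;>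
      linarith [hsymm z x, hsymm w y, hsymm z y, hsymm w x, hsymm x y, hsymm z w]
  · exact G2 x hx y hy z hz w hw
  · refine (hL x hx y hy z hz w hw).imp ?_ ?_ <;> intro h <;> linarith

end Glue

/-- Coarse nearest-point projections to `A` are gates with constant `C`. -/
def IsGated {α : Type*} (d : α → α → ℝ) (X A : Set α) (C : ℝ) : Prop :=
  ∀ x ∈ X, ∀ p ∈ A, (∀ s ∈ A, d x p ≤ d x s + 1) → ∀ s ∈ A, d x p + d p s ≤ d x s + C

section Gated

variable {α : Type*} {d : α → α → ℝ} {X A B : Set α} {c C D : ℝ}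

theorem exists_near_minimizer (hnonneg : ∀ x y, 0 ≤ d x y) (hA : A.Nonempty) (x : α) :
    ∃ p ∈ A, ∀ s ∈ A, d x p ≤ d x s + 1 := by
  have hbdd : BddBelow (d x '' A) := ⟨0, by rintro _ ⟨s, -, rfl⟩; exact hnonneg x s⟩
  obtain ⟨_, ⟨p, hp, rfl⟩, h⟩ := exists_lt_of_csInf_lt (hA.image (d x)) (lt_add_one _)
  exact ⟨p, hp, fun s hs => h.le.trans (by gcongr; exact csInf_le hbdd (mem_image_of_mem _ hs))⟩

theorem IsGated.mono (h : IsGated d X A C) (hCD : C ≤ D) : IsGated d X A D :=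
  fun x hx p hp hmin s hs => (h x hx p hp hmin s hs).trans (by gcongr)

/-- A subset containing intermediate points at all distances is gated. -/
theorem FourPoint.isGated_line (h : FourPoint X d c) (hc : 0 ≤ c)
    (hsymm : ∀ x y, d x y = d y x) (hAX : A ⊆ X)
    (hline : ∀ s ∈ A, ∀ t ∈ A, ∀ R, 0 ≤ R → R ≤ d s t → ∃ m ∈ A, d s m = R ∧ d m t = d s t - R) :
    IsGated d X A (2 * c + 4) := by
  intro x hx p hp hmin s hs
  rcases le_total (d p s) (c + 2) with hD | hD
  · linarith [hmin s hs]
  obtain ⟨m, hm, h1, h2⟩ := hline p hp s hs (c + 2) (by linarith) hD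
  have h3 := hmin m hm
  rcases h x hx m (hAX hm) p (hAX hp) s (hAX hs) with h | h
  · linarith
  · linarith [hsymm m p]

theorem IsGated.exchange (h : FourPoint X d c) (hnonneg : ∀ x y, 0 ≤ d x y)
    (hsymm : ∀ x y, d x y = d y x)
    (htri : ∀ x ∈ X, ∀ y ∈ X, ∀ z ∈ X, d x z ≤ d x y + d y z) (hAX : A ⊆ X) (hBX : B ⊆ X)
    (hA : IsGated d X A C) (hB : IsGated d X B C) {a b : α} (ha : a ∈ A) (hb : b ∈ B)
    (hab : d a b ≤ D) {x p s : α} (hx : x ∈ X) (hp : p ∈ A)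
    (hpA : ∀ t ∈ A, d x p ≤ d x t + 1) (hpB : ∀ t ∈ B, d x p ≤ d x t + 1) (hs : s ∈ B) :
    d x p + d p s ≤ d x s + (3 * C + 2 * D + c + 2) := by
  obtain ⟨q, hq, hqmin⟩ := exists_near_minimizer hnonneg ⟨b, hb⟩ x
  have h1 := hA x hx p hp hpA a ha
  have h2 := hB x hx q hq hqmin s hs
  have h3 := hB x hx q hq hqmin b hb
  have h4 := hpB q hq
  have t1 := htri x hx a (hAX ha) b (hBX hb)
  have t2 := htri x hx p (hAX hp) a (hAX ha)
  have t3 := htri a (hAX ha) b (hBX hb) s (hBX hs)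
  have t4 := htri b (hBX hb) q (hBX hq) s (hBX hs)
  have := hsymm b q
  have n1 := hnonneg a b
  have n2 := hpA p hp
  have n3 := hA x hx p hp hpA p hp
  have n4 := hnonneg p p
  rcases h p (hAX hp) s (hBX hs) x hx a (hAX ha) with h | h
  · have := hsymm p x
    have := hsymm s a
    linarith
  · have := hsymm s x
    linarith

theorem IsGated.union (h : FourPoint X d c) (hc : 0 ≤ c) (hC : 0 ≤ C)
    (hnonneg : ∀ x y, 0 ≤ d x y) (hsymm : ∀ x y, d x y = d y x)
    (htri : ∀ x ∈ X, ∀ y ∈ X, ∀ z ∈ X, d x z ≤ d x y + d y z) (hAX : A ⊆ X) (hBX : B ⊆ X)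
    (hA : IsGated d X A C) (hB : IsGated d X B C) {a b : α} (ha : a ∈ A) (hb : b ∈ B)
    (hab : d a b ≤ D) : IsGated d X (A ∪ B) (3 * C + 2 * D + c + 2) := by
  have hD : 0 ≤ D := (hnonneg a b).trans hab
  intro x hx p hp hmin s hs
  have hpA : ∀ t ∈ A, d x p ≤ d x t + 1 := fun t ht => hmin t (.inl ht)
  have hpB : ∀ t ∈ B, d x p ≤ d x t + 1 := fun t ht => hmin t (.inr ht)
  rcases hp with hp | hp <;> rcases hs with hs | hs
  · linarith [hA x hx p hp hpA s hs]
  · exact IsGated.exchange h hnonneg hsymm htri hAX hBX hA hB ha hb hab hx hp hpA hpB hs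
  · exact IsGated.exchange h hnonneg hsymm htri hBX hAX hB hA hb ha (by rwa [hsymm]) hx hp hpB
      hpA hs
  · linarith [hB x hx p hp hpB s hs]

/-- A union of gated sets, each close to one of them, is gated. -/
theorem IsGated.exists_isGate_union_iUnion (h : FourPoint X d c) (hc : 0 ≤ c) (hC : 0 ≤ C)
    (hnonneg : ∀ x y, 0 ≤ d x y) (hsymm : ∀ x y, d x y = d y x)
    (htri : ∀ x ∈ X, ∀ y ∈ X, ∀ z ∈ X, d x z ≤ d x y + d y z) {B : ℕ → Set α} (hAX : A ⊆ X)
    (hBX : ∀ n, B n ⊆ X) (hA : IsGated d X A C) (hB : ∀ n, IsGated d X (B n) C)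
    (hD : ∀ n, ∃ a ∈ A, ∃ b ∈ B n, d a b ≤ D) {x : α} (hx : x ∈ X) :
    ∃ p, IsGate d (A ∪ ⋃ n, B n) (9 * C + 8 * D + 4 * c + 8) x p := by
  have hD0 : 0 ≤ D := by
    obtain ⟨a, -, b, -, h⟩ := hD 0
    exact (hnonneg a b).trans h
  have key : ∀ n m, IsGated d X (A ∪ B n ∪ B m) (9 * C + 8 * D + 4 * c + 8) := by
    intro n m
    obtain ⟨a, ha, b, hb, hab⟩ := hD n
    obtain ⟨a', ha', b', hb', hab'⟩ := hD m
    have h1 := IsGated.union h hc hC hnonneg hsymm htri hAX (hBX n) hA (hB n) ha hb hab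
    have h2 := IsGated.union h hc (by positivity) hnonneg hsymm htri
      (union_subset hAX (hBX n)) (hBX m) h1 ((hB m).mono (by linarith)) (.inl ha') hb' hab'
    exact h2.mono (by linarith)
  have hne : (A ∪ ⋃ n, B n).Nonempty := by
    obtain ⟨a, ha, -⟩ := hD 0
    exact ⟨a, .inl ha⟩
  obtain ⟨p, hp, hmin⟩ := exists_near_minimizer hnonneg hne x
  refine ⟨p, hp, fun s hs => ?_⟩
  have idx : ∀ y ∈ A ∪ ⋃ n, B n, ∃ n, y ∈ A ∪ B n := by
    rintro y (hy | hy)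
    · exact ⟨0, .inl hy⟩
    · obtain ⟨n, hn⟩ := mem_iUnion.1 hy
      exact ⟨n, .inr hn⟩
  obtain ⟨n, hn⟩ := idx p hp
  obtain ⟨m, hm⟩ := idx s hs
  refine key n m x hx p (.inl hn) (fun t ht => hmin t ?_) s ?_
  · rcases ht with (ht | ht) | ht
    · exact .inl ht
    · exact .inr (mem_iUnion.2 ⟨_, ht⟩)
    · exact .inr (mem_iUnion.2 ⟨_, ht⟩)
  · rcases hm with hm | hm
    · exact .inl (.inl hm)
    · exact .inr hm

end Gated

/-- A `C¹` curve in `S` defined on the whole line, resting at `x` before time `0` and at `y`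
after time `1`. -/
structure RestingCurve {E : Type*} [NormedAddCommGroup E] [NormedSpace ℝ E] (S : Set E)
    (x y : E) (η : ℝ → E) : Prop where
  contDiff : ContDiff ℝ 1 η
  left : ∀ t ≤ 0, η t = x
  right : ∀ t, 1 ≤ t → η t = y
  mem : ∀ t, η t ∈ S

section DensityDist

variable {E : Type*} [NormedAddCommGroup E] [NormedSpace ℝ E] {S : Set E} {ρ : E → ℝ}
  {x y z : E} {η : ℝ → E}

theorem densityDist_nonneg (hρ : ∀ z ∈ S, 0 ≤ ρ z) (x y : E) : 0 ≤ densityDist S ρ x y := by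
  refine Real.sInf_nonneg ?_
  rintro _ ⟨γ, -, -, -, hγ, rfl⟩
  refine intervalIntegral.integral_nonneg zero_le_one fun t ht => ?_
  exact mul_nonneg (hρ _ (hγ t ht)) (norm_nonneg _)

theorem bddBelow_curveLen (hρ : ∀ z ∈ S, 0 ≤ ρ z) (x y : E) :
    BddBelow { L | ∃ γ : ℝ → E, ContDiffOn ℝ 1 γ (Icc 0 1) ∧ γ 0 = x ∧ γ 1 = y ∧
      (∀ t ∈ Icc (0:ℝ) 1, γ t ∈ S) ∧ L = curveLen ρ γ } := by
  refine ⟨0, ?_⟩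
  rintro _ ⟨γ, -, -, -, hγ, rfl⟩
  refine intervalIntegral.integral_nonneg zero_le_one fun t ht => ?_
  exact mul_nonneg (hρ _ (hγ t ht)) (norm_nonneg _)

theorem densityDist_le_integral (hρ : ∀ z ∈ S, 0 ≤ ρ z) {γ : ℝ → E} {a b : ℝ} (hab : a ≤ b)
    (hγ : ContDiffOn ℝ 1 γ (Icc a b)) (hS : ∀ t ∈ Icc a b, γ t ∈ S) :
    densityDist S ρ (γ a) (γ b) ≤ ∫ t in a..b, ρ (γ t) * ‖deriv γ t‖ := by
  have hmaps : ∀ t ∈ Icc (0:ℝ) 1, a + (b - a) * t ∈ Icc a b := fun t ht =>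
    ⟨by nlinarith [ht.1, ht.2], by nlinarith [ht.1, ht.2]⟩
  refine (csInf_le (bddBelow_curveLen hρ _ _) ⟨fun t => γ (a + (b - a) * t), ?_, by simp, by simp,
    fun t ht => hS _ (hmaps t ht), rfl⟩).trans_eq ?_
  · exact hγ.comp (by fun_prop) hmaps
  rcases hab.eq_or_lt with rfl | hab'
  · simp [curveLen]
  have hd : ∀ t, deriv (fun t => γ (a + (b - a) * t)) t = (b - a) • deriv γ (a + (b - a) * t) := by
    intro t
    rw [deriv_comp_mul_left (b - a) (fun s => γ (a + s)) t, deriv_comp_const_add]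
  have h := intervalIntegral.smul_integral_comp_add_mul (a := 0) (b := 1)
    (fun t => ρ (γ t) * ‖deriv γ t‖) (b - a) a
  simp only [mul_zero, add_zero, mul_one, add_sub_cancel] at h
  rw [← h, curveLen, smul_eq_mul, ← intervalIntegral.integral_const_mul]
  refine intervalIntegral.integral_congr fun t _ => ?_
  simp only [hd, norm_smul, Real.norm_eq_abs, abs_of_pos (sub_pos.2 hab')]
  ring

theorem RestingCurve.continuous_integrand (hη : RestingCurve S x y η) (hρ : ContinuousOn ρ S) :
    Continuous fun t => ρ (η t) * ‖deriv η t‖ :=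
  (hρ.comp_continuous hη.contDiff.continuous hη.mem).mul
    (hη.contDiff.continuous_deriv le_rfl).norm

theorem RestingCurve.densityDist_le (hη : RestingCurve S x y η) (hρ : ∀ z ∈ S, 0 ≤ ρ z) :
    densityDist S ρ x y ≤ curveLen ρ η := by
  have := densityDist_le_integral hρ zero_le_one hη.contDiff.contDiffOn (fun t _ => hη.mem t)
  rwa [hη.left 0 le_rfl, hη.right 1 le_rfl] at this

/-- Every admissible curve can be reparametrized to a resting curve of the same length. -/
theorem exists_restingCurve_of_contDiffOn (hρ : ContinuousOn ρ S) {γ : ℝ → E}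
    (hγ : ContDiffOn ℝ 1 γ (Icc 0 1)) (hS : ∀ t ∈ Icc (0:ℝ) 1, γ t ∈ S) :
    ∃ η, RestingCurve S (γ 0) (γ 1) η ∧ curveLen ρ η = curveLen ρ γ := by
  set σ := Real.smoothTransition
  have hσI : ∀ t, σ t ∈ Icc (0:ℝ) 1 := fun t =>
    ⟨Real.smoothTransition.nonneg t, Real.smoothTransition.le_one t⟩
  have hσ : ContDiff ℝ 1 σ := Real.smoothTransition.contDiff (n := 1)
  have hσ' : ∀ t, HasDerivAt σ (deriv σ t) t := fun t =>
    (hσ.differentiable one_ne_zero t).hasDerivAt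
  have hσ0 : ∀ t, 0 ≤ deriv σ t := fun t => Real.smoothTransition.monotone.deriv_nonneg
  have hγ' : ∀ t ∈ Icc (0:ℝ) 1, HasDerivWithinAt γ (derivWithin γ (Icc 0 1) t) (Icc 0 1) t :=
    fun t ht => (hγ.differentiableOn one_ne_zero t ht).hasDerivWithinAt
  have hder : ∀ t, deriv (γ ∘ σ) t = deriv σ t • derivWithin γ (Icc 0 1) (σ t) := fun t =>
    ((hγ' _ (hσI t)).scomp_hasDerivAt t (hσ' t) hσI).deriv
  refine ⟨γ ∘ σ, ⟨hγ.comp_contDiff hσ hσI, fun t ht => ?_, fun t ht => ?_,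
    fun t => hS _ (hσI t)⟩, ?_⟩
  · simp [σ, Real.smoothTransition.zero_of_nonpos ht]
  · simp [σ, Real.smoothTransition.one_of_one_le ht]
  have hcont : ContinuousOn (fun t => ρ (γ t) * ‖derivWithin γ (Icc 0 1) t‖) (Icc 0 1) :=
    (hρ.comp hγ.continuousOn hS).mul
      (hγ.continuousOn_derivWithin (uniqueDiffOn_Icc zero_lt_one) le_rfl).norm
  have hsub := intervalIntegral.integral_comp_mul_deriv'' (a := 0) (b := 1) (f := σ)
    (f' := deriv σ) (g := fun t => ρ (γ t) * ‖derivWithin γ (Icc 0 1) t‖)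
    hσ.continuous.continuousOn (fun t _ => (hσ' t).hasDerivWithinAt)
    (hσ.continuous_deriv le_rfl).continuousOn
    (hcont.mono (by rintro _ ⟨t, -, rfl⟩; exact hσI t))
  have e1 : curveLen ρ γ = ∫ t in (0:ℝ)..1, ρ (γ t) * ‖derivWithin γ (Icc 0 1) t‖ := by
    refine intervalIntegral.integral_congr_Ioo_of_le zero_le_one fun t ht => ?_
    simp only [derivWithin_of_mem_nhds (Icc_mem_nhds ht.1 ht.2)]
  rw [e1, show (0:ℝ) = σ 0 by simp [σ], show (1:ℝ) = σ 1 by simp [σ]]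
  simp only [σ, Real.smoothTransition.zero, Real.smoothTransition.one] at hsub ⊢
  rw [← hsub]
  refine intervalIntegral.integral_congr fun t _ => ?_
  have := hder t
  simp only [σ] at this
  simp only [this, norm_smul, Real.norm_eq_abs, abs_of_nonneg (hσ0 t), Function.comp, σ]
  ring

theorem exists_restingCurve (hρ : ContinuousOn ρ S) (hxy : ∃ η, RestingCurve S x y η)
    {r : ℝ} (hr : densityDist S ρ x y < r) :
    ∃ η, RestingCurve S x y η ∧ curveLen ρ η < r := by
  obtain ⟨η₀, h₀⟩ := hxy
  unfold densityDist at hr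
  obtain ⟨_, ⟨γ, hγ, rfl, rfl, hS, rfl⟩, h⟩ := exists_lt_of_csInf_lt
    (by exact ⟨curveLen ρ η₀, η₀, h₀.contDiff.contDiffOn, h₀.left 0 le_rfl, h₀.right 1 le_rfl,
      fun t _ => h₀.mem t, rfl⟩) hr
  obtain ⟨η, hη, e⟩ := exists_restingCurve_of_contDiffOn hρ hγ hS
  exact ⟨η, hη, e ▸ h⟩

theorem RestingCurve.reverse (hη : RestingCurve S x y η) :
    RestingCurve S y x (fun t => η (1 - t)) where
  contDiff := hη.contDiff.comp (by fun_prop)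
  left t ht := hη.right _ (by linarith)
  right t ht := hη.left _ (by linarith)
  mem t := hη.mem _

theorem RestingCurve.const (hx : x ∈ S) : RestingCurve S x x (fun _ => x) :=
  ⟨contDiff_const, fun _ _ => rfl, fun _ _ => rfl, fun _ => hx⟩

theorem RestingCurve.concat {η' : ℝ → E} (h : RestingCurve S x y η) (h' : RestingCurve S y z η') :
    RestingCurve S x z (fun t => η (2 * t) + η' (2 * t - 1) - y) := by
  have e1 : ∀ t ≤ (1 / 2 : ℝ), η (2 * t) + η' (2 * t - 1) - y = η (2 * t) := fun t ht => by
    rw [h'.left (2 * t - 1) (by linarith), add_sub_cancel_right]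
  have e2 : ∀ t : ℝ, 1 / 2 ≤ t → η (2 * t) + η' (2 * t - 1) - y = η' (2 * t - 1) := fun t ht => by
    rw [h.right (2 * t) (by linarith), add_sub_cancel_left]
  refine ⟨?_, fun t ht => ?_, fun t ht => ?_, fun t => ?_⟩
  · exact ((h.contDiff.comp (by fun_prop)).add (h'.contDiff.comp (by fun_prop))).sub contDiff_const
  · rw [e1 t (by linarith), h.left _ (by linarith)]
  · rw [e2 t (by linarith), h'.right _ (by linarith)]
  · rcases le_total t (1 / 2) with ht | ht
    · rw [e1 t ht]; exact h.mem _
    · rw [e2 t ht]; exact h'.mem _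

theorem RestingCurve.curveLen_concat {η' : ℝ → E} (h : RestingCurve S x y η)
    (h' : RestingCurve S y z η') (hρ : ContinuousOn ρ S) :
    curveLen ρ (fun t => η (2 * t) + η' (2 * t - 1) - y) = curveLen ρ η + curveLen ρ η' := by
  have hint := (h.concat h').continuous_integrand hρ
  set θ := fun t => η (2 * t) + η' (2 * t - 1) - y with hθ
  have d1 : ∀ t, deriv (fun t => η (2 * t)) t = (2:ℝ) • deriv η (2 * t) := fun t =>
    deriv_comp_mul_left 2 η t
  have d2 : ∀ t, deriv (fun t => η' (2 * t - 1)) t = (2:ℝ) • deriv η' (2 * t - 1) := fun t => by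
    rw [deriv_comp_mul_left 2 (fun s => η' (s - 1)) t, deriv_comp_sub_const]
  rw [curveLen, ← intervalIntegral.integral_add_adjacent_intervals (b := 1 / 2)
    (hint.intervalIntegrable _ _) (hint.intervalIntegrable _ _)]
  congr 1
  · have := intervalIntegral.smul_integral_comp_mul_left (a := 0) (b := 1 / 2)
      (fun t => ρ (η t) * ‖deriv η t‖) 2
    norm_num at this
    rw [curveLen, ← this, ← intervalIntegral.integral_const_mul]
    refine intervalIntegral.integral_congr_Ioo_of_le (by norm_num) fun t ht => ?_
    have e : θ =ᶠ[nhds t] fun t => η (2 * t) := by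
      filter_upwards [Iio_mem_nhds ht.2] with s hs
      have hs : s < 1 / 2 := hs
      simp only [hθ]
      rw [h'.left (2 * s - 1) (by linarith), add_sub_cancel_right]
    have e0 : η (2 * t) + η' (2 * t - 1) - y = η (2 * t) := e.eq_of_nhds
    simp only [e.deriv_eq, d1, e0, norm_smul]
    norm_num
    ring
  · have := intervalIntegral.smul_integral_comp_mul_sub (a := 1 / 2) (b := 1)
      (fun t => ρ (η' t) * ‖deriv η' t‖) 2 1
    norm_num at this
    rw [curveLen, ← this, ← intervalIntegral.integral_const_mul]
    refine intervalIntegral.integral_congr_Ioo_of_le (by norm_num) fun t ht => ?_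
    have e : θ =ᶠ[nhds t] fun t => η' (2 * t - 1) := by
      filter_upwards [Ioi_mem_nhds ht.1] with s hs
      have hs : 1 / 2 < s := hs
      simp only [hθ]
      rw [h.right (2 * s) (by linarith), add_sub_cancel_left]
    have e0 : η (2 * t) + η' (2 * t - 1) - y = η' (2 * t - 1) := e.eq_of_nhds
    simp only [e.deriv_eq, d2, e0, norm_smul]
    norm_num
    ring

theorem densityDist_triangle (hρ : ContinuousOn ρ S) (hρ0 : ∀ z ∈ S, 0 ≤ ρ z)
    (hxy : ∃ η, RestingCurve S x y η) (hyz : ∃ η, RestingCurve S y z η) :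
    densityDist S ρ x z ≤ densityDist S ρ x y + densityDist S ρ y z := by
  refine le_of_forall_pos_le_add fun ε hε => ?_
  obtain ⟨η, h, hl⟩ := exists_restingCurve hρ hxy (lt_add_of_pos_right _ (half_pos hε))
  obtain ⟨η', h', hl'⟩ := exists_restingCurve hρ hyz (lt_add_of_pos_right _ (half_pos hε))
  have := (h.concat h').densityDist_le hρ0
  rw [h.curveLen_concat h' hρ] at this
  linarith

theorem densityDist_self (hρ0 : ∀ z ∈ S, 0 ≤ ρ z) (hx : x ∈ S) : densityDist S ρ x x = 0 := by
  refine le_antisymm ?_ (densityDist_nonneg hρ0 x x)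
  simpa [curveLen] using (RestingCurve.const hx).densityDist_le hρ0

theorem densityDist_comm (S : Set E) (ρ : E → ℝ) (x y : E) :
    densityDist S ρ x y = densityDist S ρ y x := by
  have key : ∀ x y : E, { L | ∃ γ : ℝ → E, ContDiffOn ℝ 1 γ (Icc 0 1) ∧ γ 0 = x ∧ γ 1 = y ∧
      (∀ t ∈ Icc (0:ℝ) 1, γ t ∈ S) ∧ L = curveLen ρ γ } ⊆
      { L | ∃ γ : ℝ → E, ContDiffOn ℝ 1 γ (Icc 0 1) ∧ γ 0 = y ∧ γ 1 = x ∧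
      (∀ t ∈ Icc (0:ℝ) 1, γ t ∈ S) ∧ L = curveLen ρ γ } := by
    rintro x y _ ⟨γ, h1, h2, h3, h4, rfl⟩
    have hmaps : MapsTo (fun t : ℝ => 1 - t) (Icc (0:ℝ) 1) (Icc 0 1) := fun t ht =>
      ⟨by linarith [ht.2], by linarith [ht.1]⟩
    refine ⟨fun t => γ (1 - t), h1.comp (by fun_prop) hmaps, by simpa using h3, by simpa using h2,
      fun t ht => h4 _ (hmaps ht), ?_⟩
    have := intervalIntegral.integral_comp_sub_left (a := 0) (b := 1)
      (fun t => ρ (γ t) * ‖deriv γ t‖) 1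
    norm_num at this
    rw [curveLen, curveLen, ← this]
    simp only [deriv_comp_const_sub, norm_neg]
  unfold densityDist
  rw [(key x y).antisymm (key y x)]

theorem segment_bound_densityDist {M : ℝ} (hρ0 : ∀ z ∈ S, 0 ≤ ρ z)
    (hρ : ContinuousOn ρ S) (hseg : segment ℝ x y ⊆ S) (hM : ∀ z ∈ segment ℝ x y, ρ z ≤ M) :
    densityDist S ρ x y ≤ M * ‖y - x‖ := by
  have hmem : ∀ t ∈ Icc (0:ℝ) 1, AffineMap.lineMap x y t ∈ segment ℝ x y := fun t ht => by
    rw [segment_eq_image_lineMap]; exact mem_image_of_mem _ ht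
  have hc : ContDiff ℝ 1 (fun t : ℝ => AffineMap.lineMap x y t) := by
    simp only [AffineMap.lineMap_apply_module']; fun_prop
  have hd : ∀ t : ℝ, deriv (fun t : ℝ => AffineMap.lineMap x y t) t = y - x := fun t =>
    AffineMap.hasDerivAt_lineMap.deriv
  have h := densityDist_le_integral hρ0 zero_le_one hc.contDiffOn (fun t ht => hseg (hmem t ht))
  simp only [hd, AffineMap.lineMap_apply_zero, AffineMap.lineMap_apply_one] at h
  refine h.trans ?_
  have hi : IntervalIntegrable (fun t : ℝ => ρ (AffineMap.lineMap x y t) * ‖y - x‖)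
      MeasureTheory.volume 0 1 := by
    refine ContinuousOn.intervalIntegrable ?_
    rw [uIcc_of_le zero_le_one]
    exact (hρ.comp hc.continuous.continuousOn fun t ht => hseg (hmem t ht)).mul continuousOn_const
  have := intervalIntegral.integral_mono_on zero_le_one hi
    (intervalIntegrable_const (c := M * ‖y - x‖)) fun t ht =>
      mul_le_mul_of_nonneg_right (hM _ (hmem t ht)) (norm_nonneg _)
  simpa using this

/-- A function with local slope at most `ρ` increases by at most the `ρ`-distance. -/
theorem sub_le_densityDist (hρ : ContinuousOn ρ S) (hρ0 : ∀ z ∈ S, 0 ≤ ρ z)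
    (hxy : ∃ η, RestingCurve S x y η) {f : E → ℝ} (hf : ContinuousOn f S)
    (hslope : ∀ z ∈ S, ∀ ε > 0, ∀ᶠ w in nhdsWithin z S, f w - f z ≤ (ρ z + ε) * ‖w - z‖) :
    f y - f x ≤ densityDist S ρ x y := by
  refine le_of_forall_gt_imp_ge_of_dense fun r hr => ?_
  obtain ⟨η, h, hl⟩ := exists_restingCurve hρ hxy hr
  refine le_trans ?_ hl.le
  have hint := h.continuous_integrand hρ
  have main := image_le_of_liminf_slope_right_le_deriv_boundary (f := fun t => f (η t) - f x)
    (a := 0) (b := 1) (B := fun t => ∫ s in (0:ℝ)..t, ρ (η s) * ‖deriv η s‖)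
    (B' := fun t => ρ (η t) * ‖deriv η t‖)
    ((hf.comp_continuous h.contDiff.continuous h.mem).sub continuous_const).continuousOn
    (by simp [h.left 0 le_rfl])
    (intervalIntegral.continuous_primitive (fun _ _ => hint.intervalIntegrable _ _) _).continuousOn
    (fun t _ => (hint.integral_hasStrictDerivAt 0 t).hasDerivAt.hasDerivWithinAt) ?_
    (right_mem_Icc.2 zero_le_one)
  · simpa [h.right 1 le_rfl, curveLen] using main
  intro t ht r hr
  have hd : HasDerivAt η (deriv η t) t := (h.contDiff.differentiable one_ne_zero t).hasDerivAt
  obtain ⟨ε, hε, hεr⟩ : ∃ ε > 0, (ρ (η t) + ε) * (‖deriv η t‖ + ε) < r := by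
    have : Tendsto (fun ε : ℝ => (ρ (η t) + ε) * (‖deriv η t‖ + ε)) (nhdsWithin 0 (Ioi 0))
        (nhds ((ρ (η t) + 0) * (‖deriv η t‖ + 0))) := by
      refine Tendsto.mono_left (Continuous.tendsto ?_ 0) nhdsWithin_le_nhds
      fun_prop
    rw [add_zero, add_zero] at this
    obtain ⟨ε, h1, h2⟩ := ((this.eventually (gt_mem_nhds hr)).and self_mem_nhdsWithin).exists
    exact ⟨ε, h2, h1⟩
  have h1 : ∀ᶠ s in nhdsWithin t (Ioi t), ‖slope η t s‖ < ‖deriv η t‖ + ε := by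
    have := (hasDerivWithinAt_iff_tendsto_slope' (s := Ioi t) (by simp)).1
      (hd.hasDerivWithinAt (s := Ioi t))
    exact this.norm.eventually (gt_mem_nhds (by linarith))
  have h2 : ∀ᶠ s in nhdsWithin t (Ioi t),
      f (η s) - f (η t) ≤ (ρ (η t) + ε) * ‖η s - η t‖ := by
    have hc : Tendsto η (nhds t) (nhdsWithin (η t) S) :=
      tendsto_nhdsWithin_iff.2 ⟨h.contDiff.continuous.tendsto t, .of_forall h.mem⟩
    exact (hc.mono_left nhdsWithin_le_nhds).eventually (hslope _ (h.mem t) ε hε)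
  refine Eventually.frequently ?_
  filter_upwards [h1, h2, self_mem_nhdsWithin] with s h1 h2 hs
  have hs : 0 < s - t := sub_pos.2 hs
  have e : ‖η s - η t‖ = (s - t) * ‖slope η t s‖ := by
    rw [slope_def_module, norm_smul, norm_inv, Real.norm_eq_abs, abs_of_pos hs]
    field_simp
  rw [slope_def_field, div_lt_iff₀ hs]
  have hρt := hρ0 _ (h.mem t)
  calc f (η s) - f x - (f (η t) - f x) ≤ (ρ (η t) + ε) * ((s - t) * ‖slope η t s‖) := by
        rw [← e]; linarith
    _ ≤ (ρ (η t) + ε) * ((s - t) * (‖deriv η t‖ + ε)) := by gcongr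
    _ = ((ρ (η t) + ε) * (‖deriv η t‖ + ε)) * (s - t) := by ring
    _ < r * (s - t) := by gcongr

end DensityDist

theorem exists_restingCurve_of_isPreconnected {E : Type*} [NormedAddCommGroup E]
    [NormedSpace ℝ E] {S : Set E} (hS : IsOpen S) (hc : IsPreconnected S) {x y : E} (hx : x ∈ S)
    (hy : y ∈ S) : ∃ η, RestingCurve S x y η := by
  refine hc.induction₂ (fun x y => ∃ η, RestingCurve S x y η) (fun x hx => ?_) ?_ ?_ hx hy
  · obtain ⟨r, hr, hball⟩ := Metric.isOpen_iff.1 hS x hx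
    filter_upwards [mem_nhdsWithin_of_mem_nhds (ball_mem_nhds x hr)] with y hy
    have hc : ContDiff ℝ 1 (fun t : ℝ => AffineMap.lineMap x y t) := by
      simp only [AffineMap.lineMap_apply_module']; fun_prop
    have hmem : ∀ t ∈ Icc (0:ℝ) 1, AffineMap.lineMap x y t ∈ S := fun t ht => by
      refine hball ((convex_ball x r).segment_subset (mem_ball_self hr) hy ?_)
      rw [segment_eq_image_lineMap]; exact mem_image_of_mem _ ht
    obtain ⟨η, hη, -⟩ := exists_restingCurve_of_contDiffOn (ρ := fun _ => 0)
      continuousOn_const hc.contDiffOn hmem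
    rw [AffineMap.lineMap_apply_zero, AffineMap.lineMap_apply_one] at hη
    exact ⟨η, hη⟩
  · rintro x y z - - - ⟨η, h⟩ ⟨η', h'⟩
    exact ⟨_, h.concat h'⟩
  · rintro x y - - ⟨η, h⟩
    exact ⟨_, h.reverse⟩

section Plane

variable {S : Set ℂ} {ρ : ℂ → ℝ} {x y : ℂ}

theorem exists_real_crossing (hρ : ContinuousOn ρ S) (hρ0 : ∀ z ∈ S, 0 ≤ ρ z)
    (hxy : ∃ η, RestingCurve S x y η) (hx : 0 ≤ x.im) (hy : y.im ≤ 0) :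
    ∃ s ∈ S, s.im = 0 ∧
      densityDist S ρ x s + densityDist S ρ s y ≤ densityDist S ρ x y + 1 := by
  obtain ⟨η, h, hl⟩ := exists_restingCurve hρ hxy (lt_add_one _)
  have hc : ContinuousOn (fun t => (η t).im) (Icc 0 1) :=
    (Complex.continuous_im.comp h.contDiff.continuous).continuousOn
  obtain ⟨t, ht, h0⟩ := intermediate_value_Icc' zero_le_one hc
    (show (0:ℝ) ∈ Icc (η 1).im (η 0).im by
      rw [h.left 0 le_rfl, h.right 1 le_rfl]; exact ⟨hy, hx⟩)
  refine ⟨η t, h.mem t, h0, le_trans ?_ hl.le⟩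
  have hint := h.continuous_integrand hρ
  have h1 := densityDist_le_integral hρ0 ht.1 h.contDiff.contDiffOn (fun t _ => h.mem t)
  have h2 := densityDist_le_integral hρ0 ht.2 h.contDiff.contDiffOn (fun t _ => h.mem t)
  rw [h.left 0 le_rfl] at h1
  rw [h.right 1 le_rfl] at h2
  rw [curveLen, ← intervalIntegral.integral_add_adjacent_intervals (b := t)
    (hint.intervalIntegrable _ _) (hint.intervalIntegrable _ _)]
  exact add_le_add h1 h2

open scoped ComplexConjugate in
theorem densityDist_conj (hS : ∀ z ∈ S, conj z ∈ S) (hρ : ∀ z ∈ S, ρ (conj z) = ρ z) (x y : ℂ) :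
    densityDist S ρ (conj x) (conj y) = densityDist S ρ x y := by
  have key : ∀ x y : ℂ, { L | ∃ γ : ℝ → ℂ, ContDiffOn ℝ 1 γ (Icc 0 1) ∧ γ 0 = x ∧ γ 1 = y ∧
      (∀ t ∈ Icc (0:ℝ) 1, γ t ∈ S) ∧ L = curveLen ρ γ } ⊆
      { L | ∃ γ : ℝ → ℂ, ContDiffOn ℝ 1 γ (Icc 0 1) ∧ γ 0 = conj x ∧ γ 1 = conj y ∧
      (∀ t ∈ Icc (0:ℝ) 1, γ t ∈ S) ∧ L = curveLen ρ γ } := by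
    rintro x y _ ⟨γ, h1, rfl, rfl, h4, rfl⟩
    refine ⟨fun t => conj (γ t), ?_, rfl, rfl, fun t ht => hS _ (h4 t ht), ?_⟩
    · exact Complex.conjCLE.contDiff.comp_contDiffOn h1
    · refine intervalIntegral.integral_congr fun t ht => ?_
      rw [uIcc_of_le zero_le_one] at ht
      have : deriv (fun t => conj (γ t)) t = conj (deriv γ t) := deriv.star
      simp only [this, hρ _ (h4 t ht), RCLike.norm_conj]
  unfold densityDist
  congr 1
  refine (Subset.antisymm (key x y) ?_).symm
  simpa using key (conj x) (conj y)

end Plane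

/-- The hypotheses on a Denjoy domain with uniformly big gaps, in a convenient form. -/
structure IsBigGapDomain (Ω : Set ℂ) (a b : ℕ → ℝ) (K : ℝ) : Prop where
  isOpen : IsOpen Ω
  isPreconnected : IsPreconnected Ω
  one_lt : 1 < K
  left_nonneg : ∀ n, 0 ≤ a n
  left_lt_right : ∀ n, a n < b n
  right_le_left : ∀ n, b n ≤ a (n + 1)
  gap : ∀ n, K * a n ≤ b n
  ofReal_mem_iff : ∀ x : ℝ, (x : ℂ) ∈ Ω ↔ x < 0 ∨ ∃ n, a n < x ∧ x < b n
  mem_of_im_ne_zero : ∀ z : ℂ, z.im ≠ 0 → z ∈ Ω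

section BigGapDomain

variable {Ω : Set ℂ} {a b : ℕ → ℝ} {K : ℝ}

theorem isBigGapDomain_of_isDenjoyDomain (hΩ : IsDenjoyDomain Ω) (hK : 1 < K)
    (ha : ∀ n, 0 ≤ a n) (hab : ∀ n, a n < b n) (hba : ∀ n, b n ≤ a (n + 1))
    (hreal : (fun x : ℝ => (x : ℂ)) ⁻¹' Ω = Iio 0 ∪ ⋃ n, Ioo (a n) (b n))
    (hgap : ∀ n, K * a n ≤ b n) : IsBigGapDomain Ω a b K := by
  have hmem : ∀ x : ℝ, (x : ℂ) ∈ Ω ↔ x < 0 ∨ ∃ n, a n < x ∧ x < b n := fun x => by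
    have : x ∈ (fun x : ℝ => (x : ℂ)) ⁻¹' Ω ↔ x ∈ Iio 0 ∪ ⋃ n, Ioo (a n) (b n) := by rw [hreal]
    simpa using this
  obtain ⟨ho, hc, hf⟩ := hΩ
  have h1 : ((-1 : ℝ) : ℂ) ∈ Ω := (hmem _).2 (.inl (by norm_num))
  have hhalf : ∀ H : Set ℂ, IsPreconnected H → (∀ z ∈ H, z.im ≠ 0) → (H ∩ Ω).Nonempty →
      H ⊆ Ω := by
    intro H hH him hne
    refine hH.subset_left_of_subset_union ho isClosed_closure.isOpen_compl
      (disjoint_compl_right.mono_left subset_closure) (fun z hz => ?_) hne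
    by_contra hcon
    rw [mem_union, not_or, notMem_compl_iff] at hcon
    refine him z hz (hf ?_)
    rw [ho.frontier_eq]
    exact ⟨hcon.2, hcon.1⟩
  obtain ⟨r, hr, hball⟩ := Metric.isOpen_iff.1 ho _ h1
  have hnear : ∀ s : ℝ, |s| < r → (⟨-1, s⟩ : ℂ) ∈ Ω := fun s hs => hball (by
    rw [mem_ball, dist_eq]
    convert hs using 1
    rw [show (⟨-1, s⟩ : ℂ) - ((-1 : ℝ) : ℂ) = s * I by apply Complex.ext <;> simp]
    simp)
  refine ⟨ho, hc.isPreconnected, hK, ha, hab, hba, hgap, hmem, fun z hz => ?_⟩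
  rcases hz.lt_or_gt with hz | hz
  · refine hhalf {z | z.im < 0} (convex_halfSpace_im_lt 0).isPreconnected (fun z hz => ne_of_lt hz)
      ⟨⟨-1, -(r / 2)⟩, ?_, hnear _ ?_⟩ hz
    · show -(r / 2) < 0; linarith
    · rw [abs_neg, abs_of_pos] <;> linarith
  · refine hhalf {z | 0 < z.im} (convex_halfSpace_im_gt 0).isPreconnected (fun z hz => ne_of_gt hz)
      ⟨⟨-1, r / 2⟩, ?_, hnear _ ?_⟩ hz
    · show 0 < r / 2; linarith
    · rw [abs_of_pos] <;> linarith

namespace IsBigGapDomain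

open scoped ComplexConjugate

theorem conj_mem (h : IsBigGapDomain Ω a b K) {z : ℂ} (hz : z ∈ Ω) : conj z ∈ Ω := by
  by_cases him : z.im = 0
  · rwa [conj_eq_iff_im.2 him]
  · exact h.mem_of_im_ne_zero _ (by simpa using him)

theorem exists_restingCurve (h : IsBigGapDomain Ω a b K) {x y : ℂ} (hx : x ∈ Ω) (hy : y ∈ Ω) :
    ∃ η, RestingCurve Ω x y η :=
  exists_restingCurve_of_isPreconnected h.isOpen h.isPreconnected hx hy

/-- Hyperbolicity of the whole domain follows from the four-point inequality on the upper half and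
the existence of coarse projections onto the real part. -/
theorem gromovHyperbolicWith (h : IsBigGapDomain Ω a b K) {ρ : ℂ → ℝ} (hρ : ContinuousOn ρ Ω)
    (hρ0 : ∀ z ∈ Ω, 0 ≤ ρ z) (hconj : ∀ z ∈ Ω, ρ (conj z) = ρ z) {c C : ℝ} (hc : 0 ≤ c)
    (hC : 0 ≤ C) (hU : FourPoint {z ∈ Ω | 0 ≤ z.im} (densityDist Ω ρ) c)
    (hgate : ∀ x ∈ Ω, 0 ≤ x.im → ∃ y, IsGate (densityDist Ω ρ) {z ∈ Ω | z.im = 0} C x y) :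
    GromovHyperbolicWith Ω (densityDist Ω ρ) (2 * (4 * c + 20 * C + 20)) := by
  have hd := densityDist_conj (fun z hz => h.conj_mem hz) hconj
  have hL : FourPoint {z ∈ Ω | z.im ≤ 0} (densityDist Ω ρ) c := by
    intro x hx y hy z hz w hw
    have hmem : ∀ x ∈ {z ∈ Ω | z.im ≤ 0}, conj x ∈ {z ∈ Ω | 0 ≤ z.im} := fun x hx =>
      ⟨h.conj_mem hx.1, by simpa using hx.2⟩
    have := hU _ (hmem x hx) _ (hmem y hy) _ (hmem z hz) _ (hmem w hw)
    simpa only [hd] using this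
  have hunion : {z ∈ Ω | 0 ≤ z.im} ∪ {z ∈ Ω | z.im ≤ 0} = Ω := by
    ext z
    constructor
    · rintro (hz | hz) <;> exact hz.1
    · exact fun hz => (le_total 0 z.im).imp (fun h => ⟨hz, h⟩) (fun h => ⟨hz, h⟩)
  have h4 : FourPoint Ω (densityDist Ω ρ) (4 * c + 20 * C + 20) := by
    suffices FourPoint ({z ∈ Ω | 0 ≤ z.im} ∪ {z ∈ Ω | z.im ≤ 0}) (densityDist Ω ρ)
        (4 * c + 20 * C + 20) by rwa [hunion] at this
    refine hU.union (S := {z ∈ Ω | z.im = 0}) hL hc hC (densityDist_comm Ω ρ) ?_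
      (fun z hz => ⟨hz.1, hz.2.ge⟩) (fun z hz => ⟨hz.1, hz.2.le⟩) ?_ ?_
    · rw [hunion]
      intro x hx y hy z hz
      exact densityDist_triangle hρ hρ0 (h.exists_restingCurve hx hy) (h.exists_restingCurve hy hz)
    · rw [hunion]
      intro x hx
      rcases le_total 0 x.im with him | him
      · exact hgate x hx him
      · obtain ⟨y, hy, hy'⟩ := hgate (conj x) (h.conj_mem hx) (by simpa using him)
        refine ⟨y, hy, fun s hs => ?_⟩
        have := hy' s hs
        rwa [← hd (conj x) y, ← hd (conj x) s, conj_conj, conj_eq_iff_im.2 hy.2,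
          conj_eq_iff_im.2 hs.2] at this
    · intro x hx y hy
      obtain ⟨s, hs, h0, h1⟩ := exists_real_crossing hρ hρ0 (h.exists_restingCurve hx.1 hy.1)
        hx.2 hy.2
      exact ⟨s, ⟨hs, h0⟩, h1⟩
  exact h4.gromovHyperbolicWith (by positivity) (densityDist_comm Ω ρ) (densityDist_nonneg hρ0)

end IsBigGapDomain

end BigGapDomain

/-- Length estimate by a primitive of an upper bound of the integrand. -/
theorem densityDist_le_sub {E : Type*} [NormedAddCommGroup E] [NormedSpace ℝ E] {S : Set E}
    {ρ : E → ℝ} (hρ : ContinuousOn ρ S) (hρ0 : ∀ z ∈ S, 0 ≤ ρ z) {γ : ℝ → E} {a b : ℝ}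
    (hab : a ≤ b) {F F' : ℝ → ℝ} {γ' : ℝ → E} (hγ' : ∀ t, HasDerivAt γ (γ' t) t)
    (hγc : Continuous γ') (hS : ∀ t ∈ Icc a b, γ t ∈ S) (hF : ∀ t, HasDerivAt F (F' t) t)
    (hFc : Continuous F') (hle : ∀ t ∈ Icc a b, ρ (γ t) * ‖γ' t‖ ≤ F' t) :
    densityDist S ρ (γ a) (γ b) ≤ F b - F a := by
  have hd : deriv γ = γ' := funext fun t => (hγ' t).deriv
  have hγ : ContDiff ℝ 1 γ :=
    contDiff_one_iff_deriv.2 ⟨fun t => (hγ' t).differentiableAt, by rwa [hd]⟩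
  refine (densityDist_le_integral hρ0 hab hγ.contDiffOn hS).trans ?_
  rw [← intervalIntegral.integral_eq_sub_of_hasDerivAt (fun t _ => hF t)
    (hFc.intervalIntegrable _ _), hd]
  refine intervalIntegral.integral_mono_on hab ?_ (hFc.intervalIntegrable _ _) hle
  refine ContinuousOn.intervalIntegrable ?_
  rw [uIcc_of_le hab]
  exact (hρ.comp hγ.continuous.continuousOn hS).mul hγc.norm.continuousOn

theorem log_sub_log_le {u v : ℝ} (hu : 0 < u) (hv : 0 < v) :
    Real.log v - Real.log u ≤ (v - u) / u := by
  rw [← Real.log_div hv.ne' hu.ne']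
  refine (Real.log_le_sub_one_of_pos (div_pos hv hu)).trans_eq ?_
  field_simp

namespace IsBigGapDomain

open scoped ComplexConjugate

variable {Ω : Set ℂ} {a b : ℕ → ℝ} {K : ℝ} {x y z : ℂ}

theorem zero_notMem (h : IsBigGapDomain Ω a b K) : (0 : ℂ) ∉ Ω := by
  rw [← ofReal_zero, h.ofReal_mem_iff]
  rintro (h0 | ⟨n, h1, -⟩)
  · exact lt_irrefl _ h0
  · exact (h.left_nonneg n).not_gt h1

theorem compl_nonempty (h : IsBigGapDomain Ω a b K) : Ωᶜ.Nonempty := ⟨0, h.zero_notMem⟩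

theorem exists_eq_ofReal (h : IsBigGapDomain Ω a b K) (hz : z ∉ Ω) :
    ∃ s : ℝ, z = s ∧ 0 ≤ s ∧ ∀ n, s ≤ a n ∨ b n ≤ s := by
  have him : z.im = 0 := by
    by_contra him; exact hz (h.mem_of_im_ne_zero z him)
  have hz' : z = (z.re : ℂ) := by apply Complex.ext <;> simp [him]
  rw [hz', h.ofReal_mem_iff, not_or, not_lt, not_exists] at hz
  refine ⟨z.re, hz', hz.1, fun n => ?_⟩
  by_contra hcon
  rw [not_or, not_le, not_le] at hcon
  exact hz.2 n hcon

theorem le_infDist (h : IsBigGapDomain Ω a b K) {r : ℝ}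
    (hr : ∀ s : ℝ, 0 ≤ s → (∀ n, s ≤ a n ∨ b n ≤ s) → r ≤ ‖z - s‖) : r ≤ infDist z Ωᶜ := by
  rw [Metric.le_infDist h.compl_nonempty]
  intro w hw
  obtain ⟨s, rfl, h0, h1⟩ := h.exists_eq_ofReal hw
  rw [dist_eq]
  exact hr s h0 h1

theorem infDist_pos (h : IsBigGapDomain Ω a b K) (hz : z ∈ Ω) : 0 < infDist z Ωᶜ :=
  (h.isOpen.isClosed_compl.notMem_iff_infDist_pos h.compl_nonempty).1 (by simpa using hz)

theorem abs_im_le_infDist (h : IsBigGapDomain Ω a b K) (z : ℂ) : |z.im| ≤ infDist z Ωᶜ :=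
  h.le_infDist fun s _ _ => by simpa using Complex.abs_im_le_norm (z - s)

theorem infDist_conj (h : IsBigGapDomain Ω a b K) (z : ℂ) :
    infDist (conj z) Ωᶜ = infDist z Ωᶜ := by
  have key : ∀ z : ℂ, infDist z Ωᶜ ≤ infDist (conj z) Ωᶜ := fun z => by
    rw [Metric.le_infDist h.compl_nonempty]
    intro w hw
    have hw' : conj w ∈ Ωᶜ := fun hc => hw (by simpa using h.conj_mem hc)
    refine (infDist_le_dist_of_mem hw').trans_eq ?_
    · rw [dist_eq, dist_eq, ← RCLike.norm_conj (conj z - w), map_sub, conj_conj]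
  refine le_antisymm ?_ (key z)
  simpa using key (conj z)

theorem sqrt_le_infDist_add (h : IsBigGapDomain Ω a b K) (hz : 0 ≤ z.im) {t : ℝ} (ht : 0 ≤ t) :
    √(infDist z Ωᶜ ^ 2 + t ^ 2) ≤ infDist (z + t * I) Ωᶜ := by
  rw [Metric.le_infDist h.compl_nonempty]
  intro w hw
  obtain ⟨s, rfl, -, -⟩ := h.exists_eq_ofReal hw
  have h1 : infDist z Ωᶜ ≤ ‖z - s‖ := by
    rw [← dist_eq]; exact infDist_le_dist_of_mem hw
  refine Real.sqrt_le_iff.2 ⟨dist_nonneg, ?_⟩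
  have h2 : infDist z Ωᶜ ^ 2 ≤ ‖z - s‖ ^ 2 := pow_le_pow_left₀ infDist_nonneg h1 2
  rw [dist_eq]
  rw [← Complex.normSq_eq_norm_sq, Complex.normSq_apply] at h2 ⊢
  simp at h2 ⊢
  nlinarith [mul_nonneg hz ht]

theorem neg_re_le_infDist (h : IsBigGapDomain Ω a b K) (t : ℝ) : -t ≤ infDist (t : ℂ) Ωᶜ :=
  h.le_infDist fun s hs _ => by
    rw [← ofReal_sub, norm_real, Real.norm_eq_abs, abs_sub_comm]
    exact le_trans (by linarith) (le_abs_self _)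

theorem min_le_infDist (h : IsBigGapDomain Ω a b K) (t : ℝ) (n : ℕ) :
    min (t - a n) (b n - t) ≤ infDist (t : ℂ) Ωᶜ :=
  h.le_infDist fun s _ hs => by
    rw [← ofReal_sub, norm_real, Real.norm_eq_abs]
    rcases hs n with hs | hs
    · exact (min_le_left _ _).trans (le_trans (by linarith) (le_abs_self _))
    · exact (min_le_right _ _).trans (le_trans (by linarith) (neg_le_abs _))

theorem continuousOn_qhDensity (h : IsBigGapDomain Ω a b K) : ContinuousOn (qhDensity Ω) Ω :=
  (continuous_infDist_pt _).continuousOn.inv₀ fun _ hz => (h.infDist_pos hz).ne'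

theorem qhDensity_nonneg (z : ℂ) : 0 ≤ qhDensity Ω z := inv_nonneg.2 infDist_nonneg

theorem qhDist_vertical_le (h : IsBigGapDomain Ω a b K) (hx : x ∈ Ω) (hx0 : 0 ≤ x.im) {r : ℝ}
    (hr : 0 ≤ r) : qhDist Ω x (x + r * I) ≤
      Real.log (infDist x Ωᶜ + 2 * r) - Real.log (infDist x Ωᶜ) := by
  set δ := infDist x Ωᶜ with hδ
  have hpos : 0 < δ := h.infDist_pos hx
  have hsq : ∀ t : ℝ, 0 < √(δ ^ 2 + t ^ 2) := fun t => Real.sqrt_pos.2 (by positivity)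
  have hmem : ∀ t ∈ Icc 0 r, x + t * I ∈ Ω := fun t ht => by
    by_contra hcon
    have := (hsq t).trans_le (h.sqrt_le_infDist_add hx0 ht.1)
    rw [infDist_zero_of_mem hcon] at this
    exact lt_irrefl _ this
  have hsqrt : ∀ t : ℝ, √(1 + (t / δ) ^ 2) = √(δ ^ 2 + t ^ 2) / δ := fun t => by
    rw [← Real.sqrt_sq hpos.le, ← Real.sqrt_div (by positivity), Real.sqrt_sq hpos.le]
    congr 1; field_simp
  have main := densityDist_le_sub (ρ := qhDensity Ω) h.continuousOn_qhDensity
    (fun z _ => qhDensity_nonneg z) hr (γ := fun t : ℝ => x + t * I) (γ' := fun _ => I)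
    (F := fun t => Real.arsinh (t / δ)) (F' := fun t => (√(1 + (t / δ) ^ 2))⁻¹ * (1 / δ))
    (fun t => by
      simpa using ((Complex.ofRealCLM.hasDerivAt (x := t)).mul_const I).const_add x)
    continuous_const hmem
    (fun t => (Real.hasDerivAt_arsinh _).comp t ((hasDerivAt_id t).div_const δ))
    ((Continuous.inv₀ (by fun_prop) fun t => (Real.sqrt_pos.2 (by positivity)).ne').mul
      continuous_const) (fun t ht => by
        rw [hsqrt, norm_I, mul_one, inv_div, div_mul_div_comm, mul_one,
          mul_comm (√(δ ^ 2 + t ^ 2)), div_mul_cancel_left₀ hpos.ne', qhDensity]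
        exact inv_anti₀ (hsq t) (h.sqrt_le_infDist_add hx0 ht.1))
  simp only [ofReal_zero, zero_mul, add_zero, zero_div, Real.arsinh_zero, sub_zero] at main
  refine main.trans ?_
  rw [← Real.log_div (by positivity) hpos.ne', Real.arsinh]
  refine Real.log_le_log ?_ ?_
  · positivity
  · rw [hsqrt, ← add_div]
    have : √(δ ^ 2 + r ^ 2) ≤ δ + r := Real.sqrt_le_iff.2 ⟨by positivity, by nlinarith⟩
    exact div_le_div_of_nonneg_right (by linarith) hpos.le

/-- Up to an additive constant, the quasihyperbolic distance between points of the closed upper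
half plane is at most a logarithmic expression in their distance and their boundary distances. -/
theorem qhDist_le_log (h : IsBigGapDomain Ω a b K) (hx : x ∈ Ω) (hx0 : 0 ≤ x.im) (hy : y ∈ Ω)
    (hy0 : 0 ≤ y.im) :
    qhDist Ω x y ≤ 2 * Real.log (‖x - y‖ + infDist x Ωᶜ + infDist y Ωᶜ)
      - Real.log (infDist x Ωᶜ) - Real.log (infDist y Ωᶜ) + 3 := by
  have px := h.infDist_pos hx
  have py := h.infDist_pos hy
  have l2 := Real.log_two_lt_d9
  rcases eq_or_ne x y with rfl | hne
  · rw [qhDist, densityDist_self (fun z _ => qhDensity_nonneg z) hx, sub_self, norm_zero, zero_add]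
    have := Real.log_le_log px (by linarith : infDist x Ωᶜ ≤ infDist x Ωᶜ + infDist x Ωᶜ)
    linarith
  set r := ‖x - y‖ with hr
  have hr0 : 0 < r := norm_sub_pos_iff.2 hne
  have hup : ∀ z : ℂ, r ≤ z.im → z ∈ Ω ∧ qhDensity Ω z ≤ r⁻¹ := fun z hz =>
    ⟨h.mem_of_im_ne_zero z (by linarith), inv_anti₀ hr0
      (hz.trans ((le_abs_self _).trans (h.abs_im_le_infDist z)))⟩
  have hseg : ∀ z ∈ segment ℝ (x + r * I) (y + r * I), r ≤ z.im := by
    refine (convex_halfSpace_im_ge r).segment_subset ?_ ?_ <;> simpa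
  have hmx : x + r * I ∈ Ω := (hup _ (by simpa)).1
  have hmy : y + r * I ∈ Ω := (hup _ (by simpa)).1
  have d1 := h.qhDist_vertical_le hx hx0 hr0.le
  have d2 := h.qhDist_vertical_le hy hy0 hr0.le
  have d3 : qhDist Ω (x + r * I) (y + r * I) ≤ 1 := by
    refine (segment_bound_densityDist (fun z _ => qhDensity_nonneg z) h.continuousOn_qhDensity
      (fun z hz => (hup z (hseg z hz)).1) (fun z hz => (hup z (hseg z hz)).2)).trans_eq ?_
    rw [add_sub_add_right_eq_sub, norm_sub_rev, ← hr, inv_mul_cancel₀ hr0.ne']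
  have tri := fun x y z (hx : x ∈ Ω) (hy : y ∈ Ω) (hz : z ∈ Ω) =>
    densityDist_triangle h.continuousOn_qhDensity (fun z _ => qhDensity_nonneg z)
      (h.exists_restingCurve hx hy) (h.exists_restingCurve hy hz)
  have t1 := tri x (x + r * I) y hx hmx hy
  have t2 := tri (x + r * I) (y + r * I) y hmx hmy hy
  rw [densityDist_comm Ω _ (y + r * I) y] at t2
  have e1 : Real.log (infDist x Ωᶜ + 2 * r) ≤
      Real.log 2 + Real.log (r + infDist x Ωᶜ + infDist y Ωᶜ) := by
    rw [← Real.log_mul two_ne_zero (by positivity)]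
    exact Real.log_le_log (by positivity) (by linarith)
  have e2 : Real.log (infDist y Ωᶜ + 2 * r) ≤
      Real.log 2 + Real.log (r + infDist x Ωᶜ + infDist y Ωᶜ) := by
    rw [← Real.log_mul two_ne_zero (by positivity)]
    exact Real.log_le_log (by positivity) (by linarith)
  unfold qhDist at *
  linarith

theorem log_le_qhDist (h : IsBigGapDomain Ω a b K) (hx : x ∈ Ω) (hy : y ∈ Ω) :
    2 * Real.log (‖x - y‖ + infDist x Ωᶜ + infDist y Ωᶜ)
      - Real.log (infDist x Ωᶜ) - Real.log (infDist y Ωᶜ) - 3 ≤ qhDist Ω x y := by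
  have px := h.infDist_pos hx
  have py := h.infDist_pos hy
  set p := infDist x Ωᶜ with hp
  set q := infDist y Ωᶜ with hq
  set r := ‖x - y‖ with hr
  have hr0 : 0 ≤ r := norm_nonneg _
  have hpq : p ≤ q + r := by rw [hr, ← dist_eq]; exact infDist_le_infDist_add_dist
  have hqp : q ≤ p + r := by
    rw [hr, ← dist_eq, dist_comm]; exact infDist_le_infDist_add_dist
  have hk : ∀ w, 0 < p + min ‖w - x‖ (r / 2) := fun w => by positivity
  have hl : ∀ w, 0 < q + min ‖w - y‖ (r / 2) := fun w => by positivity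
  have main := sub_le_densityDist h.continuousOn_qhDensity (fun z _ => qhDensity_nonneg z)
    (h.exists_restingCurve hx hy)
    (f := fun w => Real.log (p + min ‖w - x‖ (r / 2)) - Real.log (q + min ‖w - y‖ (r / 2)))
    (Continuous.continuousOn (by
      refine (Continuous.log (by fun_prop) fun w => (hk w).ne').sub
        (Continuous.log (by fun_prop) fun w => (hl w).ne'))) ?_
  · have e : ‖y - x‖ = r := norm_sub_rev _ _
    simp only [sub_self, norm_zero, e, ← hr, min_eq_right (half_le_self hr0)] at main
    have e0 : min 0 (r / 2) = 0 := min_eq_left (by positivity)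
    rw [e0, add_zero, add_zero] at main
    have l2 := Real.log_two_lt_d9
    have b1 : Real.log (r + p + q) ≤ 2 * Real.log 2 + Real.log (p + r / 2) := by
      rw [← Nat.cast_two, ← Real.log_pow, Nat.cast_two, ← Real.log_mul (by norm_num) (by positivity)]
      exact Real.log_le_log (by positivity) (by linarith)
    have b2 : Real.log (r + p + q) ≤ 2 * Real.log 2 + Real.log (q + r / 2) := by
      rw [← Nat.cast_two, ← Real.log_pow, Nat.cast_two, ← Real.log_mul (by norm_num) (by positivity)]
      exact Real.log_le_log (by positivity) (by linarith)
    unfold qhDist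
    linarith
  intro z hz ε hε
  have hzpos := h.infDist_pos hz
  rcases lt_or_ge ‖z - x‖ (r / 2) with hlt | hge
  · have hzy : r / 2 < ‖z - y‖ := by
      have : r ≤ ‖z - x‖ + ‖z - y‖ := by
        rw [hr, norm_sub_rev z x]
        simpa using norm_add_le (x - z) (z - y)
      linarith
    have hev : ∀ᶠ w in nhds z, r / 2 < ‖w - y‖ :=
      (Continuous.continuousAt (by fun_prop : Continuous fun w => ‖w - y‖)).eventually
        (lt_mem_nhds hzy)
    filter_upwards [mem_nhdsWithin_of_mem_nhds hev] with w hw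
    have hwz : p + min ‖w - x‖ (r / 2) - (p + min ‖z - x‖ (r / 2)) ≤ ‖w - z‖ := by
      rw [min_eq_left hlt.le]
      have : ‖w - x‖ ≤ ‖w - z‖ + ‖z - x‖ := by simpa using norm_add_le (w - z) (z - x)
      linarith [min_le_left ‖w - x‖ (r / 2)]
    have hδ : infDist z Ωᶜ ≤ p + min ‖z - x‖ (r / 2) := by
      rw [min_eq_left hlt.le, ← dist_eq]
      exact infDist_le_infDist_add_dist
    rw [min_eq_right hw.le, min_eq_right hzy.le, sub_sub_sub_cancel_right]
    refine (log_sub_log_le (hk z) (hk w)).trans ?_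
    rw [div_eq_inv_mul]
    have h1 : (p + min ‖z - x‖ (r / 2))⁻¹ ≤ qhDensity Ω z := inv_anti₀ hzpos hδ
    calc _ ≤ (p + min ‖z - x‖ (r / 2))⁻¹ * ‖w - z‖ := by
          gcongr
      _ ≤ _ := by gcongr; linarith
  · have hev : ∀ᶠ w in nhdsWithin z Ω, qhDensity Ω w < qhDensity Ω z + ε :=
      (h.continuousOn_qhDensity z hz).eventually (gt_mem_nhds (by linarith))
    filter_upwards [hev, self_mem_nhdsWithin] with w hw hwΩ
    have hwpos := h.infDist_pos hwΩ
    have h1 : Real.log (p + min ‖w - x‖ (r / 2)) ≤ Real.log (p + min ‖z - x‖ (r / 2)) := by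
      refine Real.log_le_log (hk w) ?_
      rw [min_eq_right hge]
      gcongr
      exact min_le_right _ _
    have hq0 := qhDensity_nonneg (Ω := Ω) z
    suffices Real.log (q + min ‖z - y‖ (r / 2)) - Real.log (q + min ‖w - y‖ (r / 2)) ≤
      (qhDensity Ω z + ε) * ‖w - z‖ by linarith
    rcases le_total ‖w - y‖ (r / 2) with hwy | hwy
    · refine (log_sub_log_le (hl w) (hl z)).trans ?_
      rw [div_eq_inv_mul]
      have hδ : infDist w Ωᶜ ≤ q + min ‖w - y‖ (r / 2) := by
        rw [min_eq_left hwy, ← dist_eq]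
        exact infDist_le_infDist_add_dist
      have h2 : (q + min ‖w - y‖ (r / 2))⁻¹ ≤ qhDensity Ω w := inv_anti₀ hwpos hδ
      have hwz : q + min ‖z - y‖ (r / 2) - (q + min ‖w - y‖ (r / 2)) ≤ ‖w - z‖ := by
        rw [min_eq_left hwy, norm_sub_rev w z]
        have : ‖z - y‖ ≤ ‖z - w‖ + ‖w - y‖ := by simpa using norm_add_le (z - w) (w - y)
        linarith [min_le_left ‖z - y‖ (r / 2)]
      calc _ ≤ (q + min ‖w - y‖ (r / 2))⁻¹ * ‖w - z‖ := by
            gcongr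
        _ ≤ _ := by gcongr; linarith
    · have : Real.log (q + min ‖z - y‖ (r / 2)) ≤ Real.log (q + min ‖w - y‖ (r / 2)) := by
        refine Real.log_le_log (hl z) ?_
        rw [min_eq_right hwy]
        gcongr
        exact min_le_right _ _
      have : 0 ≤ (qhDensity Ω z + ε) * ‖w - z‖ := by positivity
      linarith

end IsBigGapDomain

namespace IsBigGapDomain

variable {Ω : Set ℂ} {a b : ℕ → ℝ} {K : ℝ} {x : ℂ}

theorem fourPoint_qhDist (h : IsBigGapDomain Ω a b K) :
    FourPoint {z ∈ Ω | 0 ≤ z.im} (qhDist Ω) (4 * Real.log 2 + 4 * 3) := by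
  refine fourPoint_of_log_quasimetric (m := fun x y => ‖x - y‖ + infDist x Ωᶜ + infDist y Ωᶜ)
    (w := fun x => Real.log (infDist x Ωᶜ)) one_le_two (fun x hx y hy => ?_) (fun x y => ?_)
    (fun x hx y hy z hz => ?_) (fun x hx y hy => h.log_le_qhDist hx.1 hy.1)
    (fun x hx y hy => h.qhDist_le_log hx.1 hx.2 hy.1 hy.2)
  · have := h.infDist_pos hx.1
    have := h.infDist_pos hy.1
    positivity
  · show ‖x - y‖ + infDist x Ωᶜ + infDist y Ωᶜ = ‖y - x‖ + infDist y Ωᶜ + infDist x Ωᶜ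
    rw [norm_sub_rev]; ring
  · have h1 : ‖x - y‖ ≤ ‖x - z‖ + ‖z - y‖ := by simpa using norm_add_le (x - z) (z - y)
    have h2 := (h.infDist_pos hz.1).le
    have h3 := le_max_left (‖x - z‖ + infDist x Ωᶜ + infDist z Ωᶜ)
      (‖z - y‖ + infDist z Ωᶜ + infDist y Ωᶜ)
    have h4 := le_max_right (‖x - z‖ + infDist x Ωᶜ + infDist z Ωᶜ)
      (‖z - y‖ + infDist z Ωᶜ + infDist y Ωᶜ)
    linarith

/-- Near every real point of `Ω` there are, at each scale, real points far from the boundary. -/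
theorem exists_real_mem_infDist_ge (h : IsBigGapDomain Ω a b K) {t r : ℝ} (ht : (t : ℂ) ∈ Ω)
    (hr : 0 < r) : ∃ s : ℝ, (s : ℂ) ∈ Ω ∧ |t - s| ≤ 2 * r ∧
      (1 - K⁻¹) / 4 * r ≤ infDist (s : ℂ) Ωᶜ := by
  set κ := (1 - K⁻¹) / 4 with hκ
  have hK := h.one_lt
  have hKi : K⁻¹ < 1 := inv_lt_one_of_one_lt₀ hK
  have hKi0 : 0 < K⁻¹ := inv_pos.2 (by linarith)
  have hκ0 : 0 < κ := by rw [hκ]; linarith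
  have hκ1 : κ < 1 / 4 := by rw [hκ]; linarith
  have hκr : 0 < κ * r := mul_pos hκ0 hr
  have hκr' : κ * r ≤ r := by nlinarith
  have key : ∀ s : ℝ, |t - s| ≤ 2 * r → κ * r ≤ infDist (s : ℂ) Ωᶜ → ∃ s : ℝ, (s : ℂ) ∈ Ω ∧
      |t - s| ≤ 2 * r ∧ κ * r ≤ infDist (s : ℂ) Ωᶜ := fun s h1 h2 =>
    ⟨s, by
      by_contra hcon
      rw [infDist_zero_of_mem hcon] at h2
      linarith, h1, h2⟩
  rcases (h.ofReal_mem_iff t).1 ht with h0 | ⟨n, h1, h2⟩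
  · refine key (t - r) ?_ ?_
    · rw [sub_sub_cancel, abs_of_pos hr]; linarith
    · exact le_trans (by linarith) (h.neg_re_le_infDist _)
  have ha := h.left_nonneg n
  rcases le_or_gt (b n) r with hb | hb
  · refine key (-r) ?_ ?_
    · rw [sub_neg_eq_add, abs_of_pos] <;> linarith
    · exact le_trans (by linarith) (h.neg_re_le_infDist _)
  have hgap : 4 * κ * b n ≤ b n - a n := by
    have : a n ≤ K⁻¹ * b n := by
      rw [le_inv_mul_iff₀ (by linarith)]; exact h.gap n
    rw [hκ]; linarith
  have hκb : κ * r ≤ κ * b n := by gcongr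
  rcases le_total t ((a n + b n) / 2) with hm | hm
  · refine key (t + κ * r) ?_ (le_trans (le_min ?_ ?_) (h.min_le_infDist _ n))
    · rw [sub_add_cancel_left, abs_neg, abs_of_pos hκr]; linarith
    · linarith
    · linarith
  · refine key (t - κ * r) ?_ (le_trans (le_min ?_ ?_) (h.min_le_infDist _ n))
    · rw [sub_sub_cancel, abs_of_pos hκr]; linarith
    · linarith
    · linarith

theorem exists_isGate_qhDist (h : IsBigGapDomain Ω a b K) (hx : x ∈ Ω) (hx0 : 0 ≤ x.im) :
    ∃ y, IsGate (qhDist Ω) {z ∈ Ω | z.im = 0} (2 * Real.log (78 / ((1 - K⁻¹) / 4)) + 9) x y := by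
  set κ := (1 - K⁻¹) / 4 with hκ
  have hKi : K⁻¹ < 1 := inv_lt_one_of_one_lt₀ h.one_lt
  have hκ0 : 0 < κ := by rw [hκ]; linarith
  have px := h.infDist_pos hx
  set m : ℂ → ℂ → ℝ := fun x y => ‖x - y‖ + infDist x Ωᶜ + infDist y Ωᶜ with hm
  obtain ⟨s₀, hs₀, hmin⟩ : ∃ s₀ ∈ {z ∈ Ω | z.im = 0}, ∀ s ∈ {z ∈ Ω | z.im = 0},
      m x s₀ ≤ 2 * m x s := by
    set T := m x '' {z ∈ Ω | z.im = 0} with hT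
    have hlow : ∀ r ∈ T, infDist x Ωᶜ ≤ r := by
      rintro _ ⟨s, hs, rfl⟩
      have := h.infDist_pos hs.1
      have := norm_nonneg (x - s)
      simp only [hm]; linarith
    have hne : T.Nonempty :=
      Nonempty.image _ ⟨((-1 : ℝ) : ℂ), (h.ofReal_mem_iff _).2 (.inl (by norm_num)), by simp⟩
    have hpos : 0 < sInf T := px.trans_le (le_csInf hne hlow)
    obtain ⟨_, ⟨s₀, hs₀, rfl⟩, hlt⟩ := exists_lt_of_csInf_lt hne
      (show sInf T < 2 * sInf T by linarith)
    refine ⟨s₀, hs₀, fun s hs => hlt.le.trans ?_⟩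
    have : sInf T ≤ m x s := csInf_le ⟨_, hlow⟩ (mem_image_of_mem _ hs)
    linarith
  have hs₀' : ((s₀.re : ℝ) : ℂ) = s₀ := by apply Complex.ext <;> simp [hs₀.2]
  have ps₀ := h.infDist_pos hs₀.1
  have hr : 0 < m x s₀ := by simp only [hm]; positivity
  obtain ⟨t, ht, hdist, hδ⟩ := h.exists_real_mem_infDist_ge (t := s₀.re) (by rw [hs₀']; exact hs₀.1) hr
  have hdist' : ‖s₀ - t‖ ≤ 2 * m x s₀ := by
    refine le_of_eq_of_le ?_ hdist
    rw [← Real.norm_eq_abs, ← norm_real, ofReal_sub, hs₀']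
  have hxt : ‖x - t‖ ≤ ‖x - s₀‖ + ‖s₀ - t‖ := by simpa using norm_add_le (x - s₀) (s₀ - t)
  have pt := h.infDist_pos ht
  have hδt : infDist (t : ℂ) Ωᶜ ≤ infDist x Ωᶜ + ‖x - t‖ := by
    rw [← dist_eq, dist_comm]; exact infDist_le_infDist_add_dist
  have hmm : m x s₀ = ‖x - s₀‖ + infDist x Ωᶜ + infDist s₀ Ωᶜ := rfl
  refine ⟨t, ⟨ht, by simp⟩, fun s hs => ?_⟩
  have ps := h.infDist_pos hs.1
  have b1 := h.qhDist_le_log hx hx0 ht (by simp)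
  have b2 := h.qhDist_le_log ht (by simp) hs.1 hs.2.ge
  have b3 := h.log_le_qhDist hx hs.1
  have hms : 0 < m x s := by simp only [hm]; positivity
  have l1 : Real.log (‖x - t‖ + infDist x Ωᶜ + infDist (t : ℂ) Ωᶜ) ≤
      Real.log 6 + Real.log (m x s₀) := by
    rw [← Real.log_mul (by norm_num) hr.ne']
    exact Real.log_le_log (by positivity) (by linarith)
  have l2 : Real.log (‖t - s‖ + infDist (t : ℂ) Ωᶜ + infDist s Ωᶜ) ≤
      Real.log 13 + Real.log (m x s) := by
    rw [← Real.log_mul (by norm_num) hms.ne']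
    refine Real.log_le_log (by positivity) ?_
    have h1 : ‖t - s‖ ≤ ‖x - t‖ + ‖x - s‖ := by
      rw [norm_sub_rev x t]; simpa using norm_add_le (t - x) (x - s)
    have h2 := hmin s hs
    have h3 : m x s = ‖x - s‖ + infDist x Ωᶜ + infDist s Ωᶜ := rfl
    linarith
  have l3 : Real.log κ + Real.log (m x s₀) ≤ Real.log (infDist (t : ℂ) Ωᶜ) := by
    rw [← Real.log_mul hκ0.ne' hr.ne']
    exact Real.log_le_log (by positivity) hδ
  have l4 : Real.log (78 / κ) = Real.log 6 + Real.log 13 - Real.log κ := by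
    rw [Real.log_div (by norm_num) hκ0.ne', ← Real.log_mul (by norm_num) (by norm_num)]
    norm_num
  have l5 : Real.log (m x s) = Real.log (‖x - s‖ + infDist x Ωᶜ + infDist s Ωᶜ) := rfl
  rw [l4]
  linarith

theorem gromovHyperbolicWith_qhDist (h : IsBigGapDomain Ω a b K) :
    GromovHyperbolicWith Ω (qhDist Ω) (2 * (4 * (4 * Real.log 2 + 4 * 3) +
      20 * (2 * Real.log (78 / ((1 - K⁻¹) / 4)) + 9) + 20)) := by
  have hKi : K⁻¹ < 1 := inv_lt_one_of_one_lt₀ h.one_lt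
  have hKi0 : 0 < K⁻¹ := inv_pos.2 (by linarith [h.one_lt])
  have hlog : 0 ≤ Real.log (78 / ((1 - K⁻¹) / 4)) := by
    refine Real.log_nonneg ?_
    rw [le_div_iff₀ (by linarith)]
    linarith
  exact h.gromovHyperbolicWith h.continuousOn_qhDensity (fun z _ => qhDensity_nonneg z)
    (fun z _ => by rw [qhDensity, h.infDist_conj]; rfl) (by positivity) (by positivity)
    h.fourPoint_qhDist fun x hx hx0 => h.exists_isGate_qhDist hx hx0

end IsBigGapDomain

section HalfPlane

theorem hasDerivAt_sub_div_sub {a b z : ℂ} (hz : z - b ≠ 0) :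
    HasDerivAt (fun v => (v - a) / (v - b)) ((a - b) / (z - b) ^ 2) z := by
  refine (((hasDerivAt_id' z).sub_const a).fun_div ((hasDerivAt_id' z).sub_const b)
    hz).congr_deriv ?_
  congr 1
  ring

open UpperHalfPlane hiding I
open scoped ComplexConjugate

theorem UpperHalfPlane.coe_sub_conj_ne_zero (ζ v : ℍ) : (v : ℂ) - conj (ζ : ℂ) ≠ 0 := fun hz => by
  have h1 := congrArg Complex.im hz
  have h2 := ζ.im_pos
  have h3 := v.im_pos
  simp at h1
  linarith

theorem UpperHalfPlane.one_sub_normSq_div (ζ v : ℍ) :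
    1 - ‖((v : ℂ) - ζ) / (v - conj (ζ : ℂ))‖ ^ 2 =
      4 * v.im * ζ.im / ‖(v : ℂ) - conj (ζ : ℂ)‖ ^ 2 := by
  have h : ‖(v : ℂ) - conj (ζ : ℂ)‖ ^ 2 ≠ 0 :=
    pow_ne_zero _ (norm_ne_zero_iff.2 (coe_sub_conj_ne_zero ζ v))
  rw [norm_div, div_pow, one_sub_div h]
  congr 1
  rw [← Complex.normSq_eq_norm_sq, ← Complex.normSq_eq_norm_sq, Complex.normSq_apply,
    Complex.normSq_apply]
  simp
  ring

theorem UpperHalfPlane.div_mem_ball (ζ v : ℍ) :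
    ((v : ℂ) - ζ) / (v - conj (ζ : ℂ)) ∈ ball (0 : ℂ) 1 := by
  have h : 0 < ‖(v : ℂ) - conj (ζ : ℂ)‖ := norm_pos_iff.2 (coe_sub_conj_ne_zero ζ v)
  have h1 := one_sub_normSq_div ζ v
  have h2 : 0 < 4 * v.im * ζ.im / ‖(v : ℂ) - conj (ζ : ℂ)‖ ^ 2 := by
    have := ζ.im_pos
    have := v.im_pos
    positivity
  rw [mem_ball_zero_iff]
  nlinarith [norm_nonneg (((v : ℂ) - ζ) / (v - conj (ζ : ℂ)))]

theorem one_sub_ne_zero_of_mem_ball {a : ℂ} (ha : a ∈ ball (0 : ℂ) 1) : 1 - a ≠ 0 := fun h => by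
  rw [sub_eq_zero] at h
  simp [← h] at ha

theorem UpperHalfPlane.im_div_pos (ζ : ℍ) {a : ℂ} (ha : a ∈ ball (0 : ℂ) 1) :
    0 < (((ζ : ℂ) - conj (ζ : ℂ) * a) / (1 - a)).im := by
  have h1 : 0 < Complex.normSq (1 - a) := Complex.normSq_pos.2 (one_sub_ne_zero_of_mem_ball ha)
  have h2 : ‖a‖ ^ 2 < 1 := by
    rw [mem_ball_zero_iff] at ha
    exact pow_lt_one₀ (norm_nonneg _) ha two_ne_zero
  rw [← Complex.normSq_eq_norm_sq, Complex.normSq_apply] at h2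
  rw [Complex.div_im, ← sub_div]
  refine div_pos ?_ h1
  have h3 := mul_pos ζ.im_pos (sub_pos.2 h2)
  simp
  nlinarith

/-- The conformal homeomorphism of the upper half plane onto the unit disk that sends `ζ`
to `0`. -/
noncomputable def UpperHalfPlane.homeomorphBall (ζ : ℍ) : ℍ ≃ₜ ball (0 : ℂ) 1 where
  toFun v := ⟨((v : ℂ) - ζ) / (v - conj (ζ : ℂ)), div_mem_ball ζ v⟩
  invFun a := ⟨((ζ : ℂ) - conj (ζ : ℂ) * a) / (1 - a), im_div_pos ζ a.2⟩
  left_inv v := by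
    ext1
    have h1 := coe_sub_conj_ne_zero ζ v
    have h2 := coe_sub_conj_ne_zero ζ ζ
    have h3 := one_sub_ne_zero_of_mem_ball (div_mem_ball ζ v)
    show ((ζ : ℂ) - conj (ζ : ℂ) * (((v : ℂ) - ζ) / (v - conj (ζ : ℂ)))) /
      (1 - ((v : ℂ) - ζ) / (v - conj (ζ : ℂ))) = v
    rw [div_eq_iff h3]
    field_simp
    ring
  right_inv a := by
    ext1
    have h2 := coe_sub_conj_ne_zero ζ ζ
    have h3 := one_sub_ne_zero_of_mem_ball a.2
    have h4 := coe_sub_conj_ne_zero ζ ⟨_, im_div_pos ζ a.2⟩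
    show (((ζ : ℂ) - conj (ζ : ℂ) * a) / (1 - a) - ζ) /
      (((ζ : ℂ) - conj (ζ : ℂ) * a) / (1 - a) - conj (ζ : ℂ)) = a
    rw [div_eq_iff h4]
    field_simp
    ring
  continuous_toFun := by
    refine Continuous.subtype_mk (Continuous.div ?_ ?_ fun v => coe_sub_conj_ne_zero ζ v) _
    · exact UpperHalfPlane.continuous_coe.sub continuous_const
    · exact UpperHalfPlane.continuous_coe.sub continuous_const
  continuous_invFun := by
    refine UpperHalfPlane.isEmbedding_coe.continuous_iff.2 ?_
    exact Continuous.div (by fun_prop) (by fun_prop) fun a => one_sub_ne_zero_of_mem_ball a.2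

theorem UpperHalfPlane.coe_homeomorphBall (ζ v : ℍ) :
    (homeomorphBall ζ v : ℂ) = ((v : ℂ) - ζ) / (v - conj (ζ : ℂ)) := rfl

/-- A holomorphic universal covering of `Ω` by the upper half plane along which the density `lam`
pulls back to the density `1 / im`. -/
structure IsHalfPlaneCover (Ω : Set ℂ) (lam : ℂ → ℝ) (q : ℂ → ℂ) : Prop where
  differentiableAt : ∀ ζ : ℍ, DifferentiableAt ℂ q ζ
  mem : ∀ ζ : ℍ, q ζ ∈ Ω
  exists_eq : ∀ w ∈ Ω, ∃ ζ : ℍ, q ζ = w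
  isCoveringMapOn : IsCoveringMapOn (fun ζ : ℍ => q ζ) Ω
  density : ∀ ζ : ℍ, lam (q ζ) * ‖deriv q ζ‖ = 1 / ζ.im

theorem IsPoincareDensity.exists_isHalfPlaneCover {Ω : Set ℂ} {lam : ℂ → ℝ}
    (h : IsPoincareDensity Ω lam) : ∃ q, IsHalfPlaneCover Ω lam q := by
  obtain ⟨p, hd, himg, hcov, hlam⟩ := h
  set ι : ℍ := UpperHalfPlane.I with hι
  have hder : ∀ ζ : ℍ, HasDerivAt (fun v : ℂ => p ((v - ι) / (v - conj (ι : ℂ))))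
      (deriv p (((ζ : ℂ) - ι) / (ζ - conj (ι : ℂ))) *
        (((ι : ℂ) - conj (ι : ℂ)) / (ζ - conj (ι : ℂ)) ^ 2)) ζ := fun ζ => by
    refine HasDerivAt.comp (ζ : ℂ) (hd _ (div_mem_ball ι ζ)).hasDerivAt
      (hasDerivAt_sub_div_sub (coe_sub_conj_ne_zero ι ζ))
  refine ⟨fun v => p ((v - ι) / (v - conj (ι : ℂ))), ⟨fun ζ => (hder ζ).differentiableAt,
    fun ζ => himg ▸ mem_image_of_mem p (div_mem_ball ι ζ), fun w hw => ?_,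
    hcov.comp_homeomorph (homeomorphBall ι), fun ζ => ?_⟩⟩
  · rw [← himg] at hw
    obtain ⟨a, ha, rfl⟩ := hw
    refine ⟨(homeomorphBall ι).symm ⟨a, ha⟩, ?_⟩
    rw [← coe_homeomorphBall, Homeomorph.apply_symm_apply]
  · rw [(hder ζ).deriv, norm_mul, ← mul_assoc, hlam _ (div_mem_ball ι ζ), one_sub_normSq_div,
      norm_div, norm_pow]
    have h1 : ‖(ζ : ℂ) - conj (ι : ℂ)‖ ≠ 0 := norm_ne_zero_iff.2 (coe_sub_conj_ne_zero ι ζ)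
    have h2 : ‖(ι : ℂ) - conj (ι : ℂ)‖ = 2 := by
      have : (ι : ℂ) - conj (ι : ℂ) = (2 : ℝ) * Complex.I := by
        rw [hι]; apply Complex.ext <;> simp; norm_num
      rw [this]; simp
    have h3 : ι.im = 1 := by rw [hι]; simp
    have h4 := ζ.im_pos.ne'
    rw [h2, h3]
    field_simp
    norm_num

end HalfPlane

theorem UpperHalfPlane.norm_coe_sub_conj (ζ : UpperHalfPlane) :
    ‖(ζ : ℂ) - (starRingEnd ℂ) (ζ : ℂ)‖ = 2 * ζ.im := by
  have : (ζ : ℂ) - (starRingEnd ℂ) (ζ : ℂ) = (2 * ζ.im : ℝ) * Complex.I := by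
    apply Complex.ext <;> simp; ring
  rw [this, norm_mul, norm_real, norm_I, mul_one, Real.norm_of_nonneg]
  exact (mul_pos two_pos ζ.im_pos).le

namespace IsHalfPlaneCover

open UpperHalfPlane hiding I
open scoped ComplexConjugate

variable {Ω : Set ℂ} {lam : ℂ → ℝ} {q : ℂ → ℂ}

theorem deriv_ne_zero (h : IsHalfPlaneCover Ω lam q) (ζ : ℍ) : deriv q ζ ≠ 0 := fun h0 => by
  have h1 := h.density ζ
  rw [h0, norm_zero, mul_zero] at h1
  exact (one_div_pos.2 ζ.im_pos).ne h1

theorem density_pos (h : IsHalfPlaneCover Ω lam q) {w : ℂ} (hw : w ∈ Ω) : 0 < lam w := by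
  obtain ⟨ζ, rfl⟩ := h.exists_eq w hw
  have h1 := h.density ζ
  have h2 := one_div_pos.2 ζ.im_pos
  rw [← h1] at h2
  exact pos_of_mul_pos_left h2 (norm_nonneg _)

theorem analyticAt (h : IsHalfPlaneCover Ω lam q) (ζ : ℍ) : AnalyticAt ℂ q ζ := by
  have hd : DifferentiableOn ℂ q {z | 0 < z.im} := fun z hz =>
    (h.differentiableAt ⟨z, hz⟩).differentiableWithinAt
  exact hd.analyticAt ((isOpen_lt continuous_const Complex.continuous_im).mem_nhds ζ.im_pos)

theorem density_eq (h : IsHalfPlaneCover Ω lam q) (ζ : ℍ) :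
    lam (q ζ) = 1 / ζ.im / ‖deriv q ζ‖ :=
  eq_div_of_mul_eq (norm_ne_zero_iff.2 (h.deriv_ne_zero ζ)) (h.density ζ)

theorem continuousOn_density (h : IsHalfPlaneCover Ω lam q) : ContinuousOn lam Ω := by
  intro w hw
  obtain ⟨ζ, rfl⟩ := h.exists_eq w hw
  refine ContinuousAt.continuousWithinAt ?_
  have hs := (h.analyticAt ζ).hasStrictDerivAt
  have hne := h.deriv_ne_zero ζ
  have hg : ContinuousAt (hs.localInverse q _ _ hne) (q ζ) :=
    (hs.to_localInverse hne).hasDerivAt.continuousAt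
  have hgζ : hs.localInverse q _ _ hne (q ζ) = ζ := HasStrictFDerivAt.localInverse_apply_image ..
  have hright := hs.eventually_right_inverse hne
  set g := hs.localInverse q _ _ hne with hgdef
  have hmem : ∀ᶠ w in nhds (q ζ), 0 < (g w).im := by
    refine hg.eventually ((isOpen_lt continuous_const Complex.continuous_im).mem_nhds ?_)
    rw [hgζ]; exact ζ.im_pos
  have heq : (fun w => 1 / (g w).im / ‖deriv q (g w)‖) =ᶠ[nhds (q ζ)] lam := by
    filter_upwards [hright, hmem] with w h1 h2
    exact (h.density_eq ⟨g w, h2⟩).symm.trans (congrArg lam h1)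
  refine ContinuousAt.congr ?_ heq
  refine ContinuousAt.div (ContinuousAt.div continuousAt_const
    (Complex.continuous_im.continuousAt.comp hg) ?_) (ContinuousAt.norm ?_) ?_
  · rw [hgζ]; exact ζ.im_pos.ne'
  · refine ContinuousAt.comp (g := deriv q) ?_ hg
    rw [hgζ]
    exact (h.analyticAt ζ).deriv.continuousAt
  · rw [hgζ]; exact norm_ne_zero_iff.2 hne

/-- Maps from simply connected sets into `Ω` lift to the upper half plane. -/
theorem exists_lift (h : IsHalfPlaneCover Ω lam q) {s : Set ℂ} [SimplyConnectedSpace s]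
    [LocallyPathConnectedSpace s] {f : ℂ → ℂ} (hf : ContinuousOn f s) (hfs : MapsTo f s Ω)
    {z₀ : ℂ} (hz₀ : z₀ ∈ s) {ζ : ℍ} (hζ : q ζ = f z₀) :
    ∃ Φ : ℂ → ℍ, ContinuousOn Φ s ∧ Φ z₀ = ζ ∧ ∀ z ∈ s, q (Φ z) = f z := by
  classical
  obtain ⟨F, ⟨h1, h2⟩, -⟩ := h.isCoveringMapOn.existsUnique_continuousMap_lifts
    (A := s) ⟨s.domRestrict f, hf.domRestrict⟩ (a₀ := ⟨z₀, hz₀⟩) (e₀ := ζ) hζ fun a => hfs a.2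
  refine ⟨fun z => if hz : z ∈ s then F ⟨z, hz⟩ else ζ, ?_, ?_, fun z hz => ?_⟩
  · rw [continuousOn_iff_continuous_domRestrict]
    convert F.continuous using 1
    ext1 z
    simp
  · simpa [hz₀] using h1
  · simp only [dif_pos hz]; exact congrFun h2 ⟨z, hz⟩

theorem hasDerivWithinAt_lift (h : IsHalfPlaneCover Ω lam q) {s : Set ℂ} {Φ : ℂ → ℍ}
    {f : ℂ → ℂ} {f' z : ℂ} (hΦ : ContinuousWithinAt Φ s z) (hq : ∀ w ∈ s, q (Φ w) = f w)
    (hz : z ∈ s) (hf : HasDerivWithinAt f f' s z) :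
    HasDerivWithinAt (fun w => (Φ w : ℂ)) (f' / deriv q (Φ z)) s z := by
  have hs := (h.analyticAt (Φ z)).hasStrictDerivAt
  have hne := h.deriv_ne_zero (Φ z)
  have hinv := (hs.to_localInverse hne).hasDerivAt
  rw [hq z hz] at hinv
  have hcomp := hinv.comp_hasDerivWithinAt z hf
  rw [inv_mul_eq_div] at hcomp
  have hΦ' : ContinuousWithinAt (fun w => (Φ w : ℂ)) s z :=
    UpperHalfPlane.continuous_coe.continuousAt.comp_continuousWithinAt hΦ
  have hev : ∀ᶠ w in nhdsWithin z s, hs.localInverse q _ _ hne (f w) = Φ w := by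
    filter_upwards [hΦ'.eventually (hs.eventually_left_inverse hne), self_mem_nhdsWithin]
      with w h1 h2
    rw [← hq w h2]; exact h1
  refine hcomp.congr_of_eventuallyEq (hev.mono fun w hw => hw.symm) ?_
  exact (hev.self_of_nhdsWithin hz).symm

/-- The Schwarz lemma for the Poincaré density. -/
theorem density_mul_norm_deriv_le (h : IsHalfPlaneCover Ω lam q) {f : ℂ → ℂ}
    (hf : DifferentiableOn ℂ f (ball 0 1)) (hfΩ : MapsTo f (ball 0 1) Ω) :
    lam (f 0) * ‖deriv f 0‖ ≤ 2 := by
  have h0 : (0 : ℂ) ∈ ball (0 : ℂ) 1 := by simp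
  have : ContractibleSpace (ball (0 : ℂ) 1) := (convex_ball _ _).contractibleSpace ⟨0, h0⟩
  have : LocallyPathConnectedSpace (ball (0 : ℂ) 1) := (convex_ball _ _).locallyPathConnectedSpace
  obtain ⟨ζ, hζ⟩ := h.exists_eq _ (hfΩ h0)
  obtain ⟨Φ, hΦ, hΦ0, hΦq⟩ := h.exists_lift hf.continuousOn hfΩ h0 hζ
  have hder : ∀ z ∈ ball (0 : ℂ) 1,
      HasDerivAt (fun w => (Φ w : ℂ)) (deriv f z / deriv q (Φ z)) z := fun z hz =>
    (h.hasDerivWithinAt_lift (hΦ z hz) hΦq hz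
      ((hf.differentiableAt (isOpen_ball.mem_nhds hz)).hasDerivAt.hasDerivWithinAt)).hasDerivAt
      (isOpen_ball.mem_nhds hz)
  set G : ℂ → ℂ := fun w => (Φ w - ζ) / (Φ w - conj (ζ : ℂ)) with hG
  have hGder : ∀ z ∈ ball (0 : ℂ) 1, HasDerivAt G
      ((ζ - conj (ζ : ℂ)) / (Φ z - conj (ζ : ℂ)) ^ 2 * (deriv f z / deriv q (Φ z))) z :=
    fun z hz => HasDerivAt.comp (h := fun w => (Φ w : ℂ)) z
      (hasDerivAt_sub_div_sub (coe_sub_conj_ne_zero ζ (Φ z))) (hder z hz)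
  have hG0 : G 0 = 0 := by simp [hG, hΦ0]
  have key := norm_deriv_le_one_of_mapsTo_ball (f := G) (c := 0) (R := 1)
    (fun z hz => (hGder z hz).differentiableAt.differentiableWithinAt)
    (fun z _ => by rw [hG0]; exact ball_subset_closedBall (div_mem_ball ζ (Φ z))) one_pos
  rw [(hGder 0 h0).deriv, hΦ0, norm_mul, norm_div, norm_div, norm_pow, norm_coe_sub_conj] at key
  rw [← hζ, h.density_eq]
  have h1 := ζ.im_pos
  have h2 := norm_pos_iff.2 (h.deriv_ne_zero ζ)
  calc 1 / ζ.im / ‖deriv q ζ‖ * ‖deriv f 0‖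
      = 2 * (2 * ζ.im / (2 * ζ.im) ^ 2 * (‖deriv f 0‖ / ‖deriv q ζ‖)) := by field_simp
    _ ≤ 2 := by linarith

theorem density_conj_le (h : IsHalfPlaneCover Ω lam q) (hΩ : ∀ z ∈ Ω, conj z ∈ Ω) {w : ℂ}
    (hw : w ∈ Ω) : lam (conj w) ≤ lam w := by
  obtain ⟨ζ, rfl⟩ := h.exists_eq w hw
  have h0 : (0 : ℂ) ∈ ball (0 : ℂ) 1 := by simp
  set g : ℂ → ℂ := fun a => q ((ζ - conj (ζ : ℂ) * a) / (1 - a)) with hg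
  have hgd : ∀ a ∈ ball (0 : ℂ) 1, DifferentiableAt ℂ g a := fun a ha => by
    refine DifferentiableAt.comp a (h.differentiableAt ⟨_, im_div_pos ζ ha⟩) ?_
    exact DifferentiableAt.div (by fun_prop) (by fun_prop) (one_sub_ne_zero_of_mem_ball ha)
  have hgmem : ∀ a ∈ ball (0 : ℂ) 1, g a ∈ Ω := fun a ha => h.mem ⟨_, im_div_pos ζ ha⟩
  have hball : ∀ a ∈ ball (0 : ℂ) 1, conj a ∈ ball (0 : ℂ) 1 := fun a ha => by
    rw [mem_ball_zero_iff, RCLike.norm_conj]; exact mem_ball_zero_iff.1 ha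
  have hg0 : g 0 = q ζ := by simp [hg]
  have hgder : HasDerivAt g (deriv q ζ * (ζ - conj (ζ : ℂ))) 0 := by
    have e : ((ζ : ℂ) - conj (ζ : ℂ) * 0) / (1 - 0) = ζ := by simp
    have hdq : HasDerivAt q (deriv q ζ) (((ζ : ℂ) - conj (ζ : ℂ) * 0) / (1 - 0)) := by
      rw [e]; exact (h.differentiableAt ζ).hasDerivAt
    refine HasDerivAt.comp 0 hdq ?_
    refine ((((hasDerivAt_id' (0 : ℂ)).const_mul (conj (ζ : ℂ))).const_sub (ζ : ℂ)).fun_div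
      ((hasDerivAt_id' (0 : ℂ)).const_sub 1) (by simp)).congr_deriv ?_
    simp
    ring
  have key := h.density_mul_norm_deriv_le (f := conj ∘ g ∘ conj)
    (fun a ha => by
      have := (hgd _ (hball a ha)).conj_conj
      rw [conj_conj] at this
      exact this.differentiableWithinAt)
    (fun a ha => hΩ _ (hgmem _ (hball a ha)))
  have hd0 := (show HasDerivAt g (deriv q ζ * (ζ - conj (ζ : ℂ))) 0 from hgder).conj_conj
  rw [map_zero] at hd0
  rw [hd0.deriv, RCLike.norm_conj, norm_mul] at key
  have h1 := ζ.im_pos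
  have h2 := norm_pos_iff.2 (h.deriv_ne_zero ζ)
  simp only [Function.comp_apply, map_zero, hg0, norm_coe_sub_conj] at key
  rw [h.density_eq ζ, div_div, le_div_iff₀ (by positivity)]
  linarith

theorem density_conj (h : IsHalfPlaneCover Ω lam q) (hΩ : ∀ z ∈ Ω, conj z ∈ Ω) {w : ℂ}
    (hw : w ∈ Ω) : lam (conj w) = lam w := by
  refine le_antisymm (h.density_conj_le hΩ hw) ?_
  simpa using h.density_conj_le hΩ (hΩ w hw)

theorem density_mul_radius_le (h : IsHalfPlaneCover Ω lam q) {w : ℂ} {r : ℝ} (hr : 0 < r)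
    (hball : ball w r ⊆ Ω) : lam w * r ≤ 2 := by
  have hder : ∀ a, HasDerivAt (fun a : ℂ => w + r * a) (r : ℂ) a := fun a => by
    simpa using ((hasDerivAt_id a).const_mul (r : ℂ)).const_add w
  have := h.density_mul_norm_deriv_le (f := fun a => w + r * a)
    (fun a _ => (hder a).differentiableAt.differentiableWithinAt) (fun a ha => hball ?_)
  · rw [(hder 0).deriv, norm_real, Real.norm_of_nonneg hr.le] at this
    simpa using this
  · rw [mem_ball_zero_iff] at ha
    rw [mem_ball, Complex.dist_eq, add_sub_cancel_left, norm_mul, norm_real, Real.norm_of_nonneg hr.le]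
    nlinarith

end IsHalfPlaneCover

namespace UpperHalfPlane

open scoped ComplexConjugate

theorem fourPoint_dist : FourPoint (univ : Set ℍ) dist (4 * Real.log 2 + 4 * 0) := by
  have hpos : ∀ x y : ℍ, 0 < dist (x : ℂ) y + dist (x : ℂ) (conj (y : ℂ)) := fun x y => by
    have : 0 < dist (x : ℂ) (conj (y : ℂ)) := dist_pos.2 (sub_ne_zero.1 (coe_sub_conj_ne_zero y x))
    positivity
  have hdist : ∀ x y : ℍ, dist x y = 2 * Real.log (dist (x : ℂ) y + dist (x : ℂ) (conj (y : ℂ)))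
      - (Real.log 2 + Real.log x.im) - (Real.log 2 + Real.log y.im) := fun x y => by
    have h1 := congrArg Real.log (exp_half_dist x y)
    have hx := x.im_pos
    have hy := y.im_pos
    rw [Real.log_exp, Real.log_div (hpos x y).ne' (by positivity), Real.log_mul two_ne_zero
      (by positivity), Real.log_sqrt (by positivity), Real.log_mul hx.ne' hy.ne'] at h1
    linarith
  refine fourPoint_of_log_quasimetric
    (m := fun x y : ℍ => dist (x : ℂ) y + dist (x : ℂ) (conj (y : ℂ)))
    (w := fun x => Real.log 2 + Real.log x.im) (by norm_num) (fun x _ y _ => hpos x y)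
    (fun x y => ?_) (fun x _ y _ z _ => ?_) (fun x _ y _ => ?_) (fun x _ y _ => ?_)
  · congr 1
    · exact dist_comm _ _
    · rw [dist_comm (y : ℂ), Complex.dist_eq, Complex.dist_eq, ← RCLike.norm_conj, map_sub, conj_conj]
  · have h1 := dist_triangle (x : ℂ) z y
    have h2 := dist_triangle (x : ℂ) z (conj (y : ℂ))
    have h4 := le_max_left (dist (x : ℂ) z + dist (x : ℂ) (conj (z : ℂ)))
      (dist (z : ℂ) y + dist (z : ℂ) (conj (y : ℂ)))
    have h5 := le_max_right (dist (x : ℂ) z + dist (x : ℂ) (conj (z : ℂ)))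
      (dist (z : ℂ) y + dist (z : ℂ) (conj (y : ℂ)))
    have h6 : dist (x : ℂ) z ≤ dist (x : ℂ) (conj (z : ℂ)) := by
      rw [Complex.dist_eq, Complex.dist_eq]
      refine abs_le_of_sq_le_sq' ?_ (norm_nonneg _) |>.2
      rw [← Complex.normSq_eq_norm_sq, ← Complex.normSq_eq_norm_sq, Complex.normSq_apply,
        Complex.normSq_apply]
      have := mul_pos x.im_pos z.im_pos
      simp
      nlinarith
    show dist (x : ℂ) y + dist (x : ℂ) (conj (y : ℂ)) ≤ _
    linarith
  · rw [hdist]; linarith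
  · rw [hdist]; linarith

/-- A complete geodesic of the upper half plane, parametrized by arclength. -/
structure IsLine (γ : ℝ → ℍ) (γ' : ℝ → ℂ) : Prop where
  hasDerivAt : ∀ t, HasDerivAt (fun t => (γ t : ℂ)) (γ' t) t
  continuous_deriv : Continuous γ'
  norm_deriv : ∀ t, ‖γ' t‖ = (γ t).im
  isometry : Isometry γ

theorem exists_isLine_of_re_eq (x : ℝ) :
    ∃ γ γ', IsLine γ γ' ∧ ∀ v : ℍ, v.re = x → v ∈ range γ := by
  refine ⟨fun t => ⟨⟨x, Real.exp t⟩, Real.exp_pos t⟩, fun t => Real.exp t * Complex.I,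
    ⟨fun t => ?_, by fun_prop, fun t => ?_, isometry_vertical_line x⟩, fun v hv => ⟨Real.log v.im, ?_⟩⟩
  · have h1 : ∀ t, (⟨x, Real.exp t⟩ : ℂ) = x + Real.exp t * Complex.I := fun t => by
      apply Complex.ext <;> simp [-ofReal_exp]
    simp only [h1]
    exact ((Real.hasDerivAt_exp t).ofReal_comp.mul_const Complex.I).const_add _
  · rw [norm_mul, norm_real, norm_I, mul_one, Real.norm_of_nonneg (Real.exp_pos t).le]
    rfl
  · ext1
    apply Complex.ext
    · exact hv.symm
    · exact Real.exp_log v.im_pos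

theorem exists_isLine_of_sq_add_sq_eq (c : ℝ) {R : ℝ} (hR : 0 < R) :
    ∃ γ γ', IsLine γ γ' ∧ ∀ v : ℍ, (v.re - c) ^ 2 + v.im ^ 2 = R ^ 2 → v ∈ range γ := by
  have him : ∀ t, 0 < R / Real.cosh t := fun t => div_pos hR (Real.cosh_pos t)
  refine ⟨fun t => ⟨⟨c - R * (Real.sinh t / Real.cosh t), R / Real.cosh t⟩, him t⟩,
    fun t => ((-(R / Real.cosh t ^ 2) : ℝ) : ℂ) + ((-(R * Real.sinh t / Real.cosh t ^ 2) : ℝ) : ℂ) * Complex.I,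
    ⟨fun t => ?_, ?_, fun t => ?_, ?_⟩, fun v hv => ⟨Real.arsinh ((c - v.re) / v.im), ?_⟩⟩
  · have hc := (Real.cosh_pos t).ne'
    have h1 : ∀ t, (⟨c - R * (Real.sinh t / Real.cosh t), R / Real.cosh t⟩ : ℂ) =
        ((c - R * (Real.sinh t / Real.cosh t) : ℝ) : ℂ) + ((R / Real.cosh t : ℝ) : ℂ) * Complex.I :=
      fun t => by apply Complex.ext <;> simp [-ofReal_div, -ofReal_sub, -ofReal_mul]
    simp only [h1]
    have d1 : HasDerivAt (fun t => c - R * (Real.sinh t / Real.cosh t)) (-(R / Real.cosh t ^ 2)) t := by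
      refine ((((Real.hasDerivAt_sinh t).fun_div (Real.hasDerivAt_cosh t) hc).const_mul
        R).const_sub c).congr_deriv ?_
      rw [← sq, ← sq, Real.cosh_sq]
      ring
    have d2 : HasDerivAt (fun t => R / Real.cosh t) (-(R * Real.sinh t / Real.cosh t ^ 2)) t := by
      refine ((hasDerivAt_const t R).fun_div (Real.hasDerivAt_cosh t) hc).congr_deriv ?_
      ring
    exact d1.ofReal_comp.add (d2.ofReal_comp.mul_const Complex.I)
  · have hc : ∀ t, Real.cosh t ^ 2 ≠ 0 := fun t => (pow_pos (Real.cosh_pos t) 2).ne'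
    have c1 : Continuous fun t => -(R / Real.cosh t ^ 2) :=
      (continuous_const.div (by fun_prop) hc).neg
    have c2 : Continuous fun t => -(R * Real.sinh t / Real.cosh t ^ 2) :=
      (Continuous.div (by fun_prop) (by fun_prop) hc).neg
    fun_prop
  · have hc := (Real.cosh_pos t).ne'
    show _ = R / Real.cosh t
    rw [Complex.norm_add_mul_I, Real.sqrt_eq_iff_mul_self_eq (by positivity) (him t).le]
    field_simp
    rw [Real.cosh_sq]
    ring
  · refine Isometry.of_dist_eq fun s t => ?_
    have hs := (Real.cosh_pos s).ne'
    have ht := (Real.cosh_pos t).ne'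
    refine (Real.cosh_strictMonoOn.injOn.eq_iff dist_nonneg dist_nonneg).1 ?_
    rw [Real.dist_eq, Real.cosh_abs, cosh_dist, Real.cosh_sub]
    show 1 + dist (⟨_, _⟩ : ℂ) ⟨_, _⟩ ^ 2 / (2 * (R / Real.cosh s) * (R / Real.cosh t)) = _
    rw [Complex.dist_eq, ← Complex.normSq_eq_norm_sq, Complex.normSq_apply]
    simp only [Complex.sub_re, Complex.sub_im]
    have e1 := Real.cosh_sq s
    have e2 := Real.cosh_sq t
    field_simp
    linear_combination -R ^ 2 * (Real.cosh t ^ 2 * e1 + Real.cosh s ^ 2 * e2)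
  · have hv0 := v.im_pos
    have hcosh : Real.cosh (Real.arsinh ((c - v.re) / v.im)) = R / v.im := by
      rw [Real.cosh_arsinh, Real.sqrt_eq_iff_mul_self_eq (by positivity) (by positivity)]
      field_simp
      linear_combination hv
    ext1
    apply Complex.ext
    · show c - R * (_ / _) = v.re
      rw [hcosh, Real.sinh_arsinh]
      field_simp
      ring
    · show R / _ = v.im
      rw [hcosh]
      field_simp

theorem exists_isLine_of_dist_eq {A B : ℍ} (hAB : A ≠ B) :
    ∃ γ γ', IsLine γ γ' ∧ ∀ v : ℍ, dist v A = dist v B → v ∈ range γ := by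
  have key : ∀ v : ℍ, dist v A = dist v B → ((v.re - A.re) ^ 2 + (v.im - A.im) ^ 2) * B.im =
      ((v.re - B.re) ^ 2 + (v.im - B.im) ^ 2) * A.im := fun v hv => by
    have h1 := congrArg Real.cosh hv
    rw [cosh_dist, cosh_dist, add_right_inj, Complex.dist_eq, Complex.dist_eq,
      ← Complex.normSq_eq_norm_sq, ← Complex.normSq_eq_norm_sq, Complex.normSq_apply,
      Complex.normSq_apply] at h1
    have hv := v.im_pos
    have hA := A.im_pos
    have hB := B.im_pos
    simp at h1
    field_simp at h1
    linear_combination h1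
  have hA := A.im_pos
  have hB := B.im_pos
  by_cases him : A.im = B.im
  · have hre : A.re ≠ B.re := fun hre => hAB (by ext1; exact Complex.ext hre him)
    obtain ⟨γ, γ', hγ, hmem⟩ := exists_isLine_of_re_eq ((A.re + B.re) / 2)
    refine ⟨γ, γ', hγ, fun v hv => hmem v ?_⟩
    have h1 := key v hv
    rw [him, mul_left_inj' hB.ne'] at h1
    have h2 : (B.re - A.re) * (v.re - (A.re + B.re) / 2) = 0 := by linear_combination h1 / 2
    exact sub_eq_zero.1 ((mul_eq_zero.1 h2).resolve_left (sub_ne_zero.2 hre.symm))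
  · by_cases hne : ∃ v₀ : ℍ, dist v₀ A = dist v₀ B
    · obtain ⟨v₀, hv₀⟩ := hne
      have h0 := key v₀ hv₀
      have hv₀ := v₀.im_pos
      have hsub : B.im - A.im ≠ 0 := sub_ne_zero.2 fun h => him h.symm
      set c := (B.im * A.re - A.im * B.re) / (B.im - A.im) with hc
      have hc' : c * (B.im - A.im) = B.im * A.re - A.im * B.re := div_mul_cancel₀ _ hsub
      obtain ⟨γ, γ', hγ, hmem⟩ := exists_isLine_of_sq_add_sq_eq c
        (R := √((v₀.re - c) ^ 2 + v₀.im ^ 2)) (by positivity)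
      refine ⟨γ, γ', hγ, fun v hv => hmem v ?_⟩
      rw [Real.sq_sqrt (by positivity), ← mul_left_inj' hsub]
      linear_combination key v hv - h0 - 2 * (v.re - v₀.re) * hc'
    · obtain ⟨γ, γ', hγ, -⟩ := exists_isLine_of_re_eq 0
      exact ⟨γ, γ', hγ, fun v hv => (hne ⟨v, hv⟩).elim⟩

theorem exists_isLine_mem (z w : ℍ) : ∃ γ γ', IsLine γ γ' ∧ z ∈ range γ ∧ w ∈ range γ := by
  by_cases hre : z.re = w.re
  · obtain ⟨γ, γ', hγ, hmem⟩ := exists_isLine_of_re_eq w.re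
    exact ⟨γ, γ', hγ, hmem z hre, hmem w rfl⟩
  · have hsub : w.re - z.re ≠ 0 := sub_ne_zero.2 fun h => hre h.symm
    set c := (w.re ^ 2 + w.im ^ 2 - z.re ^ 2 - z.im ^ 2) / (2 * (w.re - z.re)) with hc
    have hc' : c * (2 * (w.re - z.re)) = w.re ^ 2 + w.im ^ 2 - z.re ^ 2 - z.im ^ 2 :=
      div_mul_cancel₀ _ (mul_ne_zero two_ne_zero hsub)
    have hz := z.im_pos
    obtain ⟨γ, γ', hγ, hmem⟩ := exists_isLine_of_sq_add_sq_eq c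
      (R := √((z.re - c) ^ 2 + z.im ^ 2)) (by positivity)
    refine ⟨γ, γ', hγ, hmem z ?_, hmem w ?_⟩
    · rw [Real.sq_sqrt (by positivity)]
    · rw [Real.sq_sqrt (by positivity)]
      linear_combination -hc'

end UpperHalfPlane

open scoped ComplexConjugate

/-- The part of `Ω` in the closed upper (`ε = 1`) or lower (`ε = -1`) half plane. -/
def halfPart (Ω : Set ℂ) (ε : ℝ) : Set ℂ := {z ∈ Ω | 0 ≤ ε * z.im}

namespace IsBigGapDomain

variable {Ω : Set ℂ} {a b : ℕ → ℝ} {K ε : ℝ}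

theorem contractibleSpace_halfPart (h : IsBigGapDomain Ω a b K) (hε : ε ^ 2 = 1) :
    ContractibleSpace (halfPart Ω ε) := by
  have h0 : ε ≠ 0 := fun h0 => by simp [h0] at hε
  have hI : (ε : ℂ) * I ∈ halfPart Ω ε := by
    refine ⟨h.mem_of_im_ne_zero _ (by simpa using h0), ?_⟩
    simpa using mul_self_nonneg ε
  refine StarConvex.contractibleSpace (x := (ε : ℂ) * I) (fun z hz s t hs ht hst => ?_) ⟨_, hI⟩
  have him : ε * (s • ((ε : ℂ) * I) + t • z).im = s + t * (ε * z.im) := by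
    simp
    linear_combination s * hε
  have h1 := mul_nonneg ht hz.2
  refine ⟨?_, him ▸ by positivity⟩
  rcases hs.eq_or_lt with rfl | hs'
  · obtain rfl : t = 1 := by linarith
    simpa using hz.1
  · refine h.mem_of_im_ne_zero _ fun h2 => ?_
    rw [h2, mul_zero] at him
    linarith

theorem locallyPathConnectedSpace_halfPart (h : IsBigGapDomain Ω a b K) (ε : ℝ) :
    LocallyPathConnectedSpace (halfPart Ω ε) := by
  have hconv : Convex ℝ {z : ℂ | 0 ≤ ε * z.im} := fun x hx y hy s t hs ht _ => by
    have h1 := mul_nonneg hs hx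
    have h2 := mul_nonneg ht hy
    have h3 : ε * (s • x + t • y).im = s * (ε * x.im) + t * (ε * y.im) := by simp; ring
    exact (h3 ▸ add_nonneg h1 h2 : 0 ≤ ε * (s • x + t • y).im)
  have := hconv.locallyPathConnectedSpace
  have hsub : halfPart Ω ε ⊆ {z : ℂ | 0 ≤ ε * z.im} := fun z hz => hz.2
  refine (⟨Topology.IsEmbedding.inclusion hsub, ?_⟩ :
    Topology.IsOpenEmbedding (inclusion hsub)).locallyPathConnectedSpace
  rw [range_inclusion]
  convert h.isOpen.preimage (continuous_subtype_val (p := fun z => z ∈ {z : ℂ | 0 ≤ ε * z.im})) using 1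
  ext z
  exact ⟨fun hz => hz.1, fun hz => ⟨hz, z.2⟩⟩

end IsBigGapDomain

/-- The folding map of the plane onto a closed half plane. -/
noncomputable def foldHalf (ε : ℝ) (z : ℂ) : ℂ := ⟨z.re, ε * |z.im|⟩

theorem continuous_foldHalf (ε : ℝ) : Continuous (foldHalf ε) := by
  have : foldHalf ε = fun z => (z.re : ℂ) + ((ε * |z.im| : ℝ) : ℂ) * I := funext fun z => by
    apply Complex.ext <;> simp [foldHalf]
  rw [this]
  fun_prop

theorem foldHalf_eq {ε : ℝ} (hε : ε ^ 2 = 1) (z : ℂ) :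
    foldHalf ε z = z ∨ foldHalf ε z = conj z := by
  have h1 : (ε * |z.im|) ^ 2 = z.im ^ 2 := by rw [mul_pow, hε, sq_abs, one_mul]
  rcases sq_eq_sq_iff_eq_or_eq_neg.1 h1 with h | h
  · exact .inl (Complex.ext rfl h)
  · exact .inr (Complex.ext (by simp [foldHalf]) (by simpa [foldHalf] using h))

theorem norm_foldHalf_sub_le {ε : ℝ} (hε : ε ^ 2 = 1) (z w : ℂ) :
    ‖foldHalf ε z - foldHalf ε w‖ ≤ ‖z - w‖ := by
  refine abs_le_of_sq_le_sq' ?_ (norm_nonneg _) |>.2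
  rw [← Complex.normSq_eq_norm_sq, ← Complex.normSq_eq_norm_sq, Complex.normSq_apply,
    Complex.normSq_apply]
  have h1 : (|z.im| - |w.im|) ^ 2 ≤ (z.im - w.im) ^ 2 := sq_le_sq.2 (abs_abs_sub_abs_le _ _)
  have h2 : (ε * |z.im| - ε * |w.im|) ^ 2 = (|z.im| - |w.im|) ^ 2 := by
    linear_combination (|z.im| - |w.im|) ^ 2 * hε
  simp only [foldHalf, sub_re, sub_im]
  nlinarith

theorem foldHalf_of_mem {Ω : Set ℂ} {ε : ℝ} (hε : ε ^ 2 = 1) {z : ℂ} (hz : z ∈ halfPart Ω ε) :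
    foldHalf ε z = z := by
  refine Complex.ext rfl ?_
  have h1 : |ε| = 1 := by
    rcases sq_eq_sq_iff_eq_or_eq_neg.1 (hε.trans (one_pow 2).symm) with rfl | rfl <;> simp
  have h2 : |z.im| = ε * z.im := by rw [← abs_of_nonneg hz.2, abs_mul, h1, one_mul]
  show ε * |z.im| = z.im
  rw [h2]
  linear_combination z.im * hε

theorem foldHalf_mem {Ω : Set ℂ} {a b : ℕ → ℝ} {K ε : ℝ} (h : IsBigGapDomain Ω a b K)
    (hε : ε ^ 2 = 1) {z : ℂ} (hz : z ∈ Ω) : foldHalf ε z ∈ halfPart Ω ε := by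
  refine ⟨?_, ?_⟩
  · rcases foldHalf_eq hε z with e | e <;> rw [e]
    exacts [hz, h.conj_mem hz]
  · show 0 ≤ ε * (ε * |z.im|)
    have : ε * (ε * |z.im|) = |z.im| := by linear_combination |z.im| * hε
    rw [this]
    exact abs_nonneg _

namespace UpperHalfPlane

theorem eventually_dist_le {s : Set ℂ} {Φ : ℂ → ℍ} {f' z : ℂ}
    (hΦ : ContinuousWithinAt Φ s z) (hd : HasDerivWithinAt (fun w => (Φ w : ℂ)) f' s z) {ε : ℝ}
    (hε : 0 < ε) :
    ∀ᶠ w in nhdsWithin z s, dist (Φ w) (Φ z) ≤ (‖f'‖ / (Φ z).im + ε) * ‖w - z‖ := by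
  have hi := (Φ z).im_pos
  have hc : Tendsto (fun w => (‖f'‖ + ε * (Φ z).im / 2) / √((Φ w).im * (Φ z).im)) (nhdsWithin z s)
      (nhds ((‖f'‖ + ε * (Φ z).im / 2) / √((Φ z).im * (Φ z).im))) := by
    have h1 : Tendsto (fun w => (Φ w).im) (nhdsWithin z s) (nhds (Φ z).im) :=
      (continuous_im.tendsto _).comp hΦ
    exact tendsto_const_nhds.div (h1.mul_const _).sqrt (by positivity)
  have hlt : (‖f'‖ + ε * (Φ z).im / 2) / √((Φ z).im * (Φ z).im) < ‖f'‖ / (Φ z).im + ε := by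
    rw [Real.sqrt_mul_self hi.le, add_div]
    have : ε * (Φ z).im / 2 / (Φ z).im = ε / 2 := by field_simp
    linarith
  have ho := (hasDerivWithinAt_iff_isLittleO.1 hd).def (c := ε * (Φ z).im / 2) (by positivity)
  filter_upwards [hc.eventually_lt_const hlt, ho] with w h1 h2
  have h3 : ‖(Φ w : ℂ) - Φ z‖ ≤ (‖f'‖ + ε * (Φ z).im / 2) * ‖w - z‖ := by
    have h4 := norm_add_le ((Φ w : ℂ) - Φ z - (w - z) • f') ((w - z) • f')
    rw [sub_add_cancel, norm_smul] at h4
    linarith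
  calc dist (Φ w) (Φ z) ≤ dist (Φ w : ℂ) (Φ z) / √((Φ w).im * (Φ z).im) :=
        dist_le_dist_coe_div_sqrt _ _
    _ ≤ (‖f'‖ + ε * (Φ z).im / 2) * ‖w - z‖ / √((Φ w).im * (Φ z).im) := by
        rw [Complex.dist_eq]; gcongr
    _ = (‖f'‖ + ε * (Φ z).im / 2) / √((Φ w).im * (Φ z).im) * ‖w - z‖ := by ring
    _ ≤ _ := by gcongr

end UpperHalfPlane

namespace IsHalfPlaneCover

open UpperHalfPlane hiding I

variable {Ω : Set ℂ} {lam : ℂ → ℝ} {q : ℂ → ℂ} {a b : ℕ → ℝ} {K ε : ℝ}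

theorem density_nonneg (h : IsHalfPlaneCover Ω lam q) : ∀ z ∈ Ω, 0 ≤ lam z := fun _ hz =>
  (h.density_pos hz).le

theorem densityDist_le_dist (h : IsHalfPlaneCover Ω lam q) (ζ ξ : ℍ) :
    densityDist Ω lam (q ζ) (q ξ) ≤ dist ζ ξ := by
  obtain ⟨γ, γ', hγ, ⟨s, rfl⟩, ⟨t, rfl⟩⟩ := exists_isLine_mem ζ ξ
  rw [hγ.isometry.dist_eq, Real.dist_eq]
  wlog hst : s ≤ t generalizing s t
  · rw [densityDist_comm, abs_sub_comm]
    exact this t s (le_of_not_ge hst)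
  rw [abs_sub_comm, abs_of_nonneg (sub_nonneg.2 hst)]
  have hγc : Continuous fun t => (γ t : ℂ) :=
    continuous_iff_continuousAt.2 fun t => (hγ.hasDerivAt t).continuousAt
  refine densityDist_le_sub (γ := fun t => q (γ t)) (γ' := fun t => deriv q (γ t) * γ' t)
    (F := fun t => t) (F' := fun _ => 1)
    h.continuousOn_density h.density_nonneg hst (fun t => ?_) ?_ (fun t _ => h.mem _)
    (fun t => hasDerivAt_id t) continuous_const fun t _ => ?_
  · exact (h.differentiableAt (γ t)).hasDerivAt.comp t (hγ.hasDerivAt t)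
  · refine Continuous.mul ?_ hγ.continuous_deriv
    exact continuous_iff_continuousAt.2 fun t =>
      ContinuousAt.comp (f := fun t => (γ t : ℂ)) (h.analyticAt (γ t)).deriv.continuousAt
        hγc.continuousAt
  · rw [norm_mul, ← mul_assoc, h.density, hγ.norm_deriv, one_div_mul_cancel (γ t).im_pos.ne']

theorem exists_section (h : IsHalfPlaneCover Ω lam q) (hΩ : IsBigGapDomain Ω a b K)
    (hε : ε ^ 2 = 1) {z₀ : ℂ} (hz₀ : z₀ ∈ halfPart Ω ε) {ζ : ℍ} (hζ : q ζ = z₀) :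
    ∃ Φ : ℂ → ℍ, ContinuousOn Φ (halfPart Ω ε) ∧ Φ z₀ = ζ ∧ (∀ z ∈ halfPart Ω ε, q (Φ z) = z) ∧
      ∀ x ∈ halfPart Ω ε, ∀ y ∈ halfPart Ω ε, densityDist Ω lam x y = dist (Φ x) (Φ y) := by
  have := hΩ.contractibleSpace_halfPart hε
  have := hΩ.locallyPathConnectedSpace_halfPart ε
  obtain ⟨Φ, hΦ, hΦ0, hΦq⟩ := h.exists_lift continuousOn_id (fun z hz => hz.1) hz₀ hζ
  refine ⟨Φ, hΦ, hΦ0, hΦq, fun x hx y hy => le_antisymm ?_ ?_⟩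
  · simpa only [hΦq x hx, hΦq y hy, id] using h.densityDist_le_dist (Φ x) (Φ y)
  have hfold : ContinuousOn (fun z => Φ (foldHalf ε z)) Ω :=
    hΦ.comp (continuous_foldHalf ε).continuousOn fun z hz => foldHalf_mem hΩ hε hz
  have key := sub_le_densityDist h.continuousOn_density h.density_nonneg
    (hΩ.exists_restingCurve hx.1 hy.1) (f := fun z => dist (Φ x) (Φ (foldHalf ε z)))
    ((continuous_const.dist continuous_id).comp_continuousOn hfold) fun z hz r hr => ?_
  · simpa only [foldHalf_of_mem hε hx, foldHalf_of_mem hε hy, dist_self, sub_zero] using key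
  have hzm := foldHalf_mem hΩ hε hz
  have hd := h.hasDerivWithinAt_lift (hΦ _ hzm) hΦq hzm (hasDerivWithinAt_id _ _)
  have hlam : lam z = ‖1 / deriv q (Φ (foldHalf ε z))‖ / (Φ (foldHalf ε z)).im := by
    have h1 : lam z = lam (foldHalf ε z) := by
      rcases foldHalf_eq hε z with e | e <;> rw [e]
      exact (h.density_conj (fun _ => hΩ.conj_mem) hz).symm
    have h2 := h.density_eq (Φ (foldHalf ε z))
    rw [hΦq _ hzm, id] at h2
    rw [h1, h2, norm_div, norm_one, div_right_comm]
  have ht : Tendsto (foldHalf ε) (nhdsWithin z Ω) (nhdsWithin (foldHalf ε z) (halfPart Ω ε)) :=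
    (continuous_foldHalf ε).continuousWithinAt.tendsto_nhdsWithin
      fun w hw => foldHalf_mem hΩ hε hw
  filter_upwards [ht.eventually (eventually_dist_le (hΦ _ hzm) hd hr)] with w hw
  have h1 := dist_triangle (Φ x) (Φ (foldHalf ε z)) (Φ (foldHalf ε w))
  have h2 : 0 ≤ lam z + r := add_nonneg (h.density_nonneg z hz) hr.le
  rw [← hlam, dist_comm] at hw
  have h3 := mul_le_mul_of_nonneg_left (norm_foldHalf_sub_le hε w z) h2
  linarith

end IsHalfPlaneCover

namespace IsHalfPlaneCover

open UpperHalfPlane hiding I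
open scoped ComplexConjugate

variable {Ω : Set ℂ} {lam : ℂ → ℝ} {q : ℂ → ℂ} {a b : ℕ → ℝ} {K : ℝ}

theorem densityDist_conj_conj (h : IsHalfPlaneCover Ω lam q) (hΩ : IsBigGapDomain Ω a b K)
    (x y : ℂ) : densityDist Ω lam (conj x) (conj y) = densityDist Ω lam x y :=
  densityDist_conj (fun _ => hΩ.conj_mem) (fun _ => h.density_conj fun _ => hΩ.conj_mem) x y

theorem I_mem_halfPart (hΩ : IsBigGapDomain Ω a b K) : I ∈ halfPart Ω 1 :=
  ⟨hΩ.mem_of_im_ne_zero _ (by simp), by simp⟩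

theorem neg_I_mem_halfPart (hΩ : IsBigGapDomain Ω a b K) : -I ∈ halfPart Ω (-1) :=
  ⟨hΩ.mem_of_im_ne_zero _ (by simp), by simp⟩

theorem fourPoint_densityDist (h : IsHalfPlaneCover Ω lam q) (hΩ : IsBigGapDomain Ω a b K) :
    FourPoint (halfPart Ω 1) (densityDist Ω lam) (4 * Real.log 2 + 4 * 0) := by
  obtain ⟨ζ, hζ⟩ := h.exists_eq _ (I_mem_halfPart hΩ).1
  obtain ⟨Φ, -, -, -, hd⟩ := h.exists_section hΩ (one_pow 2) (I_mem_halfPart hΩ) hζ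
  intro x hx y hy z hz w hw
  rw [hd x hx y hy, hd z hz w hw, hd x hx z hz, hd y hy w hw, hd x hx w hw, hd y hy z hz]
  exact fourPoint_dist _ (mem_univ _) _ (mem_univ _) _ (mem_univ _) _ (mem_univ _)

theorem ofReal_mem_halfPart {x : ℝ} (hx : (x : ℂ) ∈ Ω) (ε : ℝ) : (x : ℂ) ∈ halfPart Ω ε :=
  ⟨hx, by simp⟩

/-- Two continuous lifts of the same map that agree at a point of a preconnected set agree on the
whole set. -/
theorem eqOn_lifts (h : IsHalfPlaneCover Ω lam q) {s : Set ℂ} (hs : IsPreconnected s)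
    {Φ Ψ : ℂ → ℍ} (hΦ : ContinuousOn Φ s) (hΨ : ContinuousOn Ψ s) (hq : ∀ z ∈ s, q (Φ z) = q (Ψ z))
    {z₀ : ℂ} (hz₀ : z₀ ∈ s) (h0 : Φ z₀ = Ψ z₀) : EqOn Φ Ψ s := by
  have hcov := h.isCoveringMapOn.isCoveringMap_restrictPreimage
  have := hcov.eqOn_of_comp_eqOn (g₁ := fun z => ⟨Φ z, h.mem _⟩) (g₂ := fun z => ⟨Ψ z, h.mem _⟩) hs
    (Topology.IsInducing.subtypeVal.continuousOn_iff.2 hΦ)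
    (Topology.IsInducing.subtypeVal.continuousOn_iff.2 hΨ)
    (fun z hz => Subtype.ext (hq z hz)) hz₀ (Subtype.ext h0)
  exact fun z hz => congrArg Subtype.val (this hz)

/-- Each component of the real part of `Ω` is a geodesic, parametrized by a continuous function. -/
theorem exists_arclength (h : IsHalfPlaneCover Ω lam q) (hΩ : IsBigGapDomain Ω a b K) {J : Set ℝ}
    (hJ : IsPreconnected J) (hne : J.Nonempty) (hJΩ : ∀ x ∈ J, (x : ℂ) ∈ Ω) :
    ∃ τ : ℝ → ℝ, ContinuousOn τ J ∧
      ∀ s ∈ J, ∀ t ∈ J, densityDist Ω lam (s : ℂ) t = |τ s - τ t| := by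
  obtain ⟨s₀, hs₀⟩ := hne
  obtain ⟨ζ, hζ⟩ := h.exists_eq _ (hJΩ s₀ hs₀)
  obtain ⟨Φ, hΦ, hΦ0, hΦq, hΦd⟩ :=
    h.exists_section hΩ (one_pow 2) (ofReal_mem_halfPart (hJΩ s₀ hs₀) 1) hζ
  obtain ⟨Ψ, hΨ, hΨ0, hΨq, hΨd⟩ :=
    h.exists_section hΩ (ε := -1) (by norm_num) (ofReal_mem_halfPart (hJΩ s₀ hs₀) (-1)) hζ
  have hsub : ∀ ε, ofReal '' J ⊆ halfPart Ω ε := by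
    rintro ε _ ⟨x, hx, rfl⟩
    exact ofReal_mem_halfPart (hJΩ x hx) ε
  have heq : EqOn Φ Ψ (ofReal '' J) :=
    h.eqOn_lifts (hJ.image _ continuous_ofReal.continuousOn) (hΦ.mono (hsub 1)) (hΨ.mono (hsub (-1)))
      (fun z hz => by rw [hΦq z (hsub 1 hz), hΨq z (hsub (-1) hz)]) (mem_image_of_mem _ hs₀)
      (hΦ0.trans hΨ0.symm)
  have hI := I_mem_halfPart hΩ
  have hI' := neg_I_mem_halfPart hΩ
  have hAB : Φ I ≠ Ψ (-I) := fun hAB => by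
    have h1 := hΦq I hI
    rw [hAB, hΨq _ hI'] at h1
    have h2 := congrArg Complex.im h1
    norm_num at h2
  obtain ⟨γ, γ', hγ, hmem⟩ := exists_isLine_of_dist_eq hAB
  have hex : ∀ s : ℝ, ∃ t, s ∈ J → γ t = Φ s := fun s => by
    by_cases hs : s ∈ J
    · have hs1 := hsub 1 (mem_image_of_mem _ hs)
      have hs2 := hsub (-1) (mem_image_of_mem _ hs)
      obtain ⟨t, ht⟩ := hmem (Φ s) (by
        rw [← hΦd _ hs1 _ hI, heq (mem_image_of_mem _ hs), ← hΨd _ hs2 _ hI',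
          ← h.densityDist_conj_conj hΩ, conj_ofReal, conj_I])
      exact ⟨t, fun _ => ht⟩
    · exact ⟨0, fun hs' => (hs hs').elim⟩
  choose τ hτ using hex
  refine ⟨τ, ?_, fun s hs t ht => ?_⟩
  · rw [hγ.isometry.isUniformInducing.isInducing.continuousOn_iff]
    refine ((hΦ.mono (hsub 1)).comp continuous_ofReal.continuousOn (mapsTo_image _ _)).congr ?_
    exact fun s hs => hτ s hs
  · rw [hΦd _ (hsub 1 (mem_image_of_mem _ hs)) _ (hsub 1 (mem_image_of_mem _ ht)), ← hτ s hs,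
      ← hτ t ht, hγ.isometry.dist_eq, Real.dist_eq]

theorem isGated_ofReal_image (h : IsHalfPlaneCover Ω lam q) (hΩ : IsBigGapDomain Ω a b K)
    {J : Set ℝ} (hJ : IsPreconnected J) (hne : J.Nonempty) (hJΩ : ∀ x ∈ J, (x : ℂ) ∈ Ω) :
    IsGated (densityDist Ω lam) (halfPart Ω 1) (ofReal '' J)
      (2 * (4 * Real.log 2 + 4 * 0) + 4) := by
  obtain ⟨τ, hτ, hd⟩ := h.exists_arclength hΩ hJ hne hJΩ
  refine (h.fourPoint_densityDist hΩ).isGated_line (by positivity) (densityDist_comm _ _) ?_ ?_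
  · rintro _ ⟨x, hx, rfl⟩
    exact ofReal_mem_halfPart (hJΩ x hx) 1
  rintro _ ⟨s, hs, rfl⟩ _ ⟨t, ht, rfl⟩ R hR hRd
  rw [hd s hs t ht] at hRd ⊢
  have hord := (hJ.image τ hτ).ordConnected.uIcc_subset (mem_image_of_mem τ hs)
    (mem_image_of_mem τ ht)
  rcases le_total (τ s) (τ t) with hst | hst
  · rw [abs_sub_comm, abs_of_nonneg (sub_nonneg.2 hst)] at hRd ⊢
    obtain ⟨m, hm, hmR⟩ := hord (show τ s + R ∈ uIcc (τ s) (τ t) by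
      rw [uIcc_of_le hst]; exact ⟨by linarith, by linarith⟩)
    refine ⟨m, mem_image_of_mem _ hm, ?_, ?_⟩
    · rw [hd s hs m hm, hmR, sub_add_cancel_left, abs_neg, abs_of_nonneg hR]
    · rw [hd m hm t ht, hmR, abs_sub_comm, abs_of_nonneg] <;> linarith
  · rw [abs_of_nonneg (sub_nonneg.2 hst)] at hRd ⊢
    obtain ⟨m, hm, hmR⟩ := hord (show τ s - R ∈ uIcc (τ s) (τ t) by
      rw [uIcc_of_ge hst]; exact ⟨by linarith, by linarith⟩)
    refine ⟨m, mem_image_of_mem _ hm, ?_, ?_⟩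
    · rw [hd s hs m hm, hmR, sub_sub_cancel, abs_of_nonneg hR]
    · rw [hd m hm t ht, hmR, abs_of_nonneg] <;> linarith

theorem density_mul_infDist_le (h : IsHalfPlaneCover Ω lam q) (hΩ : IsBigGapDomain Ω a b K) {z : ℂ}
    (hz : z ∈ Ω) : lam z * infDist z Ωᶜ ≤ 2 :=
  h.density_mul_radius_le (hΩ.infDist_pos hz) ball_infDist_compl_subset

theorem densityDist_ofReal_mul_I_le (h : IsHalfPlaneCover Ω lam q) (hΩ : IsBigGapDomain Ω a b K)
    {p r D : ℝ} (hr : 0 < r) (hp : |p| = r) (hD : 0 < D) (hDp : D ≤ infDist (p : ℂ) Ωᶜ) :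
    densityDist Ω lam (p : ℂ) (r * I) ≤ 12 * (r / D) := by
  have hnorm : ‖(r : ℂ) * I - p‖ ≤ 2 * r := by
    refine (norm_sub_le _ _).trans_eq ?_
    rw [norm_mul, norm_I, norm_real, norm_real, Real.norm_eq_abs, Real.norm_eq_abs, hp,
      abs_of_pos hr]
    ring
  have hδ : ∀ z ∈ segment ℝ (p : ℂ) (r * I), D ≤ 3 * infDist z Ωᶜ := fun z hz => by
    rw [segment_eq_image'] at hz
    obtain ⟨s, hs, rfl⟩ := hz
    have h1 := hΩ.abs_im_le_infDist ((p : ℂ) + s • ((r : ℂ) * I - p))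
    have h2 := infDist_le_infDist_add_dist (s := Ωᶜ) (x := (p : ℂ))
      (y := (p : ℂ) + s • ((r : ℂ) * I - p))
    have h3 : dist (p : ℂ) ((p : ℂ) + s • ((r : ℂ) * I - p)) ≤ 2 * (s * r) := by
      rw [dist_self_add_right, norm_smul, Real.norm_of_nonneg hs.1]
      nlinarith [hs.1]
    have h4 : ((p : ℂ) + s • ((r : ℂ) * I - p)).im = s * r := by simp
    rw [h4] at h1
    linarith [le_abs_self (s * r)]
  have hmem : segment ℝ (p : ℂ) (r * I) ⊆ Ω := fun z hz => by
    by_contra hcon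
    have := hδ z hz
    rw [infDist_zero_of_mem hcon] at this
    linarith
  have hM : ∀ z ∈ segment ℝ (p : ℂ) (r * I), lam z ≤ 6 / D := fun z hz => by
    rw [le_div_iff₀ hD]
    have h1 := h.density_mul_infDist_le hΩ (hmem hz)
    have h2 := mul_le_mul_of_nonneg_left (hδ z hz) (h.density_nonneg z (hmem hz))
    linarith
  calc densityDist Ω lam (p : ℂ) (r * I) ≤ 6 / D * ‖(r : ℂ) * I - p‖ :=
        segment_bound_densityDist h.density_nonneg h.continuousOn_density hmem hM
    _ ≤ 6 / D * (2 * r) := by gcongr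
    _ = 12 * (r / D) := by ring

theorem densityDist_bridge_le (h : IsHalfPlaneCover Ω lam q) (hΩ : IsBigGapDomain Ω a b K)
    (n : ℕ) : ∃ x ∈ ofReal '' Iio 0, ∃ y ∈ ofReal '' Ioo (a n) (b n),
      densityDist Ω lam x y ≤ 12 + 12 / ((1 - K⁻¹) / 4) := by
  have hK := hΩ.one_lt
  have ha := hΩ.left_nonneg n
  have hab := hΩ.left_lt_right n
  have hKi : K⁻¹ < 1 := inv_lt_one_of_one_lt₀ hK
  have hgap : a n ≤ K⁻¹ * b n := by
    rw [le_inv_mul_iff₀ (by linarith)]; exact hΩ.gap n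
  set r := (a n + b n) / 2 with hrdef
  set κ := (1 - K⁻¹) / 4 with hκ
  have hκ0 : 0 < κ := by rw [hκ]; linarith
  have hr : 0 < r := by linarith
  have hκr : κ * r ≤ (b n - a n) / 2 := by
    have h1 : κ * r ≤ κ * b n := by gcongr; linarith
    have h2 : 4 * (κ * b n) ≤ b n - a n := by rw [hκ]; linarith
    linarith
  have hmid : (r : ℂ) ∈ Ω := (hΩ.ofReal_mem_iff r).2 (.inr ⟨n, by linarith, by linarith⟩)
  have hneg : ((-r : ℝ) : ℂ) ∈ Ω := (hΩ.ofReal_mem_iff _).2 (.inl (by linarith))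
  have hrI : (r : ℂ) * I ∈ Ω := hΩ.mem_of_im_ne_zero _ (by simpa using hr.ne')
  refine ⟨((-r : ℝ) : ℂ), mem_image_of_mem _ (show -r < 0 by linarith), r,
    mem_image_of_mem _ ⟨by linarith, by linarith⟩, ?_⟩
  have h1 := h.densityDist_ofReal_mul_I_le hΩ hr (by rw [abs_neg, abs_of_pos hr]) hr
    (le_trans (by linarith) (hΩ.neg_re_le_infDist (-r)))
  have h2 := h.densityDist_ofReal_mul_I_le hΩ hr (abs_of_pos hr) (mul_pos hκ0 hr)
    (hκr.trans ((le_min (by linarith) (by linarith)).trans (hΩ.min_le_infDist r n)))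
  rw [densityDist_comm] at h2
  have h3 := densityDist_triangle h.continuousOn_density h.density_nonneg
    (hΩ.exists_restingCurve hneg hrI) (hΩ.exists_restingCurve hrI hmid)
  rw [div_self hr.ne'] at h1
  have h4 : r / (κ * r) = 1 / κ := by field_simp
  rw [h4] at h2
  have h5 : 12 * (1 / κ) = 12 / κ := by ring
  linarith

theorem gromovHyperbolicWith_densityDist (h : IsHalfPlaneCover Ω lam q)
    (hΩ : IsBigGapDomain Ω a b K) : GromovHyperbolicWith Ω (densityDist Ω lam)
      (2 * (4 * (4 * Real.log 2 + 4 * 0) + 20 * (9 * (2 * (4 * Real.log 2 + 4 * 0) + 4) +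
        8 * (12 + 12 / ((1 - K⁻¹) / 4)) + 4 * (4 * Real.log 2 + 4 * 0) + 8) + 20)) := by
  have hKi : K⁻¹ < 1 := inv_lt_one_of_one_lt₀ hΩ.one_lt
  have hκ : 0 ≤ 12 / ((1 - K⁻¹) / 4) := div_nonneg (by norm_num) (by linarith)
  have hhalf : {z ∈ Ω | 0 ≤ z.im} = halfPart Ω 1 := by simp [halfPart]
  have hneg : ∀ x ∈ Iio (0 : ℝ), (x : ℂ) ∈ Ω := fun x hx => (hΩ.ofReal_mem_iff x).2 (.inl hx)
  have hgap : ∀ n, ∀ x ∈ Ioo (a n) (b n), (x : ℂ) ∈ Ω := fun n x hx =>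
    (hΩ.ofReal_mem_iff x).2 (.inr ⟨n, hx⟩)
  have hsub : ∀ J : Set ℝ, (∀ x ∈ J, (x : ℂ) ∈ Ω) → ofReal '' J ⊆ halfPart Ω 1 := by
    rintro J hJ _ ⟨x, hx, rfl⟩
    exact ofReal_mem_halfPart (hJ x hx) 1
  have hreal : {z ∈ Ω | z.im = 0} = ofReal '' Iio 0 ∪ ⋃ n, ofReal '' Ioo (a n) (b n) := by
    refine Subset.antisymm (fun z hz => ?_) (union_subset ?_ (iUnion_subset fun n => ?_))
    · obtain ⟨x, rfl⟩ : ∃ x : ℝ, (x : ℂ) = z := ⟨z.re, Complex.ext rfl hz.2.symm⟩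
      rcases (hΩ.ofReal_mem_iff x).1 hz.1 with hx | ⟨n, hx⟩
      · exact .inl (mem_image_of_mem _ hx)
      · exact .inr (mem_iUnion.2 ⟨n, mem_image_of_mem _ hx⟩)
    · rintro _ ⟨x, hx, rfl⟩
      exact ⟨hneg x hx, ofReal_im x⟩
    · rintro _ ⟨x, hx, rfl⟩
      exact ⟨hgap n x hx, ofReal_im x⟩
  refine hΩ.gromovHyperbolicWith h.continuousOn_density h.density_nonneg
    (fun z => h.density_conj fun _ => hΩ.conj_mem) (by positivity) (by positivity)
    (hhalf ▸ h.fourPoint_densityDist hΩ) fun x hx hx0 => ?_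
  rw [hreal]
  refine IsGated.exists_isGate_union_iUnion (h.fourPoint_densityDist hΩ) (by positivity)
    (by positivity) (densityDist_nonneg h.density_nonneg) (densityDist_comm _ _)
    (fun x hx y hy z hz => densityDist_triangle h.continuousOn_density h.density_nonneg
      (hΩ.exists_restingCurve hx.1 hy.1) (hΩ.exists_restingCurve hy.1 hz.1))
    (hsub _ hneg) (fun n => hsub _ (hgap n))
    (h.isGated_ofReal_image hΩ isPreconnected_Iio nonempty_Iio hneg)
    (fun n => h.isGated_ofReal_image hΩ isPreconnected_Ioo
      (nonempty_Ioo.2 (hΩ.left_lt_right n)) (hgap n))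
    (h.densityDist_bridge_le hΩ) (hhalf ▸ ⟨hx, hx0⟩)

end IsHalfPlaneCover

theorem GromovHyperbolicWith.mono {α : Type*} {S : Set α} {d : α → α → ℝ} {δ δ' : ℝ}
    (h : GromovHyperbolicWith S d δ) (hδ : δ ≤ δ') : GromovHyperbolicWith S d δ' :=
  fun x hx y hy z hz gxy gxz gzy h1 h2 h3 t ht =>
    let ⟨p, hp, hd⟩ := h x hx y hy z hz gxy gxz gzy h1 h2 h3 t ht
    ⟨p, hp, hd.trans hδ⟩

noncomputable section

/-- Theorem 3.6: if `bₙ ≥ K·aₙ` for a fixed `K > 1` and every `n`, then the Poincaré and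
quasihyperbolic metrics of `Ω` are Gromov `δ`-hyperbolic with `δ` depending only on `K`. -/
theorem denjoy_hyperbolic_of_uniformly_big_gaps :
    ∃ F : ℝ → ℝ,
      ∀ (Ω : Set ℂ) (a b : ℕ → ℝ) (K : ℝ),
        IsDenjoyDomain Ω → 1 < K →
        (∀ n, 0 ≤ a n) →
        (∀ n, a n < b n) →
        (∀ n, b n ≤ a (n + 1)) →
        (fun x : ℝ => (x : ℂ)) ⁻¹' Ω = Iio 0 ∪ ⋃ n, Ioo (a n) (b n) →
        (∀ n, K * a n ≤ b n) →
        GromovHyperbolicWith Ω (qhDist Ω) (F K) ∧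
          ∀ lam : ℂ → ℝ, IsPoincareDensity Ω lam →
            GromovHyperbolicWith Ω (densityDist Ω lam) (F K) := by
  refine ⟨fun K => max
    (2 * (4 * (4 * Real.log 2 + 4 * 3) + 20 * (2 * Real.log (78 / ((1 - K⁻¹) / 4)) + 9) + 20))
    (2 * (4 * (4 * Real.log 2 + 4 * 0) + 20 * (9 * (2 * (4 * Real.log 2 + 4 * 0) + 4) +
      8 * (12 + 12 / ((1 - K⁻¹) / 4)) + 4 * (4 * Real.log 2 + 4 * 0) + 8) + 20)),
    fun Ω a b K hΩ hK ha hab hba hreal hgap => ?_⟩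
  have h := isBigGapDomain_of_isDenjoyDomain hΩ hK ha hab hba hreal hgap
  refine ⟨h.gromovHyperbolicWith_qhDist.mono (le_max_left _ _), fun lam hlam => ?_⟩
  obtain ⟨q, hq⟩ := hlam.exists_isHalfPlaneCover
  exact (hq.gromovHyperbolicWith_densityDist h).mono (le_max_right _ _)

end
end

section
/- Let D ⊆ ℂ be a Denjoy domain of hyperbolic type, let (a_n, b_n) be a component of D ∩ ℝ with b_n − a_n ≤ r for some r > 0, and let γ be a rectifiable curve in D starting at a point a ∈ (a_n, b_n) with Euclidean length s. Then the Poincaré length of γ satisfies ℓ_{h,D}(γ) ≥ 2^{−3/2} · log(1 + k₀^{−1} · log(1 + s/r)), where k₀ = 4 + log(3 + 2√2). -/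
open Set Metric Filter Complex

noncomputable section

/-- A nonvanishing holomorphic function on a disk has a holomorphic logarithm with prescribed
value at a point. -/
theorem exists_log_of_differentiableOn_ball {R : ℝ} {f : ℂ → ℂ}
    (hf : DifferentiableOn ℂ f (ball 0 R)) (h0 : ∀ z ∈ ball (0:ℂ) R, f z ≠ 0)
    {z₀ c : ℂ} (hz₀ : z₀ ∈ ball (0:ℂ) R) (hc : exp c = f z₀) :
    ∃ L : ℂ → ℂ, DifferentiableOn ℂ L (ball 0 R) ∧ L z₀ = c ∧
      ∀ z ∈ ball (0:ℂ) R, exp (L z) = f z := by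
  have hd : DifferentiableOn ℂ (fun z => deriv f z / f z) (ball 0 R) :=
    (hf.deriv isOpen_ball).div hf h0
  obtain ⟨L, hL0, hL⟩ := hd.isExactOn_ball.with_val_at z₀ c
  have hLd : DifferentiableOn ℂ L (ball 0 R) := fun z hz =>
    (hL z hz).differentiableAt.differentiableWithinAt
  have hq : ∀ z ∈ ball (0:ℂ) R, HasDerivAt (fun z => exp (-L z) * f z) 0 z := by
    intro z hz
    refine ((hL z hz).fun_neg.cexp.fun_mul
      ((hf z hz).differentiableAt (isOpen_ball.mem_nhds hz)).hasDerivAt).congr_deriv ?_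
    have := h0 z hz
    field_simp
    ring
  refine ⟨L, hLd, hL0, fun z hz => ?_⟩
  have := isOpen_ball.is_const_of_deriv_eq_zero (convex_ball (0:ℂ) R).isPreconnected
    (fun z hz => (hq z hz).differentiableAt.differentiableWithinAt)
    (fun z hz => (hq z hz).deriv) hz hz₀
  simp only [hL0, ← hc] at this
  rw [← exp_add, neg_add_cancel, exp_zero, exp_neg] at this
  field_simp at this
  exact this.symm

theorem one_sub_sq_norm_mul_one_sub_sq_norm (z w : ℂ) :
    (1 - ‖w‖ ^ 2) * (1 - ‖z‖ ^ 2) =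
      ‖1 - (starRingEnd ℂ) w * z‖ ^ 2 - ‖z - w‖ ^ 2 := by
  simp only [← normSq_eq_norm_sq, normSq_apply]
  simp
  ring

/-- At a local maximum, the hyperbolic derivative of a holomorphic function is at most `1`. -/
theorem hyperbolic_deriv_le_one_of_isLocalMax {H : ℂ → ℂ} {z₀ : ℂ}
    (hH : ∀ᶠ z in nhds z₀, DifferentiableAt ℂ H z) (hz₀ : ‖z₀‖ < 1) (hH₀ : ‖H z₀‖ < 1)
    (hmax : IsLocalMax (fun z => ‖deriv H z‖ * (1 - ‖z‖ ^ 2) / (1 - ‖H z‖ ^ 2)) z₀) :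
    ‖deriv H z₀‖ * (1 - ‖z₀‖ ^ 2) / (1 - ‖H z₀‖ ^ 2) ≤ 1 := by
  by_contra! hc
  have hz1 : 0 < 1 - ‖z₀‖ ^ 2 := by nlinarith [norm_nonneg z₀]
  have hH1 : 0 < 1 - ‖H z₀‖ ^ 2 := by nlinarith [norm_nonneg (H z₀)]
  have hHc : ContinuousAt H z₀ := hH.self_of_nhds.continuousAt
  set P : ℂ → ℂ := fun z => 1 - (starRingEnd ℂ) z₀ * z with hP
  set P' : ℂ → ℂ := fun z => 1 - (starRingEnd ℂ) (H z₀) * H z with hP'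
  set Q : ℂ → ℂ := fun z => deriv H z * P z ^ 2 / P' z ^ 2 with hQ
  have hPz : ‖P z₀‖ = 1 - ‖z₀‖ ^ 2 := by
    have : P z₀ = ((1 - ‖z₀‖ ^ 2 : ℝ) : ℂ) := by
      simp only [hP, conj_mul']; push_cast; rfl
    rw [this, norm_real, Real.norm_of_nonneg hz1.le]
  have hPz' : ‖P' z₀‖ = 1 - ‖H z₀‖ ^ 2 := by
    have : P' z₀ = ((1 - ‖H z₀‖ ^ 2 : ℝ) : ℂ) := by
      simp only [hP', conj_mul']; push_cast; rfl
    rw [this, norm_real, Real.norm_of_nonneg hH1.le]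
  have hP'c : ContinuousAt P' z₀ := by fun_prop
  have hPc : ContinuousAt P z₀ := by fun_prop
  have hP'0 : P' z₀ ≠ 0 := by rw [← norm_pos_iff, hPz']; exact hH1
  have hP'ne : ∀ᶠ z in nhds z₀, P' z ≠ 0 := hP'c.eventually_ne hP'0
  have hHlt : ∀ᶠ z in nhds z₀, ‖H z‖ < 1 := hHc.norm.eventually_lt_const hH₀
  -- away from the centre, `H` strictly expands pseudohyperbolic distances to the centre
  have hexp : ∀ᶠ z in nhdsWithin z₀ {z₀}ᶜ, ‖z - z₀‖ * ‖P' z‖ < ‖H z - H z₀‖ * ‖P z‖ := by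
    have h1 : Tendsto (fun z => ‖slope H z₀ z‖ * (‖P z‖ / ‖P' z‖)) (nhdsWithin z₀ {z₀}ᶜ)
        (nhds (‖deriv H z₀‖ * (‖P z₀‖ / ‖P' z₀‖))) :=
      (hasDerivAt_iff_tendsto_slope.1 hH.self_of_nhds.hasDerivAt).norm.mul
        ((hPc.norm.div hP'c.norm (norm_ne_zero_iff.2 hP'0)).tendsto.mono_left nhdsWithin_le_nhds)
    rw [hPz, hPz', ← mul_div_assoc] at h1
    filter_upwards [h1.eventually_const_lt hc, self_mem_nhdsWithin,
      hP'ne.filter_mono nhdsWithin_le_nhds] with z hz hne hne'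
    have e1 : 0 < ‖z - z₀‖ := norm_pos_iff.2 (sub_ne_zero.2 hne)
    have e2 : 0 < ‖P' z‖ := norm_pos_iff.2 hne'
    rw [slope_def_field, norm_div, div_mul_div_comm, lt_div_iff₀ (by positivity), one_mul] at hz
    exact hz
  set u : ℂ → ℝ := fun z => ‖deriv H z‖ * (1 - ‖z‖ ^ 2) / (1 - ‖H z‖ ^ 2) with hu
  set κ : ℝ := (1 - ‖H z₀‖ ^ 2) / (1 - ‖z₀‖ ^ 2) with hκ
  have hκ0 : 0 < κ := div_pos hH1 hz1
  have hQu : ‖Q z₀‖ * κ = u z₀ := by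
    simp only [hQ, hu, hκ, norm_div, norm_mul, norm_pow, hPz, hPz']
    field_simp
  have hform : ∀ z, ‖H z‖ < 1 → P' z ≠ 0 → u z = ‖deriv H z‖ * κ *
      ((‖P z‖ ^ 2 - ‖z - z₀‖ ^ 2) / (‖P' z‖ ^ 2 - ‖H z - H z₀‖ ^ 2)) := by
    intro z hz hne
    have hz' : 0 < 1 - ‖H z‖ ^ 2 := by nlinarith [norm_nonneg (H z)]
    simp only [hu, hκ, hP, hP', ← one_sub_sq_norm_mul_one_sub_sq_norm]
    field_simp
  have hratio : ∀ z, ‖H z‖ < 1 → P' z ≠ 0 →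
      ‖z - z₀‖ * ‖P' z‖ < ‖H z - H z₀‖ * ‖P z‖ → ‖P z‖ ^ 2 / ‖P' z‖ ^ 2 <
      (‖P z‖ ^ 2 - ‖z - z₀‖ ^ 2) / (‖P' z‖ ^ 2 - ‖H z - H z₀‖ ^ 2) := by
    intro z hz hne hlt
    have hz' : 0 < 1 - ‖H z‖ ^ 2 := by nlinarith [norm_nonneg (H z)]
    have hpos : 0 < ‖P' z‖ ^ 2 - ‖H z - H z₀‖ ^ 2 := by
      rw [← one_sub_sq_norm_mul_one_sub_sq_norm]; positivity
    have hne' : 0 < ‖P' z‖ := norm_pos_iff.2 hne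
    rw [div_lt_div_iff₀ (by positivity) hpos]
    have : (‖z - z₀‖ * ‖P' z‖) ^ 2 < (‖H z - H z₀‖ * ‖P z‖) ^ 2 := by gcongr
    nlinarith
  have hQn : ∀ z, ‖Q z‖ * κ = ‖deriv H z‖ * κ * (‖P z‖ ^ 2 / ‖P' z‖ ^ 2) := by
    intro z
    simp only [hQ, norm_div, norm_mul, norm_pow]; ring
  have hQmax : IsLocalMax (norm ∘ Q) z₀ := by
    have : ∀ᶠ z in nhds z₀, z ∈ ({z₀}ᶜ : Set ℂ) → (norm ∘ Q) z ≤ (norm ∘ Q) z₀ := by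
      filter_upwards [eventually_nhdsWithin_iff.1 hexp, hmax, hHlt, hP'ne] with z h1 h2 h3 h4 h5
      have h6 := mul_le_mul_of_nonneg_left (hratio z h3 h4 (h1 h5)).le
        (mul_nonneg (norm_nonneg (deriv H z)) hκ0.le)
      rw [← hQn, ← hform z h3 h4] at h6
      exact le_of_mul_le_mul_right (h6.trans (h2.trans hQu.symm.le)) hκ0
    filter_upwards [this] with z hz
    by_cases h : z = z₀
    · rw [h]
    · exact hz h
  have hQd : ∀ᶠ z in nhds z₀, DifferentiableAt ℂ Q z := by
    obtain ⟨s, hs, hso, hsz⟩ := _root_.eventually_nhds_iff.1 hH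
    have hd : DifferentiableOn ℂ H s := fun z hz => (hs z hz).differentiableWithinAt
    filter_upwards [hP'ne, hso.mem_nhds hsz] with z h1 h2
    have h3 := (hd.deriv hso).differentiableAt (hso.mem_nhds h2)
    have h4 := hs z h2
    have h5 : DifferentiableAt ℂ P z := by fun_prop
    have h6 : DifferentiableAt ℂ P' z := by fun_prop
    exact (h3.mul (h5.pow 2)).div (h6.pow 2) (pow_ne_zero 2 h1)
  have hQeq := Complex.eventually_eq_of_isLocalMax_norm hQd hQmax
  have hderiv : deriv H z₀ ≠ 0 := by
    intro h
    simp only [h, norm_zero, zero_mul, zero_div] at hc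
    linarith
  have hQ0 : Q z₀ ≠ 0 := by
    have hP0 : P z₀ ≠ 0 := by rw [← norm_pos_iff, hPz]; exact hz1
    exact div_ne_zero (mul_ne_zero hderiv (pow_ne_zero 2 hP0)) (pow_ne_zero 2 hP'0)
  have hfalse : ∀ᶠ z in nhdsWithin z₀ {z₀}ᶜ, False := by
    filter_upwards [hexp, hmax.filter_mono nhdsWithin_le_nhds,
      hHlt.filter_mono nhdsWithin_le_nhds, hP'ne.filter_mono nhdsWithin_le_nhds,
      hQeq.filter_mono nhdsWithin_le_nhds] with z h1 h2 h3 h4 h5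
    have hd : deriv H z ≠ 0 := by
      intro h
      apply hQ0
      rw [← h5]
      simp [hQ, h]
    have h6 := mul_lt_mul_of_pos_left (hratio z h3 h4 h1)
      (mul_pos (norm_pos_iff.2 hd) hκ0)
    rw [← hQn, ← hform z h3 h4, h5, hQu] at h6
    exact absurd h2 (not_le.2 h6)
  exact hfalse.exists.elim fun _ h => h

theorem sqrt_mul_six_sub_le {d e : ℝ} (hd : 0 ≤ d) (hde : d ≤ e) (he : e ≤ 2) :
    √d * (6 - d) ≤ √e * (6 - e) := by
  have h1 := Real.sq_sqrt hd
  have h2 := Real.sq_sqrt (hd.trans hde)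
  have h3 := Real.sqrt_le_sqrt hde
  have h0 := Real.sqrt_nonneg d
  set x := √d
  set y := √e
  rw [← h1, ← h2]
  have h4 : y ^ 2 + x * y + x ^ 2 ≤ 6 := by nlinarith
  nlinarith [mul_nonneg (sub_nonneg.2 h3) (sub_nonneg.2 h4)]

/-- The hyperbolic derivative at a local maximum, for the metric of a twofold branched disk of
radius `6` around an omitted value `p`. -/
theorem branched_hyperbolic_deriv_le {R : ℝ} {G : ℂ → ℂ} (hG : DifferentiableOn ℂ G (ball 0 R))
    {p : ℂ} (hp : ∀ z ∈ ball (0:ℂ) R, G z ≠ p) {z₀ : ℂ} (hz₀R : z₀ ∈ ball (0:ℂ) R)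
    (hz₀ : ‖z₀‖ < 1) (hd₀ : ‖G z₀ - p‖ < 2)
    (hmax : IsLocalMax (fun z => ‖deriv G z‖ * (1 - ‖z‖ ^ 2) /
      (√‖G z - p‖ * (6 - ‖G z - p‖))) z₀) :
    ‖deriv G z₀‖ * (1 - ‖z₀‖ ^ 2) / (√‖G z₀ - p‖ * (6 - ‖G z₀ - p‖)) ≤ 2 / √6 := by
  have h0 : ∀ z ∈ ball (0:ℂ) R, (G z - p) / 6 ≠ 0 := fun z hz =>
    div_ne_zero (sub_ne_zero.2 (hp z hz)) (by norm_num)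
  obtain ⟨L, hL, -, hexp⟩ := exists_log_of_differentiableOn_ball
    ((hG.sub_const p).div_const 6) h0 hz₀R (exp_log (h0 z₀ hz₀R))
  set H : ℂ → ℂ := fun z => exp (L z / 2) with hH
  have hHd : DifferentiableOn ℂ H (ball 0 R) := (hL.div_const 2).cexp
  have hH2 : ∀ z ∈ ball (0:ℂ) R, H z ^ 2 = (G z - p) / 6 := by
    intro z hz
    rw [← hexp z hz, hH, ← exp_nat_mul]
    congr 1
    push_cast
    ring
  have hHn : ∀ z ∈ ball (0:ℂ) R, ‖H z‖ ^ 2 = ‖G z - p‖ / 6 := by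
    intro z hz
    rw [← norm_pow, hH2 z hz, norm_div]
    norm_num
  have hHd' : ∀ z ∈ ball (0:ℂ) R, 2 * H z * deriv H z = deriv G z / 6 := by
    intro z hz
    have hn := isOpen_ball.mem_nhds hz
    have h1 := ((hHd z hz).differentiableAt hn).hasDerivAt.pow 2
    have h2 := (((hG z hz).differentiableAt hn).hasDerivAt.sub_const p).div_const 6
    have h3 : (fun z => H z ^ 2) =ᶠ[nhds z] fun z => (G z - p) / 6 := by
      filter_upwards [hn] with w hw using hH2 w hw
    have := (h2.congr_of_eventuallyEq h3).unique h1
    rw [this]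
    simp
  have key : ∀ z ∈ ball (0:ℂ) R, ‖G z - p‖ < 6 →
      ‖deriv H z‖ * (1 - ‖z‖ ^ 2) / (1 - ‖H z‖ ^ 2) =
      ‖deriv G z‖ * (1 - ‖z‖ ^ 2) / (√‖G z - p‖ * (6 - ‖G z - p‖)) * (√6 / 2) := by
    intro z hz hlt
    have e1 : 0 < ‖G z - p‖ := norm_pos_iff.2 (sub_ne_zero.2 (hp z hz))
    have e2 : 0 < ‖H z‖ := norm_pos_iff.2 (exp_ne_zero _)
    have e3 : √‖G z - p‖ = √6 * ‖H z‖ := by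
      rw [← Real.sqrt_sq e2.le, ← Real.sqrt_mul (by norm_num), hHn z hz]
      congr 1
      ring
    have e4 : 2 * ‖H z‖ * ‖deriv H z‖ = ‖deriv G z‖ / 6 := by
      have := congrArg norm (hHd' z hz)
      simpa using this
    have e5 : ‖deriv G z‖ = 12 * ‖H z‖ * ‖deriv H z‖ := by linarith
    have e6 : ‖G z - p‖ = 6 * ‖H z‖ ^ 2 := by rw [hHn z hz]; ring
    have e7 : 0 < 1 - ‖H z‖ ^ 2 := by linarith
    rw [e3, e5, e6]
    have : 6 - 6 * ‖H z‖ ^ 2 = 6 * (1 - ‖H z‖ ^ 2) := by ring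
    rw [this]
    have : 0 < √(6:ℝ) := by positivity
    field_simp
    ring
  have hnear : ∀ᶠ z in nhds z₀, z ∈ ball (0:ℂ) R ∧ ‖G z - p‖ < 6 := by
    have hc : ContinuousAt G z₀ := (hG.continuousOn).continuousAt (isOpen_ball.mem_nhds hz₀R)
    exact (isOpen_ball.eventually_mem hz₀R).and
      ((hc.sub continuousAt_const).norm.eventually_lt_const (hd₀.trans (by norm_num)))
  have hle := hyperbolic_deriv_le_one_of_isLocalMax (H := H) (z₀ := z₀)
    (by filter_upwards [isOpen_ball.mem_nhds hz₀R] with z hz using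
        (hHd z hz).differentiableAt (isOpen_ball.mem_nhds hz)) hz₀
    (by
      have := hHn z₀ hz₀R
      nlinarith [norm_nonneg (H z₀)])
    (by
      filter_upwards [hmax, hnear] with z h1 h2
      rw [key z h2.1 h2.2, key z₀ hz₀R (by linarith)]
      exact mul_le_mul_of_nonneg_right h1 (by positivity))
  rw [key z₀ hz₀R (by linarith)] at hle
  rw [le_div_iff₀ (by positivity)]
  linarith

/-- A Bloch-type bound, for functions holomorphic beyond the closed unit disk. -/
theorem deriv_mul_le_of_forall_notMem_of_one_lt {R : ℝ} (hR : 1 < R) {G : ℂ → ℂ}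
    (hG : DifferentiableOn ℂ G (ball 0 R)) {S : Set ℂ} (hS : IsClosed S)
    (hdense : ∀ w : ℂ, ∃ p ∈ S, ‖w - p‖ < 2) (hGS : ∀ z ∈ ball (0:ℂ) R, G z ∉ S)
    {z : ℂ} (hz : ‖z‖ < 1) : ‖deriv G z‖ * (1 - ‖z‖ ^ 2) ≤ 5 := by
  have hne : S.Nonempty := let ⟨p, hp, _⟩ := hdense 0; ⟨p, hp⟩
  have hd2 : ∀ w, infDist w S < 2 := by
    intro w
    obtain ⟨p, hp, h⟩ := hdense w
    exact (infDist_le_dist_of_mem hp).trans_lt (by rwa [dist_eq_norm])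
  have hdpos : ∀ z ∈ ball (0:ℂ) R, 0 < infDist (G z) S := fun z hz =>
    (hS.notMem_iff_infDist_pos hne).1 (hGS z hz)
  have hsub : closedBall (0:ℂ) 1 ⊆ ball 0 R := closedBall_subset_ball hR
  set h : ℂ → ℝ := fun z => √(infDist (G z) S) * (6 - infDist (G z) S) with hh
  have hhpos : ∀ z ∈ ball (0:ℂ) R, 0 < h z := fun z hz =>
    mul_pos (Real.sqrt_pos.2 (hdpos z hz)) (by linarith [hd2 (G z)])
  set u : ℂ → ℝ := fun z => ‖deriv G z‖ * (1 - ‖z‖ ^ 2) / h z with hu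
  have hGc : ContinuousOn G (closedBall 0 1) := hG.continuousOn.mono hsub
  have hdc : ContinuousOn (fun z => infDist (G z) S) (closedBall 0 1) :=
    (continuous_infDist_pt S).comp_continuousOn hGc
  have huc : ContinuousOn u (closedBall 0 1) := by
    have h1 : ContinuousOn (deriv G) (closedBall 0 1) :=
      (hG.deriv isOpen_ball).continuousOn.mono hsub
    refine ContinuousOn.div (h1.norm.mul (by fun_prop)) ?_ fun z hz => (hhpos z (hsub hz)).ne'
    exact hdc.sqrt.mul (continuousOn_const.sub hdc)
  obtain ⟨z₀, hz₀, hmax⟩ := (isCompact_closedBall (0:ℂ) 1).exists_isMaxOn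
    ⟨0, by simp⟩ huc
  have hbound : u z₀ ≤ 2 / √6 := by
    rcases (mem_closedBall_zero_iff.1 hz₀).lt_or_eq with hlt | heq
    · obtain ⟨p, hp, hpd⟩ := hS.exists_infDist_eq_dist hne (G z₀)
      rw [dist_eq_norm] at hpd
      have hd₀ : ‖G z₀ - p‖ < 2 := hpd ▸ hd2 (G z₀)
      have hu₀ : u z₀ = ‖deriv G z₀‖ * (1 - ‖z₀‖ ^ 2) /
        (√‖G z₀ - p‖ * (6 - ‖G z₀ - p‖)) := by simp only [hu, hh, hpd]
      rw [hu₀]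
      refine branched_hyperbolic_deriv_le hG (fun z hz e => hGS z hz (e ▸ hp)) (hsub hz₀) hlt
        hd₀ ?_
      have hnear : ∀ᶠ z in nhds z₀, ‖G z - p‖ < 2 :=
        (((hG.continuousOn).continuousAt (isOpen_ball.mem_nhds (hsub hz₀))).sub
          continuousAt_const).norm.eventually_lt_const hd₀
      have hb : ∀ᶠ z in nhds z₀, z ∈ ball (0:ℂ) 1 :=
        isOpen_ball.mem_nhds (mem_ball_zero_iff.2 hlt)
      filter_upwards [hnear, hb] with z h1 h2
      have h3 := ball_subset_closedBall h2
      rw [← hu₀]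
      refine le_trans ?_ (hmax h3)
      have h4 : infDist (G z) S ≤ ‖G z - p‖ := by
        rw [← dist_eq_norm]; exact infDist_le_dist_of_mem hp
      have h5 : 0 ≤ 1 - ‖z‖ ^ 2 := by
        nlinarith [norm_nonneg z, mem_ball_zero_iff.1 h2]
      exact div_le_div_of_nonneg_left (by positivity) (hhpos z (hsub h3))
        (sqrt_mul_six_sub_le infDist_nonneg h4 h1.le)
    · have : u z₀ = 0 := by simp [hu, heq]
      rw [this]
      positivity
  have hzb : z ∈ closedBall (0:ℂ) 1 := mem_closedBall_zero_iff.2 hz.le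
  have h1 : u z ≤ 2 / √6 := (hmax hzb).trans hbound
  have h2 : h z ≤ √2 * (6 - 2) := sqrt_mul_six_sub_le infDist_nonneg (hd2 _).le le_rfl
  rw [hu, div_le_iff₀ (hhpos z (hsub hzb))] at h1
  refine h1.trans ((mul_le_mul_of_nonneg_left h2 (by positivity)).trans ?_)
  have h6 : √(6:ℝ) = √2 * √3 := by rw [← Real.sqrt_mul (by norm_num)]; norm_num
  have h3 : (1.6:ℝ) ≤ √3 := Real.le_sqrt_of_sq_le (by norm_num)
  have h7 : 0 < √(2:ℝ) := by positivity
  rw [h6, div_mul_eq_mul_div, div_le_iff₀ (by positivity)]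
  nlinarith

/-- A Bloch-type bound: a holomorphic function on the unit disk omitting a closed set which meets
every open disk of radius `2` has hyperbolic derivative bounded by `5`. -/
theorem deriv_mul_le_of_forall_notMem {G : ℂ → ℂ}
    (hG : DifferentiableOn ℂ G (ball 0 1)) {S : Set ℂ} (hS : IsClosed S)
    (hdense : ∀ w : ℂ, ∃ p ∈ S, ‖w - p‖ < 2) (hGS : ∀ z ∈ ball (0:ℂ) 1, G z ∉ S)
    {z : ℂ} (hz : ‖z‖ < 1) : ‖deriv G z‖ * (1 - ‖z‖ ^ 2) ≤ 5 := by
  have hscale : ∀ t : ℝ, ‖z‖ < t → t < 1 → t * ‖deriv G z‖ * (1 - (‖z‖ / t) ^ 2) ≤ 5 := by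
    intro t ht ht1
    have ht0 : 0 < t := (norm_nonneg z).trans_lt ht
    have htC : (t : ℂ) ≠ 0 := by exact_mod_cast ht0.ne'
    have hmaps : ∀ ζ ∈ ball (0:ℂ) t⁻¹, (t : ℂ) * ζ ∈ ball (0:ℂ) 1 := by
      intro ζ hζ
      rw [mem_ball_zero_iff] at hζ ⊢
      rw [norm_mul, norm_real, Real.norm_of_nonneg ht0.le]
      calc t * ‖ζ‖ < t * t⁻¹ := by gcongr
        _ = 1 := mul_inv_cancel₀ ht0.ne'
    have hd : DifferentiableOn ℂ (fun ζ => G (t * ζ)) (ball 0 t⁻¹) :=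
      hG.comp (by fun_prop) hmaps
    have := deriv_mul_le_of_forall_notMem_of_one_lt ((one_lt_inv₀ ht0).2 ht1) hd hS hdense
      (fun ζ hζ => hGS _ (hmaps ζ hζ)) (z := z / t)
      (by rw [norm_div, norm_real, Real.norm_of_nonneg ht0.le, div_lt_one ht0]; exact ht)
    rw [deriv_comp_mul_left, mul_div_cancel₀ _ htC, norm_smul, norm_div, norm_real,
      Real.norm_of_nonneg ht0.le] at this
    exact this
  have hlim : Tendsto (fun t : ℝ => t * ‖deriv G z‖ * (1 - (‖z‖ / t) ^ 2)) (nhdsWithin 1 (Iio 1))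
      (nhds (1 * ‖deriv G z‖ * (1 - (‖z‖ / 1) ^ 2))) := by
    refine ContinuousAt.tendsto (f := fun t : ℝ => t * ‖deriv G z‖ * (1 - (‖z‖ / t) ^ 2)) ?_
      |>.mono_left nhdsWithin_le_nhds
    exact (continuousAt_id.mul continuousAt_const).mul
      (continuousAt_const.sub ((continuousAt_const.div continuousAt_id one_ne_zero).pow 2))
  rw [one_mul, div_one] at hlim
  refine le_of_tendsto hlim ?_
  filter_upwards [Ioo_mem_nhdsLT hz] with t ht using hscale t ht.1 ht.2

theorem arsinh_sqrt_add_one_le {x : ℝ} (hx : 0 ≤ x) :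
    Real.arsinh √(x + 1) ≤ Real.arsinh √x + 1 := by
  rw [← Real.sinh_le_sinh, Real.sinh_arsinh, Real.sinh_add, Real.sinh_arsinh, Real.cosh_arsinh,
    Real.sq_sqrt hx, add_comm 1 x]
  have h1 : 1 ≤ Real.sinh 1 := Real.self_le_sinh_iff.2 zero_le_one
  have h2 := Real.sqrt_nonneg (x + 1)
  have h3 := mul_nonneg (Real.sqrt_nonneg x) (Real.cosh_pos 1).le
  nlinarith

theorem exists_nat_abs_sub_two_mul_arsinh_sqrt_le {x : ℝ} (hx : 0 ≤ x) :
    ∃ m : ℕ, |x - 2 * Real.arsinh √m| ≤ 1 := by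
  set m := ⌊Real.sinh (x / 2) ^ 2⌋₊
  have hs : 0 ≤ Real.sinh (x / 2) := Real.sinh_nonneg_iff.2 (by linarith)
  have h1 : Real.arsinh √m ≤ x / 2 := by
    rw [← Real.sinh_le_sinh, Real.sinh_arsinh]
    exact Real.sqrt_le_left hs |>.2 (Nat.floor_le (sq_nonneg _))
  have h2 : x / 2 < Real.arsinh √((m + 1 : ℕ) : ℝ) := by
    rw [← Real.sinh_lt_sinh, Real.sinh_arsinh]
    refine Real.lt_sqrt hs |>.2 ?_
    push_cast
    exact Nat.lt_floor_add_one _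
  have h3 : Real.arsinh √((m + 1 : ℕ) : ℝ) ≤ Real.arsinh √m + 1 := by
    push_cast
    exact arsinh_sqrt_add_one_le (Nat.cast_nonneg m)
  rcases le_total x (2 * Real.arsinh √m + 1) with h | h
  · exact ⟨m, abs_le.2 ⟨by linarith, by linarith⟩⟩
  · exact ⟨m + 1, abs_le.2 ⟨by linarith, by linarith⟩⟩

theorem cosh_two_mul_arsinh_sqrt (m : ℕ) : Real.cosh (2 * Real.arsinh √m) = 2 * m + 1 := by
  rw [Real.cosh_two_mul, Real.cosh_sq, Real.sinh_arsinh, Real.sq_sqrt (Nat.cast_nonneg m)]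
  ring

theorem exp_pi_mul_I_mul_odd (n : ℤ) : exp (Real.pi * I * (2 * n + 1)) = -1 := by
  have : (Real.pi * I * (2 * n + 1) : ℂ) = Real.pi * I + n * (2 * Real.pi * I) := by ring
  rw [this, exp_add, exp_pi_mul_I, exp_int_mul_two_pi_mul_I, mul_one]

/-- The points at which `cosh` is an odd integer meet every disk of radius `2`. -/
theorem exists_exp_cosh_eq_neg_one (w : ℂ) :
    ∃ p ∈ {p : ℂ | exp (Real.pi * I * cosh p) = -1}, ‖w - p‖ < 2 := by
  obtain ⟨m, hm⟩ := exists_nat_abs_sub_two_mul_arsinh_sqrt_le (abs_nonneg w.re)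
  obtain ⟨x, hx, hxw⟩ : ∃ x : ℝ, Real.cosh x = 2 * m + 1 ∧ |w.re - x| ≤ 1 := by
    rcases abs_cases w.re with ⟨h, -⟩ | ⟨h, -⟩
    · exact ⟨_, cosh_two_mul_arsinh_sqrt m, h ▸ hm⟩
    · refine ⟨-(2 * Real.arsinh √m), by rw [Real.cosh_neg, cosh_two_mul_arsinh_sqrt], ?_⟩
      rw [← abs_neg]
      convert hm using 2
      rw [h]
      ring
  set k : ℤ := round (w.im / Real.pi)
  have hk : |w.im - k * Real.pi| ≤ Real.pi / 2 := by
    have h1 := abs_sub_round (w.im / Real.pi)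
    have h2 : w.im - k * Real.pi = (w.im / Real.pi - k) * Real.pi := by
      field_simp
    rw [h2, abs_mul, abs_of_pos Real.pi_pos]
    nlinarith [Real.pi_pos]
  refine ⟨x + (k * Real.pi : ℝ) * I, ?_, ?_⟩
  · have hc : cosh (x + (k * Real.pi : ℝ) * I) = (2 * m + 1 : ℂ) * (-1) ^ k := by
      rw [cosh_add, cosh_mul_I, sinh_mul_I, ← ofReal_sin, Real.sin_int_mul_pi, ← ofReal_cos,
        Real.cos_int_mul_pi, ← ofReal_cosh, hx]
      push_cast
      ring
    rw [mem_ofPred_eq, hc]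
    rcases k.even_or_odd.imp (fun h => h.neg_one_zpow (α := ℂ))
      (fun h => h.neg_one_zpow (α := ℂ)) with h | h <;> rw [h]
    · convert exp_pi_mul_I_mul_odd m using 2
      push_cast
      ring
    · convert exp_pi_mul_I_mul_odd (-m - 1) using 2
      push_cast
      ring
  · have h1 : ‖w - (x + (k * Real.pi : ℝ) * I)‖ ^ 2 =
        (w.re - x) ^ 2 + (w.im - k * Real.pi) ^ 2 := by
      rw [← normSq_eq_norm_sq, normSq_apply]
      simp
      ring
    have h2 : (w.re - x) ^ 2 ≤ 1 ^ 2 := sq_le_sq' (abs_le.1 hxw).1 (abs_le.1 hxw).2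
    have h3 : (w.im - k * Real.pi) ^ 2 ≤ (Real.pi / 2) ^ 2 :=
      sq_le_sq' (by linarith [(abs_le.1 hk).1]) (abs_le.1 hk).2
    have h4 : Real.pi < 3.15 := Real.pi_lt_d2
    refine lt_of_pow_lt_pow_left₀ 2 (by norm_num) ?_
    rw [h1]
    nlinarith [Real.pi_pos]

theorem norm_sq_sub_one_le {C : ℂ} (hC : |C.re| ≤ 1) : ‖C ^ 2 - 1‖ ≤ (1 + |C.im|) ^ 2 := by
  refine le_of_sq_le_sq ?_ (by positivity)
  rw [← normSq_eq_norm_sq, normSq_apply]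
  have h1 : C.re ^ 2 ≤ 1 := (sq_le_one_iff_abs_le_one _).2 hC
  have h2 := sq_abs C.im
  have h3 := abs_nonneg C.im
  simp [sq C]
  set v := |C.im|
  have h4 : (C.re * C.re - C.im * C.im - 1) * (C.re * C.re - C.im * C.im - 1) +
      (C.re * C.im + C.im * C.re) * (C.re * C.im + C.im * C.re) =
      (1 + v ^ 2) ^ 2 - 2 * C.re ^ 2 + 2 * C.re ^ 2 * v ^ 2 + C.re ^ 2 * C.re ^ 2 := by
    rw [h2]; ring
  rw [h4]
  nlinarith [sq_nonneg C.re, mul_nonneg (sub_nonneg.2 h1) (sq_nonneg v), sq_nonneg v,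
    mul_nonneg (sub_nonneg.2 h1) (sq_nonneg C.re), pow_nonneg h3 3]

/-- A Landau-type theorem: an explicit bound for the hyperbolic derivative of a holomorphic function
on the unit disk omitting `0` and `1`. -/
theorem landau_deriv_bound {f : ℂ → ℂ} (hf : DifferentiableOn ℂ f (ball 0 1))
    (h0 : ∀ z ∈ ball (0:ℂ) 1, f z ≠ 0) (h1 : ∀ z ∈ ball (0:ℂ) 1, f z ≠ 1)
    {z₀ : ℂ} (hz₀ : z₀ ∈ ball (0:ℂ) 1) :
    ‖deriv f z₀‖ * (1 - ‖z₀‖ ^ 2) ≤ 5 * ‖f z₀‖ * (Real.pi + |Real.log ‖f z₀‖|) := by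
  have hpi : (Real.pi * I : ℂ) ≠ 0 := mul_ne_zero (by exact_mod_cast Real.pi_ne_zero) I_ne_zero
  have hn0 : ∀ z ∈ ball (0:ℂ) 1, -f z ≠ 0 := fun z hz => neg_ne_zero.2 (h0 z hz)
  obtain ⟨L, hL, hL0, hLf⟩ := exists_log_of_differentiableOn_ball hf.neg hn0 hz₀
    (exp_log (hn0 z₀ hz₀))
  set C : ℂ → ℂ := fun z => L z / (Real.pi * I) with hC
  have hCd : DifferentiableOn ℂ C (ball 0 1) := hL.div_const _
  have hfC : ∀ z ∈ ball (0:ℂ) 1, f z = -exp (Real.pi * I * C z) := by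
    intro z hz
    rw [hC, mul_div_cancel₀ _ hpi, hLf z hz]
    simp
  have hC1 : ∀ z ∈ ball (0:ℂ) 1, C z ^ 2 - 1 ≠ 0 := by
    intro z hz h
    have h' : (C z - 1) * (C z + 1) = 0 := by linear_combination h
    apply h1 z hz
    rw [hfC z hz]
    rcases mul_eq_zero.1 h' with h | h
    · rw [sub_eq_zero.1 h, mul_one, exp_pi_mul_I, neg_neg]
    · rw [eq_neg_of_add_eq_zero_left h, mul_neg_one, exp_neg, exp_pi_mul_I]
      norm_num
  obtain ⟨M, hM, -, hMC⟩ := exists_log_of_differentiableOn_ball ((hCd.pow 2).sub_const 1) hC1 hz₀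
    (exp_log (hC1 z₀ hz₀))
  set S : ℂ → ℂ := fun z => exp (M z / 2) with hS
  have hSd : DifferentiableOn ℂ S (ball 0 1) := (hM.div_const 2).cexp
  have hS2 : ∀ z ∈ ball (0:ℂ) 1, S z ^ 2 = C z ^ 2 - 1 := by
    intro z hz
    rw [hS, ← exp_nat_mul]
    simpa [mul_div_cancel₀] using hMC z hz
  have hCS : ∀ z ∈ ball (0:ℂ) 1, C z + S z ≠ 0 := by
    intro z hz h
    have := hS2 z hz
    rw [eq_neg_of_add_eq_zero_right h] at this
    have : (1:ℂ) = 0 := by linear_combination this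
    exact one_ne_zero this
  obtain ⟨E, hE, -, hEC⟩ := exists_log_of_differentiableOn_ball (hCd.add hSd) hCS hz₀
    (exp_log (hCS z₀ hz₀))
  have hEneg : ∀ z ∈ ball (0:ℂ) 1, exp (-E z) = C z - S z := by
    intro z hz
    rw [exp_neg, hEC z hz]
    refine inv_eq_of_mul_eq_one_right ?_
    simp only [Pi.add_apply]
    linear_combination -hS2 z hz
  have hcosh : ∀ z ∈ ball (0:ℂ) 1, cosh (E z) = C z := by
    intro z hz
    rw [cosh, hEneg z hz, hEC z hz]
    simp only [Pi.add_apply]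
    ring
  have hsinh : ∀ z ∈ ball (0:ℂ) 1, sinh (E z) = S z := by
    intro z hz
    rw [sinh, hEneg z hz, hEC z hz]
    simp only [Pi.add_apply]
    ring
  have hbloch := deriv_mul_le_of_forall_notMem hE
    (S := {p : ℂ | exp (Real.pi * I * cosh p) = -1})
    (isClosed_eq (by fun_prop) continuous_const) exists_exp_cosh_eq_neg_one
    (fun z hz h => h1 z hz (by
      rw [hfC z hz, ← hcosh z hz, show exp _ = -1 from h, neg_neg])) (mem_ball_zero_iff.1 hz₀)
  have hn := isOpen_ball.mem_nhds hz₀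
  have hderiv : deriv f z₀ = f z₀ * (Real.pi * I) * S z₀ * deriv E z₀ := by
    have e1 : f =ᶠ[nhds z₀] fun z => -exp (Real.pi * I * cosh (E z)) := by
      filter_upwards [hn] with z hz
      rw [hcosh z hz, hfC z hz]
    have e2 := (((hE z₀ hz₀).differentiableAt hn).hasDerivAt.ccosh.const_mul
      (Real.pi * I : ℂ)).cexp.neg
    rw [(e2.congr_of_eventuallyEq e1).deriv, hcosh z₀ hz₀, hsinh z₀ hz₀, hfC z₀ hz₀]
    ring
  have hre : |(C z₀).re| ≤ 1 := by
    have : (C z₀).re = arg (-f z₀) / Real.pi := by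
      have : C z₀ = (L z₀ * (-I)) / (Real.pi : ℝ) := by
        rw [hC]; field_simp; simp
      rw [this, div_ofReal_re, hL0]
      simp [log_im]
    rw [this, abs_div, abs_of_pos Real.pi_pos, div_le_one Real.pi_pos]
    exact abs_arg_le_pi _
  have him : |(C z₀).im| = |Real.log ‖f z₀‖| / Real.pi := by
    have : C z₀ = (L z₀ * (-I)) / (Real.pi : ℝ) := by
      rw [hC]; field_simp; simp
    rw [this, div_ofReal_im, hL0, abs_div, abs_of_pos Real.pi_pos]
    simp [log_re]
  have hSn : ‖S z₀‖ ≤ 1 + |Real.log ‖f z₀‖| / Real.pi := by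
    have := norm_sq_sub_one_le hre
    rw [← hS2 z₀ hz₀, norm_pow, him] at this
    exact le_of_sq_le_sq this (by positivity)
  have hz1 : 0 ≤ 1 - ‖z₀‖ ^ 2 := by
    nlinarith [norm_nonneg z₀, mem_ball_zero_iff.1 hz₀]
  rw [hderiv, norm_mul, norm_mul, norm_mul, norm_mul, norm_I, mul_one, norm_real,
    Real.norm_of_nonneg Real.pi_pos.le]
  calc ‖f z₀‖ * Real.pi * ‖S z₀‖ * ‖deriv E z₀‖ * (1 - ‖z₀‖ ^ 2)
      = ‖f z₀‖ * Real.pi * ‖S z₀‖ * (‖deriv E z₀‖ * (1 - ‖z₀‖ ^ 2)) := by ring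
    _ ≤ ‖f z₀‖ * Real.pi * (1 + |Real.log ‖f z₀‖| / Real.pi) * 5 := by
        exact mul_le_mul (by gcongr) hbloch (mul_nonneg (norm_nonneg _) hz1) (by positivity)
    _ = _ := by
        field_simp

/-- The Poincaré density of a domain is continuous on the domain. -/
theorem IsPoincareDensity.continuousOn {D : Set ℂ} {lam : ℂ → ℝ} (h : IsPoincareDensity D lam) :
    ContinuousOn lam D := by
  obtain ⟨p, hp, hpD, -, hlam⟩ := h
  have hpd : DifferentiableOn ℂ p (ball 0 1) := fun z hz => (hp z hz).differentiableWithinAt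
  rw [← hpD]
  rintro _ ⟨z, hz, rfl⟩
  refine ContinuousAt.continuousWithinAt ?_
  have hpos : ∀ w ∈ ball (0:ℂ) 1, 0 < 1 - ‖w‖ ^ 2 := fun w hw => by
    nlinarith [norm_nonneg w, mem_ball_zero_iff.1 hw]
  have hne : ∀ w ∈ ball (0:ℂ) 1, deriv p w ≠ 0 := by
    intro w hw h
    have h1 := hlam w hw
    rw [h, norm_zero, mul_zero] at h1
    exact (div_pos two_pos (hpos w hw)).ne h1
  have hn := isOpen_ball.mem_nhds hz
  have hstrict : HasStrictDerivAt p (deriv p z) z :=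
    (hpd.analyticAt hn).hasStrictDerivAt
  rw [ContinuousAt, ← hstrict.map_nhds_eq (hne z hz), tendsto_map'_iff]
  have heq : (fun w => 2 / (1 - ‖w‖ ^ 2) / ‖deriv p w‖) =ᶠ[nhds z] lam ∘ p := by
    filter_upwards [hn] with w hw
    rw [← hlam w hw, mul_div_cancel_right₀ _ (norm_ne_zero_iff.2 (hne w hw)), Function.comp_apply]
  have hc : ContinuousAt (fun w => 2 / (1 - ‖w‖ ^ 2) / ‖deriv p w‖) z := by
    have h1 : ContinuousAt (deriv p) z :=
      (hpd.deriv isOpen_ball).continuousOn.continuousAt hn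
    refine ContinuousAt.div (ContinuousAt.div continuousAt_const (by fun_prop) (hpos z hz).ne')
      h1.norm (norm_ne_zero_iff.2 (hne z hz))
  have := hc.tendsto.congr' heq
  rwa [heq.eq_of_nhds, Function.comp_apply] at this

theorem mul_pi_add_abs_log_le {y T : ℝ} (hy : 0 < y) (hyT : y ≤ T) (hT : 1 ≤ T) :
    y * (Real.pi + |Real.log y|) ≤ T * (4 + Real.log T) := by
  have hpi : Real.pi ≤ 4 := Real.pi_le_four
  have hlogT : 0 ≤ Real.log T := Real.log_nonneg hT
  rcases le_total 1 y with h | h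
  · rw [abs_of_nonneg (Real.log_nonneg h)]
    have := Real.log_le_log hy hyT
    have := Real.log_nonneg h
    have := Real.pi_pos
    gcongr
  · rw [abs_of_nonpos (Real.log_nonpos hy.le h)]
    have h1 : -Real.log y ≤ y⁻¹ - 1 := by
      rw [← Real.log_inv]
      exact Real.log_le_sub_one_of_pos (inv_pos.2 hy)
    have h2 : y * -Real.log y ≤ 1 - y := by
      have := mul_le_mul_of_nonneg_left h1 hy.le
      rwa [mul_sub, mul_inv_cancel₀ hy.ne', mul_one] at this
    nlinarith [Real.pi_gt_three]

/-- Lower bound for the Poincaré density of a domain omitting two real points. -/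
theorem IsPoincareDensity.le_of_notMem {D : Set ℂ} {lam : ℂ → ℝ} (h : IsPoincareDensity D lam)
    {a b : ℝ} (hab : a < b) (ha : (a : ℂ) ∉ D) (hb : (b : ℂ) ∉ D) {w : ℂ} (hw : w ∈ D)
    {T : ℝ} (hT : 1 ≤ T) (hwT : ‖w - a‖ ≤ (b - a) * T) :
    2 / (5 * ((b - a) * (T * (4 + Real.log T)))) ≤ lam w := by
  obtain ⟨p, hp, hpD, -, hlam⟩ := h
  have hl : 0 < b - a := sub_pos.2 hab
  have hlC : ((b - a : ℝ) : ℂ) ≠ 0 := by exact_mod_cast hl.ne'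
  have hln : ‖((b - a : ℝ) : ℂ)‖ = b - a := by rw [norm_real, Real.norm_of_nonneg hl.le]
  have hmem : ∀ z ∈ ball (0:ℂ) 1, p z ∈ D := fun z hz => hpD ▸ mem_image_of_mem p hz
  obtain ⟨z, hz, rfl⟩ : w ∈ p '' ball 0 1 := hpD ▸ hw
  have hf0 : ∀ z ∈ ball (0:ℂ) 1, (p z - a) / ((b - a : ℝ) : ℂ) ≠ 0 := fun z hz h => by
    rcases div_eq_zero_iff.1 h with h | h
    · exact ha (sub_eq_zero.1 h ▸ hmem z hz)
    · exact hlC h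
  have hf1 : ∀ z ∈ ball (0:ℂ) 1, (p z - a) / ((b - a : ℝ) : ℂ) ≠ 1 := fun z hz h => by
    rw [div_eq_one_iff_eq hlC, ofReal_sub, sub_left_inj] at h
    exact hb (h ▸ hmem z hz)
  have hbound := landau_deriv_bound (f := fun z => (p z - a) / ((b - a : ℝ) : ℂ))
    (fun z hz => (((hp z hz).sub_const _).div_const _).differentiableWithinAt) hf0 hf1 hz
  have hy : 0 < ‖(p z - a) / ((b - a : ℝ) : ℂ)‖ := norm_pos_iff.2 (hf0 z hz)
  have hyT : ‖(p z - a) / ((b - a : ℝ) : ℂ)‖ ≤ T := by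
    rw [norm_div, hln, div_le_iff₀ hl]
    linarith
  have hmul := mul_pi_add_abs_log_le hy hyT hT
  rw [deriv_div_const, deriv_sub_const, norm_div, hln] at hbound
  have hX : 0 < T * (4 + Real.log T) := by
    have := Real.log_nonneg hT
    positivity
  have hdisk : 0 < 1 - ‖z‖ ^ 2 := by
    nlinarith [norm_nonneg z, mem_ball_zero_iff.1 hz]
  have hle : ‖deriv p z‖ * (1 - ‖z‖ ^ 2) ≤ 5 * ((b - a) * (T * (4 + Real.log T))) := by
    have h1 := hbound.trans (b := _) (c := 5 * (T * (4 + Real.log T))) (by linarith)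
    rw [div_mul_eq_mul_div, div_le_iff₀ hl] at h1
    linarith
  have hlz := hlam z hz
  rw [eq_div_iff hdisk.ne'] at hlz
  have hlpos : 0 ≤ lam (p z) := by
    by_contra! hneg
    have := mul_nonneg (norm_nonneg (deriv p z)) hdisk.le
    nlinarith
  rw [div_le_iff₀ (by positivity), ← hlz, mul_assoc]
  exact mul_le_mul_of_nonneg_left hle hlpos

theorem two_rpow_neg_three_half_le : (2:ℝ) ^ (-(3:ℝ) / 2) ≤ 2 / 5 := by
  refine le_of_sq_le_sq ?_ (by norm_num)
  rw [← Real.rpow_natCast, ← Real.rpow_mul (by norm_num)]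
  norm_num

section CurveLength

variable {E : Type*} [NormedAddCommGroup E] [NormedSpace ℝ E] {γ : ℝ → E}

theorem continuousOn_derivWithin_of_contDiffOn (hγ : ContDiffOn ℝ 1 γ (Icc 0 1)) :
    ContinuousOn (derivWithin γ (Icc 0 1)) (Icc 0 1) :=
  hγ.continuousOn_derivWithin (uniqueDiffOn_Icc zero_lt_one) le_rfl

theorem derivWithin_eqOn_deriv_Ioo : EqOn (derivWithin γ (Icc 0 1)) (deriv γ) (Ioo 0 1) :=
  fun _ ht => derivWithin_of_mem_nhds (Icc_mem_nhds ht.1 ht.2)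

theorem integrableOn_mul_norm_deriv (hγ : ContDiffOn ℝ 1 γ (Icc 0 1)) {g : ℝ → ℝ}
    (hg : ContinuousOn g (Icc 0 1)) :
    MeasureTheory.IntegrableOn (fun t => g t * ‖deriv γ t‖) (Icc 0 1) := by
  rw [integrableOn_Icc_iff_integrableOn_Ioo]
  have h1 : ContinuousOn (fun t => g t * ‖derivWithin γ (Icc 0 1) t‖) (Icc 0 1) :=
    hg.mul (continuousOn_derivWithin_of_contDiffOn hγ).norm
  refine (h1.integrableOn_Icc.mono_set Ioo_subset_Icc_self).congr_fun (fun t ht => ?_)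
    measurableSet_Ioo
  simp only [derivWithin_eqOn_deriv_Ioo ht]

theorem intervalIntegrable_norm_deriv (hγ : ContDiffOn ℝ 1 γ (Icc 0 1)) {t : ℝ}
    (ht : t ∈ Icc (0:ℝ) 1) :
    IntervalIntegrable (fun t => ‖deriv γ t‖) MeasureTheory.volume 0 t := by
  rw [intervalIntegrable_iff_integrableOn_Icc_of_le ht.1]
  have := integrableOn_mul_norm_deriv hγ (g := fun _ => 1) continuousOn_const
  simp only [one_mul] at this
  exact this.mono_set (Icc_subset_Icc_right ht.2)

theorem continuousOn_deriv_Ioo (hγ : ContDiffOn ℝ 1 γ (Icc 0 1)) :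
    ContinuousOn (deriv γ) (Ioo 0 1) :=
  ((continuousOn_derivWithin_of_contDiffOn hγ).mono Ioo_subset_Icc_self).congr
    derivWithin_eqOn_deriv_Ioo.symm

theorem hasDerivAt_integral_norm_deriv (hγ : ContDiffOn ℝ 1 γ (Icc 0 1)) {t : ℝ}
    (ht : t ∈ Ioo (0:ℝ) 1) :
    HasDerivAt (fun t => ∫ x in (0:ℝ)..t, ‖deriv γ x‖) ‖deriv γ t‖ t :=
  intervalIntegral.integral_hasDerivAt_right
    (intervalIntegrable_norm_deriv hγ (Ioo_subset_Icc_self ht))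
    ((continuousOn_deriv_Ioo hγ).norm.stronglyMeasurableAtFilter isOpen_Ioo t ht)
    ((continuousOn_deriv_Ioo hγ).norm.continuousAt (isOpen_Ioo.mem_nhds ht))

theorem continuousOn_integral_norm_deriv (hγ : ContDiffOn ℝ 1 γ (Icc 0 1)) :
    ContinuousOn (fun t => ∫ x in (0:ℝ)..t, ‖deriv γ x‖) (Icc 0 1) := by
  have := integrableOn_mul_norm_deriv hγ (g := fun _ => 1) continuousOn_const
  simp only [one_mul] at this
  rw [← uIcc_of_le (zero_le_one (α := ℝ))] at this ⊢
  exact intervalIntegral.continuousOn_primitive_interval this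

theorem norm_sub_le_integral_norm_deriv [CompleteSpace E] (hγ : ContDiffOn ℝ 1 γ (Icc 0 1))
    {t : ℝ} (ht : t ∈ Icc (0:ℝ) 1) : ‖γ t - γ 0‖ ≤ ∫ x in (0:ℝ)..t, ‖deriv γ x‖ := by
  have hint : IntervalIntegrable (deriv γ) MeasureTheory.volume 0 t := by
    rw [intervalIntegrable_iff_integrableOn_Ioo_of_le ht.1]
    have hsub : Ioo 0 t ⊆ Ioo (0:ℝ) 1 := Ioo_subset_Ioo_right ht.2
    exact ((continuousOn_derivWithin_of_contDiffOn hγ).integrableOn_Icc.mono_set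
      (hsub.trans Ioo_subset_Icc_self)).congr_fun (derivWithin_eqOn_deriv_Ioo.mono hsub)
      measurableSet_Ioo
  have hderiv : ∀ x ∈ Ioo 0 t, HasDerivAt γ (deriv γ x) x := fun x hx =>
    ((hγ.differentiableOn one_ne_zero).differentiableAt
      (Icc_mem_nhds hx.1 (hx.2.trans_le ht.2))).hasDerivAt
  rw [← intervalIntegral.integral_eq_sub_of_hasDerivAt_of_le ht.1
    (hγ.continuousOn.mono (Icc_subset_Icc_right ht.2)) hderiv hint]
  exact intervalIntegral.norm_integral_le_integral_norm ht.1

end CurveLength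

/-- Lemma 4.3(2): the Poincaré length of a curve of Euclidean length `s` starting on a
component `(aₙ, bₙ)` of `D ∩ ℝ` with `bₙ - aₙ ≤ r` is at least
`2^(-3/2)·log(1 + k₀⁻¹·log(1 + s/r))`, where `k₀ = 4 + log(3 + 2√2)`. -/
theorem poincare_length_lower_bound
    (D : Set ℂ) (hD : IsDenjoyDomain D)
    (lam : ℂ → ℝ) (hlam : IsPoincareDensity D lam)
    (an bn r : ℝ) (hr : 0 < r) (hanbn : an < bn) (hlen : bn - an ≤ r)
    (hcomp : Ioo an bn ⊆ (fun x : ℝ => (x : ℂ)) ⁻¹' D)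
    (hend₁ : (an : ℂ) ∉ D) (hend₂ : (bn : ℂ) ∉ D)
    (γ : ℝ → ℂ) (hγ : ContDiffOn ℝ 1 γ (Icc 0 1))
    (hmem : ∀ t ∈ Icc (0:ℝ) 1, γ t ∈ D)
    (hstart : (γ 0).im = 0 ∧ (γ 0).re ∈ Ioo an bn)
    (s : ℝ) (hs : s = ∫ t in (0:ℝ)..1, ‖deriv γ t‖) :
    2 ^ (-(3:ℝ)/2) *
        Real.log (1 + (4 + Real.log (3 + 2 * Real.sqrt 2))⁻¹ * Real.log (1 + s / r))
      ≤ curveLen lam γ := by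
  have hl : 0 < bn - an := sub_pos.2 hanbn
  set l := bn - an with hldef
  set k := 4 + Real.log (3 + 2 * √2) with hk
  have hk4 : 4 ≤ k := by
    have : 0 ≤ Real.log (3 + 2 * √2) := Real.log_nonneg (by linarith [Real.sqrt_nonneg 2])
    linarith
  set c : ℝ := 2 ^ (-(3:ℝ)/2) with hc
  have hc0 : 0 ≤ c := by positivity
  set L : ℝ → ℝ := fun t => ∫ x in (0:ℝ)..t, ‖deriv γ x‖ with hL
  have hL0 : ∀ t ∈ Icc (0:ℝ) 1, 0 ≤ L t := fun t ht =>
    intervalIntegral.integral_nonneg ht.1 fun _ _ => norm_nonneg _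
  have hLc : ContinuousOn L (Icc 0 1) := continuousOn_integral_norm_deriv hγ
  set T : ℝ → ℝ := fun t => 1 + L t / l with hT
  have hT1 : ∀ t ∈ Icc (0:ℝ) 1, 1 ≤ T t := fun t ht =>
    le_add_of_nonneg_right (div_nonneg (hL0 t ht) hl.le)
  have hlogT : ∀ t ∈ Icc (0:ℝ) 1, 0 ≤ Real.log (T t) := fun t ht => Real.log_nonneg (hT1 t ht)
  have hinner : ∀ t ∈ Icc (0:ℝ) 1, 1 ≤ 1 + k⁻¹ * Real.log (T t) := fun t ht =>
    le_add_of_nonneg_right (mul_nonneg (by positivity) (hlogT t ht))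
  set Φ : ℝ → ℝ := fun t => c * Real.log (1 + k⁻¹ * Real.log (T t)) with hΦ
  have hΦ0 : Φ 0 = 0 := by simp [hΦ, hT, hL]
  have hmono : c * Real.log (1 + k⁻¹ * Real.log (1 + s / r)) ≤ Φ 1 := by
    have hs0 : 0 ≤ s := hs ▸ hL0 1 (by simp)
    have h1 : s / r ≤ L 1 / l := by
      rw [hs]
      exact div_le_div_of_nonneg_left (hL0 1 (by simp)) hl hlen
    have h2 : 0 ≤ s / r := by positivity
    have h3 : 0 ≤ Real.log (1 + s / r) := Real.log_nonneg (by linarith)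
    simp only [hΦ, hT]
    gcongr
  have hTc : ContinuousOn T (Icc 0 1) := continuousOn_const.add (hLc.div_const l)
  have hΦc : ContinuousOn Φ (Icc 0 1) := by
    refine continuousOn_const.mul (ContinuousOn.log ?_ fun t ht => by linarith [hinner t ht])
    exact continuousOn_const.add (continuousOn_const.mul
      (hTc.log fun t ht => by linarith [hT1 t ht]))
  have hderiv : ∀ t ∈ Ioo (0:ℝ) 1, HasDerivWithinAt Φ
      (c * (k⁻¹ * (‖deriv γ t‖ / l / T t) / (1 + k⁻¹ * Real.log (T t)))) (Ioi t) t := by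
    intro t ht
    have ht' := Ioo_subset_Icc_self ht
    have h1 : HasDerivAt T (‖deriv γ t‖ / l) t :=
      ((hasDerivAt_integral_norm_deriv hγ ht).div_const l).const_add 1
    exact ((((h1.log (by linarith [hT1 t ht'])).const_mul k⁻¹).const_add 1).log
      (by linarith [hinner t ht'])).const_mul c |>.hasDerivWithinAt
  have hγc : ContinuousOn γ (Icc 0 1) := hγ.continuousOn
  have hint := integrableOn_mul_norm_deriv hγ (hlam.continuousOn.comp hγc hmem)
  have hle := intervalIntegral.sub_le_integral_of_hasDeriv_right_of_le zero_le_one hΦc hderiv hint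
    (by
      intro t ht
      have ht' := Ioo_subset_Icc_self ht
      have hstart' : ‖γ 0 - an‖ ≤ l := by
        have : γ 0 - an = ((γ 0).re - an : ℝ) := by
          apply Complex.ext <;> simp [hstart.1]
        rw [this, norm_real, Real.norm_of_nonneg (sub_nonneg.2 hstart.2.1.le)]
        linarith [hstart.2.2]
      have hdist : ‖γ t - an‖ ≤ l * T t := by
        have h1 : γ t - an = (γ t - γ 0) + (γ 0 - an) := by ring
        have h2 : l * T t = L t + l := by simp only [hT]; field_simp; ring
        rw [h1, h2]
        exact (norm_add_le _ _).trans (add_le_add (norm_sub_le_integral_norm_deriv hγ ht') hstart')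
      have hlow := hlam.le_of_notMem hanbn hend₁ hend₂ (hmem t ht') (hT1 t ht') hdist
      have hTpos : 0 < T t := by linarith [hT1 t ht']
      have hlog := hlogT t ht'
      have hkpos : 0 < k := by linarith
      have hrew : c * (k⁻¹ * (‖deriv γ t‖ / l / T t) / (1 + k⁻¹ * Real.log (T t))) =
          c / (l * (T t * (k + Real.log (T t)))) * ‖deriv γ t‖ := by
        have : k + Real.log (T t) ≠ 0 := by positivity
        field_simp
      rw [hrew]
      refine mul_le_mul_of_nonneg_right (le_trans ?_ hlow) (norm_nonneg _)
      rw [← div_div 2 5]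
      have := two_rpow_neg_three_half_le
      gcongr)
  rw [hΦ0, sub_zero] at hle
  exact hmono.trans hle

end
end
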